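/- Let (G, S, L) be a canvas in which S has exactly two components: a path P and an isolated vertex u with |L(u)| ≥ 2. Assume that if |V(P)| ≥ 2, then G is 2-connected, u is not adjacent to any internal vertex of P, and there is no chord of the outer walk of G with an end in P that separates a vertex of P from u. Let L₀ be a set of size two and suppose L(v) = L₀ for all v ∈ V(P). Then G has an L-coloring, unless L(u) = L₀ and V(S) induces an odd cycle in G. -/

import Mathlib

open Set Topology

/-- A plane embedding (drawing) of a simple graph: vertices are distinct points of the
plane and each edge is drawn as a simple arc joining the images of its endpoints;
an arc passes through no vertex other than its endpoints, and two distinct arcs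
meet only at images of common endpoints. -/
structure PlaneEmbedding {V : Type*} (G : SimpleGraph V) where
  pos : V → ℝ × ℝ
  arc : Sym2 V → Set (ℝ × ℝ)
  pos_inj : Function.Injective pos
  arc_is_arc : ∀ e ∈ G.edgeSet, ∃ γ : ℝ → ℝ × ℝ,
    ContinuousOn γ (Icc 0 1) ∧ InjOn γ (Icc 0 1) ∧ γ '' (Icc 0 1) = arc e ∧
    ∀ u v : V, e = s(u, v) → ({γ 0, γ 1} : Set (ℝ × ℝ)) = {pos u, pos v}
  arc_inter_pos : ∀ e ∈ G.edgeSet, ∀ v : V, pos v ∈ arc e → v ∈ e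
  arc_inter_arc : ∀ e ∈ G.edgeSet, ∀ f ∈ G.edgeSet, e ≠ f →
    ∀ p ∈ arc e ∩ arc f, ∃ v : V, v ∈ e ∧ v ∈ f ∧ pos v = p

namespace PlaneEmbedding

variable {V : Type*} {G : SimpleGraph V} (E : PlaneEmbedding G)

/-- The point set of the drawing. -/
def image : Set (ℝ × ℝ) := Set.range E.pos ∪ ⋃ e ∈ G.edgeSet, E.arc e

/-- The outer (unbounded) face: the set of points of the complement of the drawing
whose connected component in the complement is unbounded. -/
def outerFace : Set (ℝ × ℝ) :=
  {x | x ∉ E.image ∧ ¬ Bornology.IsBounded (connectedComponentIn E.imageᶜ x)}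

/-- A vertex is incident with the outer face if its image lies in the closure of
the outer face. -/
def IncOuter (v : V) : Prop := E.pos v ∈ closure E.outerFace

/-- `C` is the outer cycle of the drawing: a cycle in `G` whose drawing is exactly
the boundary of the outer face. -/
def IsOuterCycle {w : V} (C : G.Walk w w) : Prop :=
  C.IsCycle ∧ (⋃ e ∈ C.edges, E.arc e) = frontier E.outerFace

end PlaneEmbedding

/-- `φ` is a proper coloring of `G` from the lists `L`. -/
def IsLColoring {V : Type*} (G : SimpleGraph V) (L : V → Finset ℕ) (φ : V → ℕ) : Prop :=
  (∀ v : V, φ v ∈ L v) ∧ ∀ ⦃u w : V⦄, G.Adj u w → φ u ≠ φ w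

/-- `(G, S, L)` (with drawing `E`) is a canvas: `S` is a subgraph of the boundary of
the outer face, lists are nonempty, have size at least `5` off the outer face, size
at least `3` outside `S`, and `S` has a proper `L`-coloring. -/
def IsCanvas {V : Type*} (G : SimpleGraph V) (E : PlaneEmbedding G) (S : G.Subgraph)
    (L : V → Finset ℕ) : Prop :=
  (∀ v : V, (L v).Nonempty) ∧
  (∀ v ∈ S.verts, E.pos v ∈ frontier E.outerFace) ∧
  (∀ e ∈ S.edgeSet, E.arc e ⊆ frontier E.outerFace) ∧
  (∀ v : V, ¬ E.IncOuter v → 5 ≤ (L v).card) ∧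
  (∀ v : V, v ∉ S.verts → 3 ≤ (L v).card) ∧
  (∃ φ : V → ℕ, (∀ v ∈ S.verts, φ v ∈ L v) ∧ ∀ ⦃x y : V⦄, S.Adj x y → φ x ≠ φ y)

/-- A canvas is critical if `G` is not `L`-colorable but deleting any edge not in `S`
yields an `L`-colorable graph. -/
def IsCritical {V : Type*} (G : SimpleGraph V) (S : SimpleGraph.Subgraph G)
    (L : V → Finset ℕ) : Prop :=
  (¬ ∃ φ : V → ℕ, IsLColoring G L φ) ∧
  ∀ e ∈ G.edgeSet, e ∉ S.edgeSet →
    ∃ φ : V → ℕ, IsLColoring (G.deleteEdges {e}) L φ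

/-- `v` is a cutvertex of `G`: some two vertices distinct from `v` are connected in
`G`, but every walk between them passes through `v`. -/
def IsCutvertex {V : Type*} (G : SimpleGraph V) (v : V) : Prop :=
  ∃ x y : V, x ≠ v ∧ y ≠ v ∧ G.Reachable x y ∧ ∀ W : G.Walk x y, v ∈ W.support

/-- `G` is 2-connected: connected with no cutvertex. -/
def TwoConnected {V : Type*} (G : SimpleGraph V) : Prop :=
  G.Connected ∧ ∀ v : V, ¬ IsCutvertex G v

/-- The edge `uv` is a chord of the outer walk of the drawing `E`: an edge of `G`
joining two vertices on the boundary of the outer face that is not itself drawn on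
that boundary. -/
def IsChord {V : Type*} {G : SimpleGraph V} (E : PlaneEmbedding G) (u v : V) : Prop :=
  G.Adj u v ∧ E.pos u ∈ frontier E.outerFace ∧ E.pos v ∈ frontier E.outerFace ∧
    ¬ E.arc s(u, v) ⊆ frontier E.outerFace

/-- A cutvertex `v` is essential (with respect to `S`) if whenever `G = G₁ ∪ G₂` with
`V(G₁), V(G₂) ≠ V(G)` and `V(G₁) ∩ V(G₂) = {v}`, neither `Gᵢ` contains all of `V(S)`. -/
def EssentialCutvertex {V : Type*} (G : SimpleGraph V) (S : SimpleGraph.Subgraph G)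
    (v : V) : Prop :=
  ∀ H₁ H₂ : SimpleGraph.Subgraph G, H₁ ⊔ H₂ = ⊤ →
    H₁.verts ≠ Set.univ → H₂.verts ≠ Set.univ → H₁.verts ∩ H₂.verts = {v} →
    ¬ S.verts ⊆ H₁.verts ∧ ¬ S.verts ⊆ H₂.verts

/-- A chord `uv` is essential (with respect to `S`) if whenever `G = G₁ ∪ G₂` with
`V(G₁), V(G₂) ≠ V(G)` and `V(G₁) ∩ V(G₂) = {u, v}`, neither `Gᵢ` contains all of `V(S)`. -/
def EssentialChord {V : Type*} (G : SimpleGraph V) (S : SimpleGraph.Subgraph G)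
    (u v : V) : Prop :=
  ∀ H₁ H₂ : SimpleGraph.Subgraph G, H₁ ⊔ H₂ = ⊤ →
    H₁.verts ≠ Set.univ → H₂.verts ≠ Set.univ → H₁.verts ∩ H₂.verts = {u, v} →
    ¬ S.verts ⊆ H₁.verts ∧ ¬ S.verts ⊆ H₂.verts

/-- The edge `xy` of `G` separates `s` from `t`: `s` and `t` lie in different
components of `G ∖ {x, y}`. -/
def SeparatesEdge {V : Type*} (G : SimpleGraph V) (x y s t : V) : Prop :=
  s ≠ x ∧ s ≠ y ∧ t ≠ x ∧ t ≠ y ∧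
    ∀ W : G.Walk s t, x ∈ W.support ∨ y ∈ W.support

namespace TL
variable {V : Type} {G : SimpleGraph V}

/-- `x` and `y` are linked by a walk of `G` inside `A`. -/
def Lk (G : SimpleGraph V) (A : Set V) (x y : V) : Prop :=
  x ∈ A ∧ Relation.ReflTransGen (fun a b => G.Adj a b ∧ b ∈ A) x y

def Conn (G : SimpleGraph V) (A : Set V) : Prop := ∀ x ∈ A, ∀ y ∈ A, Lk G A x y

def comp (G : SimpleGraph V) (A : Set V) (x : V) : Set V := {y | Lk G A x y}

def Touch (G : SimpleGraph V) (B C : Set V) : Prop := ∃ b ∈ B, ∃ c ∈ C, G.Adj b c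

def nb (G : SimpleGraph V) (Z : Set V) : Set V := {v | ∃ z ∈ Z, G.Adj v z}

/-- `K` is a union of components of `A \ Q`. -/
def Closed (G : SimpleGraph V) (A Q K : Set V) : Prop :=
  K ⊆ A \ Q ∧ ∀ k ∈ K, ∀ v ∈ A, G.Adj k v → v ∈ K ∪ Q

theorem Lk.left {A : Set V} {x y : V} (h : Lk G A x y) : x ∈ A := h.1

theorem Lk.ind {A : Set V} {x y : V} (h : Lk G A x y) (p : V → Prop) (h0 : p x)
    (hs : ∀ a b, Lk G A x a → p a → b ∈ A → G.Adj a b → p b) : p y := by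
  obtain ⟨hx, h⟩ := h
  induction h with
  | refl => exact h0
  | tail h1 h2 ih => exact hs _ _ ⟨hx, h1⟩ ih h2.2 h2.1

theorem Lk.right {A : Set V} {x y : V} (h : Lk G A x y) : y ∈ A :=
  h.ind (· ∈ A) h.1 (fun _ _ _ _ hb _ => hb)

theorem Lk.refl {A : Set V} {x : V} (h : x ∈ A) : Lk G A x x := ⟨h, .refl⟩

theorem Lk.tail {A : Set V} {x y z : V} (h : Lk G A x y) (hz : z ∈ A) (ha : G.Adj y z) :
    Lk G A x z := ⟨h.1, h.2.tail ⟨ha, hz⟩⟩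

theorem Lk.of_adj {A : Set V} {x y : V} (hx : x ∈ A) (hy : y ∈ A) (ha : G.Adj x y) :
    Lk G A x y := (Lk.refl hx).tail hy ha

theorem Lk.trans {A : Set V} {x y z : V} (h : Lk G A x y) (h' : Lk G A y z) : Lk G A x z :=
  ⟨h.1, h.2.trans h'.2⟩

theorem Lk.symm {A : Set V} {x y : V} (h : Lk G A x y) : Lk G A y x :=
  h.ind (fun y => Lk G A y x) (Lk.refl h.1)
    (fun _ _ h1 h2 hb ha => (Lk.of_adj hb h1.right ha.symm).trans h2)

theorem Lk.mono {A B : Set V} {x y : V} (h : Lk G A x y) (hAB : A ⊆ B) : Lk G B x y :=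
  h.ind (fun y => Lk G B x y) (Lk.refl (hAB h.1)) (fun _ _ _ h2 hb ha => h2.tail (hAB hb) ha)

/-- a walk starting in a set closed under steps stays there -/
theorem Lk.stay {A K : Set V} {x y : V} (h : Lk G A x y) (hx : x ∈ K)
    (hK : ∀ a ∈ K, a ∈ A → ∀ b ∈ A, G.Adj a b → b ∈ K) : Lk G (A ∩ K) x y :=
  h.ind (fun y => Lk G (A ∩ K) x y) (Lk.refl ⟨h.1, hx⟩)
    (fun _ _ h1 h2 hb ha => h2.tail ⟨hb, hK _ h2.right.2 h1.right _ hb ha⟩ ha)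

theorem comp_sub {A : Set V} {x : V} : comp G A x ⊆ A := fun _ h => h.right

theorem mem_comp {A : Set V} {x : V} (h : x ∈ A) : x ∈ comp G A x := Lk.refl h

theorem Lk.comp {A : Set V} {x y : V} (h : Lk G A x y) : Lk G (comp G A x) x y :=
  (h.stay (K := TL.comp G A x) (Lk.refl h.1) (fun _ ha _ _ hb hab => Lk.tail ha hb hab)).mono
    inter_subset_right

theorem conn_comp {A : Set V} {x : V} : Conn G (comp G A x) :=
  fun _ hy _ hz => (Lk.comp hy).symm.trans (Lk.comp hz)

theorem comp_eq {A : Set V} {x y : V} (h : y ∈ comp G A x) : comp G A y = comp G A x := by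
  ext z; exact ⟨fun hz => Lk.trans h hz, fun hz => (Lk.symm h).trans hz⟩

theorem comp_step {A : Set V} {x y z : V} (h : y ∈ comp G A x) (hz : z ∈ A) (ha : G.Adj y z) :
    z ∈ comp G A x := Lk.tail h hz ha

theorem closed_comp {A Q : Set V} {x : V} : Closed G A Q (comp G (A \ Q) x) := by
  refine ⟨comp_sub, fun k hk v hv ha => ?_⟩
  by_cases hq : v ∈ Q
  · exact Or.inr hq
  · exact Or.inl (comp_step hk ⟨hv, hq⟩ ha)

theorem Conn.single (x : V) : Conn G {x} := by
  rintro a rfl b rfl; exact Lk.refl rfl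

theorem Conn.of_root {A : Set V} (r : V) (h : ∀ x ∈ A, Lk G A r x) : Conn G A :=
  fun x hx y hy => (h x hx).symm.trans (h y hy)

theorem Conn.union {A B : Set V} (hA : Conn G A) (hB : Conn G B) (h : Touch G A B) :
    Conn G (A ∪ B) := by
  obtain ⟨a, ha, b, hb, hab⟩ := h
  refine Conn.of_root a ?_
  rintro x (hx | hx)
  · exact (hA a ha x hx).mono subset_union_left
  · have h1 : Lk G (A ∪ B) a b := Lk.of_adj (Or.inl ha) (Or.inr hb) hab
    exact h1.trans ((hB b hb x hx).mono subset_union_right)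

theorem Touch.symm {A B : Set V} (h : Touch G A B) : Touch G B A := by
  obtain ⟨a, ha, b, hb, hab⟩ := h; exact ⟨b, hb, a, ha, hab.symm⟩

theorem Touch.mono {A B A' B' : Set V} (h : Touch G A B) (h1 : A ⊆ A') (h2 : B ⊆ B') :
    Touch G A' B' := by
  obtain ⟨a, ha, b, hb, hab⟩ := h; exact ⟨a, h1 ha, b, h2 hb, hab⟩

theorem Touch.single {x y : V} (h : G.Adj x y) : Touch G {x} {y} := ⟨x, rfl, y, rfl, h⟩

theorem touch_nb {Z : Set V} {x : V} (h : x ∈ nb G Z) : Touch G {x} Z := by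
  obtain ⟨z, hz, h⟩ := h; exact ⟨x, rfl, z, hz, h⟩

theorem nb_union {Z R : Set V} : nb G (Z ∪ R) = nb G Z ∪ nb G R := by
  ext v; simp only [nb, mem_ofPred_eq, mem_union, or_and_right, exists_or]

theorem nb_single {x v : V} : v ∈ nb G {x} ↔ G.Adj v x := by simp [nb]

theorem Conn.add {Z R : Set V} (hZ : Conn G Z) (hR : R ⊆ nb G Z) : Conn G (Z ∪ R) := by
  intro x hx y hy
  have key : ∀ x ∈ Z ∪ R, ∃ z ∈ Z, Lk G (Z ∪ R) x z := by
    rintro x (hx | hx)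
    · exact ⟨x, hx, Lk.refl (Or.inl hx)⟩
    · obtain ⟨z, hz, h⟩ := hR hx
      exact ⟨z, hz, Lk.of_adj (Or.inr hx) (Or.inl hz) h⟩
  obtain ⟨z, hz, h⟩ := key x hx
  obtain ⟨z', hz', hlast⟩ := key y hy
  exact h.trans (((hZ z hz z' hz').mono subset_union_left).trans hlast.symm)

/-- `G` has no `K₅` and no `K₃,₃` minor. -/
structure NoMin (G : SimpleGraph V) : Prop where
  k5 : ∀ b1 b2 b3 b4 b5 : Set V, Conn G b1 → Conn G b2 → Conn G b3 → Conn G b4 → Conn G b5 →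
    Disjoint b1 b2 → Disjoint b1 b3 → Disjoint b1 b4 → Disjoint b1 b5 → Disjoint b2 b3 →
    Disjoint b2 b4 → Disjoint b2 b5 → Disjoint b3 b4 → Disjoint b3 b5 → Disjoint b4 b5 →
    Touch G b1 b2 → Touch G b1 b3 → Touch G b1 b4 → Touch G b1 b5 → Touch G b2 b3 →
    Touch G b2 b4 → Touch G b2 b5 → Touch G b3 b4 → Touch G b3 b5 → Touch G b4 b5 → False
  k33 : ∀ a1 a2 a3 b1 b2 b3 : Set V, Conn G a1 → Conn G a2 → Conn G a3 → Conn G b1 →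
    Conn G b2 → Conn G b3 →
    Disjoint a1 a2 → Disjoint a1 a3 → Disjoint a2 a3 → Disjoint b1 b2 → Disjoint b1 b3 →
    Disjoint b2 b3 → Disjoint a1 b1 → Disjoint a1 b2 → Disjoint a1 b3 → Disjoint a2 b1 →
    Disjoint a2 b2 → Disjoint a2 b3 → Disjoint a3 b1 → Disjoint a3 b2 → Disjoint a3 b3 →
    Touch G a1 b1 → Touch G a1 b2 → Touch G a1 b3 → Touch G a2 b1 → Touch G a2 b2 →
    Touch G a2 b3 → Touch G a3 b1 → Touch G a3 b2 → Touch G a3 b3 → False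

/-- connecting set between two linked vertices -/
theorem link_split {A B : Set V} {x y : V} (h : Lk G A x y) (hxy : x ≠ y)
    (hB : B = A \ {x, y}) :
    ∃ K ⊆ B, Conn G ({x} ∪ K) ∧ Touch G ({x} ∪ K) {y} ∧
      ∀ k ∈ K, K = comp G B k ∧ Touch G K {x} ∧ Touch G K {y} := by
  subst hB
  by_contra hcon
  have key : y = x ∨ ∃ w, G.Adj x w ∧ y ∈ comp G (A \ {x, y}) w := by
    refine h.ind (fun v => v = x ∨ ∃ w, G.Adj x w ∧ v ∈ comp G (A \ {x, y}) w) (Or.inl rfl) ?_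
    intro a b hxa ha hb hab
    by_cases hbx : b = x
    · exact Or.inl hbx
    by_cases hby : b = y
    · subst hby
      exfalso
      rcases ha with rfl | ⟨w, hw, ha⟩
      · apply hcon
        refine ⟨∅, by simp, ?_, ?_, by simp⟩
        · simpa using Conn.single a
        · simpa using Touch.single hab
      · apply hcon
        have hwm : w ∈ A \ {x, b} := Lk.left ha
        refine ⟨_, comp_sub, (Conn.single x).union (conn_comp (x := w)) ?_,
          ⟨a, Or.inr ha, b, rfl, hab⟩, ?_⟩
        · exact ⟨x, rfl, w, mem_comp hwm, hw⟩
        · intro k hk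
          exact ⟨(comp_eq hk).symm, ⟨w, mem_comp hwm, x, rfl, hw.symm⟩, ⟨a, ha, b, rfl, hab⟩⟩
    · right
      rcases ha with rfl | ⟨w, hw, ha⟩
      · exact ⟨b, hab, mem_comp ⟨hb, by simp [hbx, hby]⟩⟩
      · exact ⟨w, hw, comp_step ha ⟨hb, by simp [hbx, hby]⟩ hab⟩
  rcases key with h1 | ⟨w, _, h1⟩
  · exact hxy h1.symm
  · exact (comp_sub h1).2 (by simp)

/-- rooted lemma -/
theorem RL (hG : NoMin G) {A Z : Set V} (hZ : Conn G Z) (hAZ : Disjoint A Z) {s w1 w2 w3 : V}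
    (hs : s ∈ A) (hsZ : s ∈ nb G Z) (h1Z : w1 ∈ nb G Z)
    (h2Z : w2 ∈ nb G Z) (h3Z : w3 ∈ nb G Z)
    (a1 : G.Adj s w1) (a2 : G.Adj s w2) (a3 : G.Adj s w3)
    (n12 : w1 ≠ w2) (n13 : w1 ≠ w3) (n23 : w2 ≠ w3)
    (l12 : Lk G (A \ {s, w3}) w1 w2) (l13 : Lk G (A \ {s, w2}) w1 w3)
    (l23 : Lk G (A \ {s, w1}) w2 w3) : False := by
  have m1 := l12.left.1
  have m2 := l12.right.1
  have m3 := l13.right.1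
  have ns1 := a1.ne
  have ns2 := a2.ne
  have ns3 := a3.ne
  set B := A \ {s, w1, w2, w3} with hB
  have hnZ : ∀ v ∈ A, v ∉ Z := fun v hv hz => hAZ.le_bot ⟨hv, hz⟩
  have case1 : ∀ K, Conn G K → K ⊆ B → Touch G K {w1} → Touch G K {w2} → Touch G K {w3} → False := by
    intro K hK hKB t1 t2 t3
    have hKA : ∀ v ∈ K, v ∉ Z := fun v hv => hnZ v (hKB hv).1
    have hKn : ∀ v ∈ K, v ≠ s ∧ v ≠ w1 ∧ v ≠ w2 ∧ v ≠ w3 := fun v hv => by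
      have := (hKB hv).2
      simpa using this
    refine hG.k33 {s} Z K {w1} {w2} {w3} (.single _) hZ hK (.single _) (.single _) (.single _)
      ?_ ?_ ?_ ?_ ?_ ?_ ?_ ?_ ?_ ?_ ?_ ?_ ?_ ?_ ?_ (.single a1) (.single a2) (.single a3)
      (touch_nb h1Z).symm (touch_nb h2Z).symm (touch_nb h3Z).symm t1 t2 t3
    all_goals
      rw [Set.disjoint_left]
      grind
  obtain ⟨K1, k11, k12, k13, k14⟩ := link_split (B := B) l12 n12 (by grind)
  obtain ⟨K2, k21, k22, k23, k24⟩ := link_split (B := B) l23 n23 (by grind)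
  obtain ⟨K3, k31, k32, k33, k34⟩ := link_split (B := B) l13.symm n13.symm (by grind)
  have d12 : ∀ v ∈ K1, v ∉ K2 := by
    intro v h1 h2
    have e := (k14 v h1).1.trans (k24 v h2).1.symm
    exact case1 K1 ((k14 v h1).1 ▸ conn_comp) k11 (k14 v h1).2.1 (k14 v h1).2.2
      (e ▸ (k24 v h2).2.2)
  have d13 : ∀ v ∈ K1, v ∉ K3 := by
    intro v h1 h2
    have e := (k14 v h1).1.trans (k34 v h2).1.symm
    exact case1 K1 ((k14 v h1).1 ▸ conn_comp) k11 (k14 v h1).2.1 (k14 v h1).2.2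
      (e ▸ (k34 v h2).2.1)
  have d23 : ∀ v ∈ K2, v ∉ K3 := by
    intro v h1 h2
    have e := (k24 v h1).1.trans (k34 v h2).1.symm
    exact case1 K2 ((k24 v h1).1 ▸ conn_comp) k21 (e ▸ (k34 v h2).2.2) (k24 v h1).2.1
      (k24 v h1).2.2
  have e1 : ∀ v ∈ K1, v ∉ Z ∧ v ≠ s ∧ v ≠ w1 ∧ v ≠ w2 ∧ v ≠ w3 := fun v hv => by
    have := k11 hv
    grind
  have e2 : ∀ v ∈ K2, v ∉ Z ∧ v ≠ s ∧ v ≠ w1 ∧ v ≠ w2 ∧ v ≠ w3 := fun v hv => by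
    have := k21 hv
    grind
  have e3 : ∀ v ∈ K3, v ∉ Z ∧ v ≠ s ∧ v ≠ w1 ∧ v ≠ w2 ∧ v ≠ w3 := fun v hv => by
    have := k31 hv
    grind
  refine hG.k5 {s} Z ({w1} ∪ K1) ({w2} ∪ K2) ({w3} ∪ K3) (.single _) hZ k12 k22 k32
      ?_ ?_ ?_ ?_ ?_ ?_ ?_ ?_ ?_ ?_ (touch_nb hsZ)
      ((Touch.single a1).mono subset_rfl subset_union_left)
      ((Touch.single a2).mono subset_rfl subset_union_left)
      ((Touch.single a3).mono subset_rfl subset_union_left)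
      ((touch_nb h1Z).symm.mono subset_rfl subset_union_left)
      ((touch_nb h2Z).symm.mono subset_rfl subset_union_left)
      ((touch_nb h3Z).symm.mono subset_rfl subset_union_left)
      (k13.mono subset_rfl subset_union_left) (k33.symm.mono subset_union_left subset_rfl)
      (k23.mono subset_rfl subset_union_left)
  all_goals
    rw [Set.disjoint_left]
    grind

end TL

namespace TL
variable {V : Type} {G : SimpleGraph V}

def Col (G : SimpleGraph V) (A : Set V) (L : V → Finset ℕ) (φ : V → ℕ) : Prop :=
  (∀ v ∈ A, φ v ∈ L v) ∧ ∀ x ∈ A, ∀ y ∈ A, G.Adj x y → φ x ≠ φ y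

def Ext (G : SimpleGraph V) (A : Set V) (L : V → Finset ℕ) : Prop := ∃ φ, Col G A L φ

open Classical in
/-- lists after deleting the coloured set `R`. -/
noncomputable def resid (G : SimpleGraph V) (L : V → Finset ℕ) (R : Set V) (ψ : V → ℕ) (v : V) :
    Finset ℕ := (L v).filter (fun c => ∀ r ∈ R, G.Adj v r → ψ r ≠ c)

theorem mem_resid {L : V → Finset ℕ} {R : Set V} {ψ : V → ℕ} {v : V} {c : ℕ} :
    c ∈ resid G L R ψ v ↔ c ∈ L v ∧ ∀ r ∈ R, G.Adj v r → ψ r ≠ c := by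
  simp [resid]

theorem resid_card {L : V → Finset ℕ} {R : Set V} {ψ : V → ℕ} {v : V} (C : Finset ℕ)
    (h : ∀ r ∈ R, G.Adj v r → ψ r ∈ C) : (L v).card ≤ (resid G L R ψ v).card + C.card := by
  have h1 : L v ⊆ resid G L R ψ v ∪ C := by
    intro c hc
    by_cases hC : c ∈ C
    · simp [hC]
    · simp only [Finset.mem_union, mem_resid, hc, true_and]
      left
      intro r hr ha e
      exact hC (e ▸ h r hr ha)
  exact (Finset.card_le_card h1).trans (Finset.card_union_le _ _)

theorem resid_card0 {L : V → Finset ℕ} {R : Set V} {ψ : V → ℕ} {v : V}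
    (h : ∀ r ∈ R, ¬ G.Adj v r) : (L v).card ≤ (resid G L R ψ v).card := by
  simpa using resid_card (G := G) (L := L) (R := R) (ψ := ψ) (v := v) ∅
    (fun r hr ha => (h r hr ha).elim)

open Classical in
theorem col_resid {A R : Set V} {L : V → Finset ℕ} {ψ φ : V → ℕ} (h1 : Col G R L ψ)
    (h2 : Col G (A \ R) (resid G L R ψ) φ) :
    ∃ f, Col G A L f ∧ (∀ r ∈ R, f r = ψ r) ∧ ∀ v, v ∉ R → f v = φ v := by
  refine ⟨fun v => if v ∈ R then ψ v else φ v, ⟨?_, ?_⟩, ?_, ?_⟩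
  · intro v hv
    by_cases hr : v ∈ R
    · simpa [hr] using h1.1 v hr
    · simpa [hr] using (mem_resid.1 (h2.1 v ⟨hv, hr⟩)).1
  · intro x hx y hy ha
    by_cases hxr : x ∈ R <;> by_cases hyr : y ∈ R <;> simp only [hxr, hyr, if_true, if_false]
    · exact h1.2 x hxr y hyr ha
    · exact (mem_resid.1 (h2.1 y ⟨hy, hyr⟩)).2 x hxr ha.symm
    · exact ((mem_resid.1 (h2.1 x ⟨hx, hxr⟩)).2 y hyr ha).symm
    · exact h2.2 x ⟨hx, hxr⟩ y ⟨hy, hyr⟩ ha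
  · intro r hr; simp [hr]
  · intro r hr; simp [hr]

theorem ext_resid {A R : Set V} {L : V → Finset ℕ} {ψ : V → ℕ} (h1 : Col G R L ψ)
    (h2 : Ext G (A \ R) (resid G L R ψ)) : Ext G A L := by
  obtain ⟨φ, h⟩ := h2
  obtain ⟨f, hf, _⟩ := col_resid h1 h
  exact ⟨f, hf⟩

theorem Col.mono {A B : Set V} {L L' : V → Finset ℕ} {φ : V → ℕ} (h : Col G A L φ) (hB : B ⊆ A)
    (hL : ∀ v ∈ B, φ v ∈ L v → φ v ∈ L' v) : Col G B L' φ :=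
  ⟨fun v hv => hL v hv (h.1 v (hB hv)), fun x hx y hy => h.2 x (hB hx) y (hB hy)⟩

theorem Ext.mono {A : Set V} {L L' : V → Finset ℕ} (h : Ext G A L)
    (hL : ∀ v ∈ A, L v ⊆ L' v) : Ext G A L' := by
  obtain ⟨φ, h⟩ := h
  exact ⟨φ, h.mono subset_rfl (fun v hv h => hL v hv h)⟩

theorem Col.congr {A : Set V} {L : V → Finset ℕ} {φ f : V → ℕ} (h : Col G A L φ)
    (hf : ∀ v ∈ A, f v = φ v) : Col G A L f :=
  ⟨fun v hv => by rw [hf v hv]; exact h.1 v hv,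
   fun x hx y hy ha => by rw [hf x hx, hf y hy]; exact h.2 x hx y hy ha⟩

theorem Col.single {L : V → Finset ℕ} {φ : V → ℕ} {x : V} (h : φ x ∈ L x) : Col G {x} L φ := by
  constructor
  · rintro v rfl; exact h
  · rintro v rfl w rfl ha; exact (G.loopless.irrefl _ ha).elim

open Classical in
theorem glue {A Q K : Set V} {L : V → Finset ℕ} {φ1 φ2 : V → ℕ} (hK : Closed G A Q K)
    (h1 : Col G (A \ K) L φ1) (h2 : Col G (K ∪ Q) L φ2) (hQ : ∀ q ∈ Q, φ1 q = φ2 q) :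
    ∃ f, Col G A L f ∧ (∀ v ∈ K, f v = φ2 v) ∧ ∀ v, v ∉ K → f v = φ1 v := by
  refine ⟨fun v => if v ∈ K then φ2 v else φ1 v, ⟨?_, ?_⟩, ?_, ?_⟩
  · intro v hv
    by_cases hr : v ∈ K
    · simpa [hr] using h2.1 v (Or.inl hr)
    · simpa [hr] using h1.1 v ⟨hv, hr⟩
  · intro x hx y hy ha
    by_cases hxr : x ∈ K <;> by_cases hyr : y ∈ K <;> simp only [hxr, hyr, if_true, if_false]
    · exact h2.2 x (Or.inl hxr) y (Or.inl hyr) ha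
    · have hq : y ∈ Q := (hK.2 x hxr y hy ha).resolve_left hyr
      rw [hQ y hq]
      exact h2.2 x (Or.inl hxr) y (Or.inr hq) ha
    · have hq : x ∈ Q := (hK.2 y hyr x hx ha.symm).resolve_left hxr
      rw [hQ x hq]
      exact h2.2 x (Or.inr hq) y (Or.inl hyr) ha
    · exact h1.2 x ⟨hx, hxr⟩ y ⟨hy, hyr⟩ ha
  · intro r hr; simp [hr]
  · intro r hr; simp [hr]

/-- cliques with at most two vertices -/
def Cl2 (G : SimpleGraph V) (Q : Set V) : Prop :=
  Q = ∅ ∨ (∃ x, Q = {x}) ∨ ∃ x y, G.Adj x y ∧ Q = {x, y}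

theorem Cl2.empty : Cl2 G ∅ := Or.inl rfl
theorem Cl2.single (x : V) : Cl2 G {x} := Or.inr (Or.inl ⟨x, rfl⟩)
theorem Cl2.pair {x y : V} (h : G.Adj x y) : Cl2 G {x, y} := Or.inr (Or.inr ⟨x, y, h, rfl⟩)

theorem Cl2.adj {Q : Set V} (h : Cl2 G Q) {x y : V} (hx : x ∈ Q) (hy : y ∈ Q) (hne : x ≠ y) :
    G.Adj x y := by
  rcases h with rfl | ⟨a, rfl⟩ | ⟨a, b, hab, rfl⟩
  · exact hx.elim
  · simp at hx hy; exact (hne (hx.trans hy.symm)).elim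
  · have := hab.symm
    grind

theorem closed_other {A Q : Set V} {x : V} : Closed G A Q ((A \ Q) \ comp G (A \ Q) x) := by
  refine ⟨sdiff_subset, fun k hk v hv ha => ?_⟩
  by_cases hq : v ∈ Q
  · exact Or.inr hq
  · refine Or.inl ⟨⟨hv, hq⟩, fun hc => hk.2 (comp_step hc hk.1 ha.symm)⟩

theorem not_conn {A : Set V} (h : ¬ Conn G A) : ∃ x ∈ A, ∃ y ∈ A, ¬ Lk G A x y := by
  simpa [Conn] using h

/-- pick two nbr bound -/
theorem three_nbrs (hG : NoMin G) {A Z : Set V} (hZ : Conn G Z) (hAZ : Disjoint A Z) {s : V}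
    (hs : s ∈ A) (hsZ : s ∈ nb G Z)
    (hc : ∀ w ∈ A, w ∈ nb G Z → G.Adj s w → Conn G (A \ {s, w}))
    {w1 w2 w3 : V} (m1 : w1 ∈ A) (m2 : w2 ∈ A) (m3 : w3 ∈ A)
    (h1Z : w1 ∈ nb G Z) (h2Z : w2 ∈ nb G Z) (h3Z : w3 ∈ nb G Z)
    (a1 : G.Adj s w1) (a2 : G.Adj s w2) (a3 : G.Adj s w3)
    (n12 : w1 ≠ w2) (n13 : w1 ≠ w3) (n23 : w2 ≠ w3) : False := by
  have := a1.ne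
  have := a2.ne
  have := a3.ne
  refine RL hG hZ hAZ hs hsZ h1Z h2Z h3Z a1 a2 a3 n12 n13 n23 ?_ ?_ ?_
  · exact hc w3 m3 h3Z a3 _ (by grind) _ (by grind)
  · exact hc w2 m2 h2Z a2 _ (by grind) _ (by grind)
  · exact hc w1 m1 h1Z a1 _ (by grind) _ (by grind)

theorem exists_ne_of_card {s : Finset ℕ} (h : 2 ≤ s.card) (a : ℕ) : ∃ c ∈ s, c ≠ a :=
  Finset.exists_mem_ne (by omega) a

end TL

namespace TL
variable {V : Type} {G : SimpleGraph V}

theorem ncard_lt [Finite V] {A B : Set V} {x : V} (h : B ⊆ A) (hx : x ∈ A) (hxB : x ∉ B) :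
    B.ncard < A.ncard :=
  Set.ncard_lt_ncard ⟨h, fun h' => hxB (h' hx)⟩ (Set.toFinite _)

theorem disj_sub {A B Z : Set V} (h : Disjoint A Z) (hB : B ⊆ A) : Disjoint B Z :=
  h.mono_left hB

theorem disj_add {A R Z : Set V} (h : Disjoint A Z) : Disjoint (A \ R) (Z ∪ R) := by
  rw [Set.disjoint_left] at *
  grind

/-- Thomassen's theorem -/
theorem thomassen_aux [Finite V] (hG : NoMin G) (n : ℕ) : ∀ A Z : Set V, A.ncard ≤ n → Conn G Z →
    Disjoint A Z → ∀ Q, Cl2 G Q → Q ⊆ A → Q ⊆ nb G Z → ∀ (L : V → Finset ℕ) (ψ : V → ℕ),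
    (∀ q ∈ Q, ψ q ∈ L q) → (∀ x ∈ Q, ∀ y ∈ Q, x ≠ y → ψ x ≠ ψ y) →
    (∀ v ∈ A, v ∉ Q → 3 ≤ (L v).card) → (∀ v ∈ A, v ∉ nb G Z → 5 ≤ (L v).card) →
    ∃ φ, Col G A L φ ∧ ∀ q ∈ Q, φ q = ψ q := by
  induction n with
  | zero =>
    intro A Z hn hZ hAZ Q hQ hQA hQZ L ψ _ _ _ _
    have hA : A = ∅ := by
      have := Set.ncard_eq_zero (Set.toFinite A) |>.1 (by omega)
      exact this
    subst hA
    refine ⟨ψ, ⟨by simp, by simp⟩, fun _ _ => rfl⟩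
  | succ n ih =>
    intro A Z hn hZ hAZ
    have hnZ : ∀ v ∈ A, v ∉ Z := fun v hv hz => hAZ.le_bot ⟨hv, hz⟩
    -- deleting one vertex x
    have size : ∀ (B : Set V) x, B ⊆ A → x ∈ A → x ∉ B → B.ncard ≤ n := by
      intro B x h1 h2 h3
      have := ncard_lt h1 h2 h3
      omega
    -- splitting
    have hsplit : ∀ Q, Cl2 G Q → Q ⊆ A → Q ⊆ nb G Z → ∀ (L : V → Finset ℕ) (ψ : V → ℕ),
        (∀ q ∈ Q, ψ q ∈ L q) → (∀ x ∈ Q, ∀ y ∈ Q, x ≠ y → ψ x ≠ ψ y) →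
        (∀ v ∈ A, v ∉ Q → 3 ≤ (L v).card) → (∀ v ∈ A, v ∉ nb G Z → 5 ≤ (L v).card) →
        ∀ R, Cl2 G R → R ⊆ A → R ⊆ nb G Z → ¬ Conn G (A \ R) →
        ∃ φ, Col G A L φ ∧ ∀ q ∈ Q, φ q = ψ q := by
      intro Q hQ hQA hQZ L ψ h1 h2 h3 h4 R hR hRA hRZ hnc
      obtain ⟨x0, hx0, y0, hy0, hxy0⟩ := not_conn hnc
      obtain ⟨x, hx, y, hy, hxy, hxQ⟩ : ∃ x ∈ A \ R, ∃ y ∈ A \ R, ¬ Lk G (A \ R) x y ∧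
          ∀ q ∈ Q, q ∉ comp G (A \ R) x := by
        by_cases hq : ∀ q ∈ Q, q ∉ comp G (A \ R) x0
        · exact ⟨x0, hx0, y0, hy0, hxy0, hq⟩
        · push Not at hq
          obtain ⟨q, hq, hqc⟩ := hq
          refine ⟨y0, hy0, x0, hx0, fun h => hxy0 h.symm, fun q' hq' hc => ?_⟩
          have : Lk G (A \ R) q q' := by
            by_cases e : q = q'
            · subst e; exact Lk.refl hqc.right
            · exact Lk.of_adj hqc.right hc.right (hQ.adj hq hq' e)
          exact hxy0 ((Lk.trans hqc this).trans (Lk.symm hc))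
      set K := comp G (A \ R) x with hK
      have hKc : Closed G A R K := closed_comp
      have hxK : x ∈ K := mem_comp hx
      obtain ⟨φ1, hφ1, hφ1Q⟩ := ih (A \ K) Z (size _ x sdiff_subset hx.1 (by simp [hxK])) hZ
        (disj_sub hAZ sdiff_subset) Q hQ (fun q hq => ⟨hQA hq, hxQ q hq⟩) hQZ L ψ h1 h2
        (fun v hv => h3 v hv.1) (fun v hv => h4 v hv.1)
      have hRK : R ⊆ A \ K := fun r hr => ⟨hRA hr, fun h => (hKc.1 h).2 hr⟩
      have hKR : K ∪ R ⊆ A := union_subset (fun k hk => (hKc.1 hk).1) hRA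
      obtain ⟨φ2, hφ2, hφ2Q⟩ := ih (K ∪ R) Z (size _ y hKR hy.1
          (by rintro (h | h); exacts [hxy h, hy.2 h])) hZ
        (disj_sub hAZ hKR) R hR subset_union_right hRZ L φ1 (fun q hq => hφ1.1 q (hRK hq))
        (fun a ha b hb hne => hφ1.2 a (hRK ha) b (hRK hb) (hR.adj ha hb hne))
        (fun v hv hvR => h3 v (hKR hv) (fun hvQ => by
          rcases hv with hv | hv
          · exact hxQ v hvQ hv
          · exact hvR hv)) (fun v hv => h4 v (hKR hv))
      obtain ⟨f, hf, _, hf2⟩ := glue hKc hφ1 hφ2 (fun q hq => (hφ2Q q hq).symm)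
      exact ⟨f, hf, fun q hq => (hf2 q (hxQ q hq)).trans (hφ1Q q hq)⟩
    -- two precoloured vertices
    have two : ∀ x y, x ∈ A → y ∈ A → x ∈ nb G Z → y ∈ nb G Z → G.Adj x y →
        ∀ (L : V → Finset ℕ) (ψ : V → ℕ), ψ x ∈ L x → ψ y ∈ L y → ψ x ≠ ψ y →
        (∀ v ∈ A, v ≠ x → v ≠ y → 3 ≤ (L v).card) → (∀ v ∈ A, v ∉ nb G Z → 5 ≤ (L v).card) →
        ∃ φ, Col G A L φ ∧ φ x = ψ x ∧ φ y = ψ y := by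
      intro x y hx hy hxZ hyZ hxy L ψ hψx hψy hψ h3 h4
      by_contra hcon
      have hconn : ∀ R, Cl2 G R → R ⊆ A → R ⊆ nb G Z → Conn G (A \ R) := by
        intro R hR hRA hRZ
        by_contra hnc
        obtain ⟨φ, hφ, hφ'⟩ := hsplit {x, y} (Cl2.pair hxy) (by grind) (by grind) L ψ
          (by grind) (by grind) (by grind) h4 R hR hRA hRZ hnc
        exact hcon ⟨φ, hφ, hφ' x (by simp), hφ' y (by simp)⟩
      have hN : ∀ s ∈ A, s ∈ nb G Z → ∀ w1 ∈ A, ∀ w2 ∈ A, ∀ w3 ∈ A, w1 ∈ nb G Z →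
          w2 ∈ nb G Z → w3 ∈ nb G Z → G.Adj s w1 → G.Adj s w2 → G.Adj s w3 → w1 ≠ w2 →
          w1 ≠ w3 → w2 ≠ w3 → False := by
        intro s hs hsZ w1 m1 w2 m2 w3 m3 z1 z2 z3 a1 a2 a3 n1 n2 n3
        refine three_nbrs hG hZ hAZ hs hsZ (fun w hw hwZ ha => hconn _ (Cl2.pair ha) ?_ ?_)
          m1 m2 m3 z1 z2 z3 a1 a2 a3 n1 n2 n3
        · grind
        · grind
      apply hcon
      by_cases hv : ∃ v ∈ A, v ∈ nb G Z ∧ G.Adj x v ∧ v ≠ y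
      · obtain ⟨v, hv, hvZ, hxv, hvy⟩ := hv
        have hvx := hxv.ne
        -- reserved colours
        obtain ⟨c1, c2, hc12, hc1, hc2, hc1x, hc2x⟩ : ∃ c1 c2, c1 ≠ c2 ∧ c1 ∈ L v ∧ c2 ∈ L v ∧
            c1 ≠ ψ x ∧ c2 ≠ ψ x := by
          have h := h3 v hv hvx.symm hvy
          have : 1 < ((L v).erase (ψ x)).card := by
            have := Finset.pred_card_le_card_erase (s := L v) (a := ψ x)
            omega
          obtain ⟨c1, h1, c2, h2, h12⟩ := Finset.one_lt_card.1 this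
          simp only [Finset.mem_erase] at h1 h2
          exact ⟨c1, c2, h12, h1.2, h2.2, h1.1, h2.1⟩
        classical
        let L' : V → Finset ℕ := fun w => if G.Adj w v ∧ w ∉ nb G Z then L w \ {c1, c2} else L w
        have hL' : ∀ w, L' w ⊆ L w := by
          intro w
          simp only [L']
          split_ifs
          · exact Finset.sdiff_subset
          · exact subset_rfl
        have hL'nb : ∀ w, w ∈ nb G Z → L' w = L w := by
          intro w hw; simp [L', hw]
        have hL'far : ∀ w, ¬ G.Adj w v → L' w = L w := by
          intro w hw; simp [L', hw]
        obtain ⟨φ, hφ, hφQ⟩ := ih (A \ {v}) (Z ∪ {v}) (size _ v sdiff_subset hv (by simp))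
          (hZ.add (by simpa using hvZ)) (disj_add hAZ) {x, y} (Cl2.pair hxy) (by grind)
          (by rw [nb_union]; grind) L' ψ
          (by rintro q (rfl | rfl)
              · rw [hL'nb _ hxZ]; exact hψx
              · rw [hL'nb _ hyZ]; exact hψy) (by grind)
          (by
            intro w hw hwQ
            by_cases h : G.Adj w v ∧ w ∉ nb G Z
            · simp only [L', h, if_true, not_false_eq_true, and_self]
              have h5 := h4 w hw.1 h.2
              have := Finset.le_card_sdiff {c1, c2} (L w)
              have := Finset.card_le_two (a := c1) (b := c2)
              omega
            · simp only [L', h, if_false]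
              exact h3 w hw.1 (by grind) (by grind))
          (by
            intro w hw hwZ
            rw [nb_union] at hwZ
            rw [hL'far w (fun ha => hwZ (Or.inr (nb_single.2 ha)))]
            exact h4 w hw.1 (fun h => hwZ (Or.inl h)))
        have hφx := hφQ x (by simp)
        have hφy := hφQ y (by simp)
        obtain ⟨c, hc, hcx, hcL, hcN⟩ : ∃ c, (c = c1 ∨ c = c2) ∧ c ≠ ψ x ∧ c ∈ L v ∧
            ∀ w ∈ A, w ∈ nb G Z → G.Adj v w → w ≠ x → φ w ≠ c := by
          by_cases hw : ∃ w ∈ A, w ∈ nb G Z ∧ G.Adj v w ∧ w ≠ x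
          · obtain ⟨w, hwA, hwZ, hvw, hwx⟩ := hw
            have huniq : ∀ w' ∈ A, w' ∈ nb G Z → G.Adj v w' → w' ≠ x → w' = w := by
              intro w' h1 h2 h3 h4'
              by_contra hne
              exact hN v hv hvZ x hx w hwA w' h1 hxZ hwZ h2 hxv.symm hvw h3 (Ne.symm hwx)
                (Ne.symm h4') (Ne.symm hne)
            by_cases e : φ w = c1
            · exact ⟨c2, Or.inr rfl, hc2x, hc2, fun w' h1 h2 h3 h4' => by
                rw [huniq w' h1 h2 h3 h4', e]; exact hc12⟩
            · exact ⟨c1, Or.inl rfl, hc1x, hc1, fun w' h1 h2 h3 h4' => by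
                rw [huniq w' h1 h2 h3 h4']; exact e⟩
          · push Not at hw
            exact ⟨c1, Or.inl rfl, hc1x, hc1, fun w' h1 h2 h3 h4' => (h4' (hw w' h1 h2 h3)).elim⟩
        obtain ⟨f, hf, hf1, hf2⟩ := col_resid (A := A) (R := {v}) (L := L) (ψ := fun _ => c)
          (φ := φ) (Col.single hcL) (by
            refine ⟨fun w hw => mem_resid.2 ⟨hL' w (hφ.1 w hw), ?_⟩, hφ.2⟩
            rintro r hr hwr
            have hr' : r = v := hr
            subst hr'
            by_cases hwZ : w ∈ nb G Z
            · by_cases hwx : w = x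
              · subst hwx; rw [hφx]; exact hcx
              · exact (hcN w hw.1 hwZ hwr.symm hwx).symm
            · have := hφ.1 w hw
              simp only [L', hwr, hwZ, if_true, not_false_eq_true, and_self, Finset.mem_sdiff,
                Finset.mem_insert, Finset.mem_singleton] at this
              rintro rfl
              exact this.2 hc)
        exact ⟨f, hf, (hf2 x (by simpa using hvx)).trans hφx,
          (hf2 y (by simpa using hvy.symm)).trans hφy⟩
      · push Not at hv
        obtain ⟨φ, hφ, hφQ⟩ := ih (A \ {x}) (Z ∪ {x}) (size _ x sdiff_subset hx (by simp))
          (hZ.add (by simpa using hxZ)) (disj_add hAZ) {y} (Cl2.single y)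
          (by have := hxy.ne; grind) (by rw [nb_union]; grind) (resid G L {x} ψ) ψ
          (by rintro q rfl
              refine mem_resid.2 ⟨hψy, ?_⟩
              rintro r rfl _
              exact hψ) (by grind)
          (by
            intro w hw hwy
            by_cases h : G.Adj w x
            · have h5 := h4 w hw.1 (fun h' => hwy (hv w hw.1 h' h.symm))
              have := resid_card (G := G) (L := L) (R := {x}) (ψ := ψ) (v := w) {ψ x} (by simp)
              simp at this
              omega
            · have := resid_card0 (G := G) (L := L) (R := {x}) (ψ := ψ) (v := w) (by simpa using h)
              have := h3 w hw.1 hw.2 hwy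
              omega)
          (by
            intro w hw hwZ
            rw [nb_union] at hwZ
            have h : ¬ G.Adj w x := fun ha => hwZ (Or.inr (nb_single.2 ha))
            have := resid_card0 (G := G) (L := L) (R := {x}) (ψ := ψ) (v := w) (by simpa using h)
            have := h4 w hw.1 (fun h => hwZ (Or.inl h))
            omega)
        obtain ⟨f, hf, hf1, hf2⟩ := col_resid (A := A) (Col.single hψx) hφ
        exact ⟨f, hf, hf1 x rfl, (hf2 y (by simpa using hxy.ne.symm)).trans (hφQ y rfl)⟩
    have one : ∀ x, x ∈ A → x ∈ nb G Z →
        ∀ (L : V → Finset ℕ) (ψ : V → ℕ), ψ x ∈ L x →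
        (∀ v ∈ A, v ≠ x → 3 ≤ (L v).card) → (∀ v ∈ A, v ∉ nb G Z → 5 ≤ (L v).card) →
        ∃ φ, Col G A L φ ∧ φ x = ψ x := by
      intro x hx hxZ L ψ hψx h3 h4
      by_cases hv : ∃ v ∈ A, v ∈ nb G Z ∧ G.Adj x v
      · obtain ⟨v, hv, hvZ, hxv⟩ := hv
        have hne := hxv.ne
        obtain ⟨c, hc, hcx⟩ := exists_ne_of_card (s := L v) (by have := h3 v hv hne.symm; omega)
          (ψ x)
        classical
        obtain ⟨φ, h1, h2, h3⟩ := two x v hx hv hxZ hvZ hxv L (Function.update ψ v c)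
          (by simpa [hne] using hψx) (by simpa using hc) (by simpa [hne] using hcx.symm)
          (fun w hw hwx _ => h3 w hw hwx) h4
        exact ⟨φ, h1, by simpa [hne] using h2⟩
      · push Not at hv
        obtain ⟨φ, hφ, -⟩ := ih (A \ {x}) (Z ∪ {x}) (size _ x sdiff_subset hx (by simp))
          (hZ.add (by simpa using hxZ)) (disj_add hAZ) ∅ Cl2.empty
          (by simp) (by simp) (resid G L {x} ψ) ψ (by simp) (by simp)
          (by
            intro w hw hwy
            by_cases h : G.Adj w x
            · have h5 := h4 w hw.1 (fun h' => hv w hw.1 h' h.symm)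
              have := resid_card (G := G) (L := L) (R := {x}) (ψ := ψ) (v := w) {ψ x} (by simp)
              simp at this
              omega
            · have := resid_card0 (G := G) (L := L) (R := {x}) (ψ := ψ) (v := w) (by simpa using h)
              have := h3 w hw.1 hw.2
              omega)
          (by
            intro w hw hwZ
            rw [nb_union] at hwZ
            have h : ¬ G.Adj w x := fun ha => hwZ (Or.inr (nb_single.2 ha))
            have := resid_card0 (G := G) (L := L) (R := {x}) (ψ := ψ) (v := w) (by simpa using h)
            have := h4 w hw.1 (fun h => hwZ (Or.inl h))
            omega)
        obtain ⟨f, hf, hf1, hf2⟩ := col_resid (A := A) (Col.single hψx) hφ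
        exact ⟨f, hf, hf1 x rfl⟩
    intro Q hQ hQA hQZ L ψ h1 h2 h3 h4
    rcases hQ with rfl | ⟨x, rfl⟩ | ⟨x, y, hxy, rfl⟩
    · by_cases hA : A = ∅
      · subst hA
        exact ⟨ψ, ⟨by simp, by simp⟩, fun _ _ => rfl⟩
      by_cases hX : ∃ x ∈ A, x ∈ nb G Z
      · obtain ⟨x, hx, hxZ⟩ := hX
        have := h3 x hx (by simp)
        obtain ⟨c, hc⟩ := Finset.card_pos.1 (show 0 < (L x).card by omega)
        obtain ⟨φ, hφ, _⟩ := one x hx hxZ L (fun _ => c) hc (fun v hv _ => h3 v hv (by simp)) h4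
        exact ⟨φ, hφ, by simp⟩
      · push Not at hX
        obtain ⟨x, hx⟩ := Set.nonempty_iff_ne_empty.2 hA
        have := h3 x hx (by simp)
        obtain ⟨c, hc⟩ := Finset.card_pos.1 (show 0 < (L x).card by omega)
        obtain ⟨φ, hφ, -⟩ := ih (A \ {x}) {x} (size _ x sdiff_subset hx (by simp))
          (Conn.single x) disjoint_sdiff_left ∅ Cl2.empty
          (by simp) (by simp) (resid G L {x} (fun _ => c)) ψ (by simp) (by simp)
          (by
            intro w hw hwy
            have h5 := h4 w hw.1 (hX w hw.1)
            have := resid_card (G := G) (L := L) (R := {x}) (ψ := fun _ => c) (v := w) {c} (by simp)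
            simp at this
            omega)
          (by
            intro w hw hwZ
            have h : ¬ G.Adj w x := fun ha => hwZ (nb_single.2 ha)
            have := resid_card0 (G := G) (L := L) (R := {x}) (ψ := fun _ => c) (v := w)
              (by simpa using h)
            have := h4 w hw.1 (hX w hw.1)
            omega)
        obtain ⟨f, hf, hf1, hf2⟩ := col_resid (A := A) (ψ := fun _ => c) (Col.single hc) hφ
        exact ⟨f, hf, by simp⟩
    · obtain ⟨φ, h⟩ := one x (hQA rfl) (hQZ rfl) L ψ (h1 x rfl) h3 h4
      exact ⟨φ, h.1, by rintro q rfl; exact h.2⟩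
    · obtain ⟨φ, h⟩ := two x y (hQA (by simp)) (hQA (by simp)) (hQZ (by simp)) (hQZ (by simp)) hxy
        L ψ (h1 x (by simp)) (h1 y (by simp)) (h2 x (by simp) y (by simp) hxy.ne)
        (by grind) h4
      exact ⟨φ, h.1, by rintro q (rfl | rfl); exacts [h.2.1, h.2.2]⟩

end TL

namespace TL
variable {V : Type} {G : SimpleGraph V}

theorem thomassen [Finite V] (hG : NoMin G) {A Z : Set V} (hZ : Conn G Z)
    (hAZ : Disjoint A Z) {Q : Set V} (hQ : Cl2 G Q) (hQA : Q ⊆ A) (hQZ : Q ⊆ nb G Z)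
    {L : V → Finset ℕ} {ψ : V → ℕ}
    (h1 : ∀ q ∈ Q, ψ q ∈ L q) (h2 : ∀ x ∈ Q, ∀ y ∈ Q, x ≠ y → ψ x ≠ ψ y)
    (h3 : ∀ v ∈ A, v ∉ Q → 3 ≤ (L v).card) (h5 : ∀ v ∈ A, v ∉ nb G Z → 5 ≤ (L v).card) :
    ∃ φ, Col G A L φ ∧ ∀ q ∈ Q, φ q = ψ q :=
  thomassen_aux hG A.ncard A Z le_rfl hZ hAZ Q hQ hQA hQZ L ψ h1 h2 h3 h5

/-- one vertex with an arbitrary nonempty list -/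
theorem thom_one [Finite V] (hG : NoMin G) {A Z : Set V} (hZ : Conn G Z)
    (hAZ : Disjoint A Z) {L : V → Finset ℕ} (s : V) (hs : s ∈ A → (L s).Nonempty)
    (h3 : ∀ v ∈ A, v ≠ s → 3 ≤ (L v).card) (h5 : ∀ v ∈ A, v ∉ nb G Z → 5 ≤ (L v).card) :
    Ext G A L := by
  by_cases h : s ∈ A ∧ s ∈ nb G Z
  · obtain ⟨c, hc⟩ := hs h.1
    obtain ⟨φ, hφ, _⟩ := thomassen (Q := {s}) (ψ := fun _ => c) (L := L) hG hZ hAZ (Cl2.single s)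
      (by simpa using h.1) (by simpa using h.2) (by simpa using hc) (by simp) h3 h5
    exact ⟨φ, hφ⟩
  · obtain ⟨φ, hφ, _⟩ := thomassen (Q := ∅) (ψ := fun _ => 0) (L := L) hG hZ hAZ Cl2.empty
      (by simp) (by simp) (by simp) (by simp) (by
        intro v hv _
        by_cases e : v = s
        · subst e
          have := h5 v hv (fun h' => h ⟨hv, h'⟩)
          omega
        · exact h3 v hv e) h5
    exact ⟨φ, hφ⟩

theorem Closed.sub {A Q K : Set V} (h : Closed G A Q K) : K ⊆ A := fun _ hk => (h.1 hk).1

theorem Closed.mono {A B Q K : Set V} (h : Closed G A Q K) (hB : B ⊆ A) (hK : K ⊆ B) :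
    Closed G B Q K := ⟨fun k hk => ⟨hK hk, (h.1 hk).2⟩, fun k hk v hv => h.2 k hk v (hB hv)⟩

theorem ext_closed [Finite V] (hG : NoMin G) {A Z : Set V} (hZ : Conn G Z)
    (hAZ : Disjoint A Z) {Q K : Set V} (hQ : Cl2 G Q) (hQA : Q ⊆ A) (hQZ : Q ⊆ nb G Z)
    (hK : Closed G A Q K) {L : V → Finset ℕ} {φ : V → ℕ} (hφ : Col G (A \ K) L φ)
    (h3 : ∀ v ∈ K, 3 ≤ (L v).card) (h5 : ∀ v ∈ K, v ∉ nb G Z → 5 ≤ (L v).card) :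
    ∃ f, Col G A L f ∧ ∀ v, v ∉ K → f v = φ v := by
  have hQK : Q ⊆ A \ K := fun q hq => ⟨hQA hq, fun h => (hK.1 h).2 hq⟩
  obtain ⟨φ2, h1, h2⟩ := thomassen (A := K ∪ Q) (ψ := φ) (L := L) hG hZ
    (disj_sub hAZ (union_subset hK.sub hQA)) hQ subset_union_right hQZ
    (fun q hq => hφ.1 q (hQK hq))
    (fun x hx y hy hne => hφ.2 x (hQK hx) y (hQK hy) (hQ.adj hx hy hne))
    (fun v hv hvQ => h3 v (hv.resolve_right hvQ))
    (fun v hv hvZ => h5 v (hv.resolve_right (fun h => hvZ (hQZ h))) hvZ)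
  obtain ⟨f, hf, _, hf2⟩ := glue hK hφ h1 (fun q hq => (h2 q hq).symm)
  exact ⟨f, hf, hf2⟩

theorem tri_ext [Finite V] (hG : NoMin G) {A K : Set V} {x y z : V} (hxy : G.Adj x y)
    (hyz : G.Adj y z) (hxz : G.Adj x z) (hx : x ∈ A) (hy : y ∈ A) (hz : z ∈ A)
    (hK : Closed G A {x, y, z} K) {L : V → Finset ℕ} {φ : V → ℕ} (hφ : Col G (A \ K) L φ)
    (h5 : ∀ v ∈ K, 5 ≤ (L v).card) :
    ∃ f, Col G A L f ∧ ∀ v, v ∉ K → f v = φ v := by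
  have n1 := hxy.ne
  have n2 := hyz.ne
  have n3 := hxz.ne
  have hKn : ∀ k ∈ K, k ≠ x ∧ k ≠ y ∧ k ≠ z := fun k hk => by
    have := (hK.1 hk).2
    simpa using this
  have mx : x ∈ A \ K := ⟨hx, fun h => (hKn x h).1 rfl⟩
  have my : y ∈ A \ K := ⟨hy, fun h => (hKn y h).2.1 rfl⟩
  have mz : z ∈ A \ K := ⟨hz, fun h => (hKn z h).2.2 rfl⟩
  have cxy := hφ.2 x mx y my hxy
  have cyz := hφ.2 y my z mz hyz
  have cxz := hφ.2 x mx z mz hxz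
  obtain ⟨φ2, h1, h2⟩ := thomassen (A := (K ∪ {x, y, z}) \ {z}) (Z := {z}) (Q := {x, y}) (ψ := φ)
    (L := resid G L {z} φ) hG (Conn.single z) disjoint_sdiff_left (Cl2.pair hxy) (by grind)
    (by rintro q (rfl | rfl)
        · exact nb_single.2 hxz
        · exact nb_single.2 hyz)
    (by rintro q (rfl | rfl)
        · exact mem_resid.2 ⟨hφ.1 _ mx, by rintro r rfl _; exact cxz.symm⟩
        · exact mem_resid.2 ⟨hφ.1 _ my, by rintro r rfl _; exact cyz.symm⟩)
    (by grind)
    (by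
      intro v hv hvQ
      have := resid_card (G := G) (L := L) (R := {z}) (ψ := φ) (v := v) {φ z} (by simp)
      simp at this
      have := h5 v (by grind)
      omega)
    (by
      intro v hv hvZ
      have := resid_card0 (G := G) (L := L) (R := {z}) (ψ := φ) (v := v)
        (by simpa using fun h => hvZ (nb_single.2 h))
      have : v ∈ K := by
        rcases hv with ⟨hv | rfl | rfl | rfl, hvz⟩
        · exact hv
        · exact (hvZ (nb_single.2 hxz)).elim
        · exact (hvZ (nb_single.2 hyz)).elim
        · exact (hvz rfl).elim
      have := h5 v this
      omega)
  obtain ⟨g, hg, hg1, hg2⟩ := col_resid (A := K ∪ {x, y, z}) (Col.single (hφ.1 z mz)) h1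
  obtain ⟨f, hf, _, hf2⟩ := glue hK hφ hg (by
    rintro q (rfl | rfl | rfl)
    · rw [hg2 _ (by simpa using n3), h2 _ (by simp)]
    · rw [hg2 _ (by simpa using n2), h2 _ (by simp)]
    · rw [hg1 _ rfl])
  exact ⟨f, hf, hf2⟩

theorem shortcut {A Q K S : Set V} (hK : Closed G A Q K)
    (hQ : ∀ x ∈ Q \ S, ∀ y ∈ Q \ S, x ∈ A → y ∈ A → Lk G ((A \ K) \ S) x y) {v w : V} (hv : v ∉ K)
    (hw : w ∉ K)
    (h : Lk G (A \ S) v w) : Lk G ((A \ K) \ S) v w := by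
  have key : (w ∉ K → Lk G ((A \ K) \ S) v w) ∧
      (w ∈ K → ∃ q ∈ Q \ S, q ∈ A ∧ Lk G ((A \ K) \ S) v q) := by
    refine h.ind (fun w => (w ∉ K → Lk G ((A \ K) \ S) v w) ∧
      (w ∈ K → ∃ q ∈ Q \ S, q ∈ A ∧ Lk G ((A \ K) \ S) v q)) ?_ ?_
    · exact ⟨fun _ => Lk.refl ⟨⟨h.left.1, hv⟩, h.left.2⟩, fun h => (hv h).elim⟩
    · intro a b h1 h2 hb hab
      constructor
      · intro hbK
        by_cases haK : a ∈ K
        · obtain ⟨q, hq, hqA, hq'⟩ := h2.2 haK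
          have hbQ : b ∈ Q := (hK.2 a haK b hb.1 hab).resolve_left hbK
          exact hq'.trans (hQ q hq b ⟨hbQ, hb.2⟩ hqA hb.1)
        · exact (h2.1 haK).tail ⟨⟨hb.1, hbK⟩, hb.2⟩ hab
      · intro hbK
        by_cases haK : a ∈ K
        · exact h2.2 haK
        · have haQ : a ∈ Q := (hK.2 b hbK a h1.right.1 hab.symm).resolve_left haK
          exact ⟨a, ⟨haQ, h1.right.2⟩, h1.right.1, h2.1 haK⟩
  exact key.1 hw

theorem shortcut_cl {A Q K S : Set V} (hK : Closed G A Q K) (hQ : Cl2 G Q) {v w : V} (hv : v ∉ K)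
    (hw : w ∉ K) (h : Lk G (A \ S) v w) : Lk G ((A \ K) \ S) v w := by
  refine shortcut hK ?_ hv hw h
  intro x hx y hy hxA hyA
  have mx : x ∈ (A \ K) \ S := ⟨⟨hxA, fun h => (hK.1 h).2 hx.1⟩, hx.2⟩
  have my : y ∈ (A \ K) \ S := ⟨⟨hyA, fun h => (hK.1 h).2 hy.1⟩, hy.2⟩
  by_cases e : x = y
  · subst e; exact Lk.refl mx
  · exact Lk.of_adj mx my (hQ.adj hx.1 hy.1 e)

/-- if a walk leaves a component of `B` within `A`, then the component touches the outside -/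
theorem exit_comp {A B : Set V} {u w : V} (hu : u ∈ B) (h : Lk G A u w) (hw : w ∉ B) :
    ∃ b ∈ A, b ∉ B ∧ Touch G (comp G B u) {b} := by
  by_contra hcon
  have : w ∈ comp G B u := by
    refine h.ind (fun w => w ∈ comp G B u) (mem_comp hu) ?_
    intro a b _ ha hb hab
    by_cases hbB : b ∈ B
    · exact comp_step ha hbB hab
    · exact (hcon ⟨b, hb, hbB, a, ha, b, rfl, hab⟩).elim
  exact hw (comp_sub this)

theorem tri_cyc (hG : NoMin G) {A Z : Set V} (hZ : Conn G Z) (hAZ : Disjoint A Z) {x y z : V}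
    (hxy : G.Adj x y) (hyz : G.Adj y z) (hxz : G.Adj x z) (hx : x ∈ A) (hy : y ∈ A) (hz : z ∈ A)
    (hxZ : x ∈ nb G Z) (hyZ : y ∈ nb G Z) (hzZ : z ∈ nb G Z)
    (c1 : Conn G (A \ {x, y})) (c2 : Conn G (A \ {y, z})) (c3 : Conn G (A \ {x, z}))
    {v : V} (hv : v ∈ A) (hvZ : v ∈ nb G Z) : v = x ∨ v = y ∨ v = z := by
  by_contra hcon
  push Not at hcon
  have n1 := hxy.ne
  have n2 := hyz.ne
  have n3 := hxz.ne
  have hnZ : ∀ v ∈ A, v ∉ Z := fun v hv hz => hAZ.le_bot ⟨hv, hz⟩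
  set B := A \ {x, y, z} with hB
  have hvB : v ∈ B := by grind
  have t1 : Touch G (comp G B v) {x} := by
    obtain ⟨b, hb, hbB, h⟩ := exit_comp hvB (c2 v (by grind) x (by grind)) (by grind)
    have : b = x := by grind
    exact this ▸ h
  have t2 : Touch G (comp G B v) {y} := by
    obtain ⟨b, hb, hbB, h⟩ := exit_comp hvB (c3 v (by grind) y (by grind)) (by grind)
    have : b = y := by grind
    exact this ▸ h
  have t3 : Touch G (comp G B v) {z} := by
    obtain ⟨b, hb, hbB, h⟩ := exit_comp hvB (c1 v (by grind) z (by grind)) (by grind)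
    have : b = z := by grind
    exact this ▸ h
  have hK : ∀ k ∈ comp G B v, k ∈ A ∧ k ≠ x ∧ k ≠ y ∧ k ≠ z := fun k hk => by
    have := comp_sub hk
    grind
  refine hG.k5 {x} {y} {z} Z (comp G B v) (.single _) (.single _) (.single _) hZ conn_comp
    ?_ ?_ ?_ ?_ ?_ ?_ ?_ ?_ ?_ ?_ (.single hxy) (.single hxz) (touch_nb hxZ) t1.symm
    (.single hyz) (touch_nb hyZ) t2.symm (touch_nb hzZ) t3.symm
    ((touch_nb hvZ).symm.mono subset_rfl (by simpa using mem_comp hvB))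
  all_goals
    rw [Set.disjoint_left]
    grind

theorem seg_conn {c : ℕ → V} {a b : ℕ} (h : ∀ i, a ≤ i → i + 1 < b → G.Adj (c i) (c (i + 1))) :
    Conn G (c '' Ico a b) := by
  refine Conn.of_root (c a) ?_
  rintro _ ⟨i, ⟨hai, hib⟩, rfl⟩
  induction i, hai using Nat.le_induction with
  | base => exact Lk.refl ⟨a, ⟨le_rfl, hib⟩, rfl⟩
  | succ i hai ih =>
    exact (ih (by omega)).tail ⟨i + 1, ⟨by omega, hib⟩, rfl⟩ (h i hai hib)

end TL

namespace TL
variable {V : Type} {G : SimpleGraph V}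

/-- a cycle in the boundary cannot have a further boundary vertex inside it -/
theorem cyc (hG : NoMin G) {A Z : Set V} (hZ : Conn G Z) (hAZ : Disjoint A Z) {c : ℕ → V} {m : ℕ}
    (hm : 3 ≤ m) (hinj : ∀ i j, i < m → j < m → c i = c j → i = j)
    (hcA : ∀ i, i < m → c i ∈ A) (hcZ : ∀ i, i < m → c i ∈ nb G Z)
    (hadj : ∀ i, i + 1 < m → G.Adj (c i) (c (i + 1))) (hwrap : G.Adj (c (m - 1)) (c 0))
    {u : V} (huA : u ∈ A) (huZ : u ∈ nb G Z) (huc : ∀ i, i < m → u ≠ c i)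
    (hl : ∀ i, i + 1 < m → ∃ j, j < m ∧ Lk G (A \ {c i, c (i + 1)}) (c j) u)
    (hlw : ∃ j, j < m ∧ Lk G (A \ {c (m - 1), c 0}) (c j) u) : False := by
  classical
  have hnZ : ∀ v ∈ A, v ∉ Z := fun v hv hz => hAZ.le_bot ⟨hv, hz⟩
  set B : Set V := A \ (c '' Ico 0 m) with hB
  have huB : u ∈ B := ⟨huA, by rintro ⟨i, hi, e⟩; exact huc i hi.2 e.symm⟩
  set K := comp G B u with hK
  have hKB : ∀ k ∈ K, k ∈ A ∧ ∀ i, i < m → k ≠ c i := fun k hk => by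
    have := comp_sub hk
    exact ⟨this.1, fun i hi e => this.2 ⟨i, ⟨by omega, hi⟩, e.symm⟩⟩
  have hKc : Conn G K := conn_comp
  have huK : u ∈ K := mem_comp huB
  -- attachments
  have att : ∀ (Q : Set V) j, j < m → Lk G (A \ Q) (c j) u →
      ∃ i, i < m ∧ c i ∉ Q ∧ Touch G K {c i} := by
    intro Q j hj hlk
    obtain ⟨b, hb, hbB, h⟩ := exit_comp (B := B) huB hlk.symm
      (by rintro ⟨_, h⟩; exact h ⟨j, ⟨by omega, hj⟩, rfl⟩)
    have : b ∈ c '' Ico 0 m := by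
      by_contra h'
      exact hbB ⟨hb.1, h'⟩
    obtain ⟨i, hi, rfl⟩ := this
    exact ⟨i, hi.2, hb.2, h⟩
  have hex : ∃ i, i < m ∧ Touch G K {c i} := by
    obtain ⟨j, hj, h⟩ := hlw
    obtain ⟨i, h1, _, h2⟩ := att _ j hj h
    exact ⟨i, h1, h2⟩
  have a1 : ∀ i, i + 1 < m → ∃ j, j < m ∧ j ≠ i ∧ j ≠ i + 1 ∧ Touch G K {c j} := by
    intro i hi
    obtain ⟨j, hj, h⟩ := hl i hi
    obtain ⟨t, h1, h2, h3⟩ := att _ j hj h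
    refine ⟨t, h1, ?_, ?_, h3⟩ <;> rintro rfl <;> simp at h2
  have a2 : ∃ j, j < m ∧ j ≠ m - 1 ∧ j ≠ 0 ∧ Touch G K {c j} := by
    obtain ⟨j, hj, h⟩ := hlw
    obtain ⟨t, h1, h2, h3⟩ := att _ j hj h
    refine ⟨t, h1, ?_, ?_, h3⟩ <;> rintro rfl <;> simp at h2
  obtain ⟨i0, ⟨hi0, ti0⟩, hmin⟩ : ∃ i0, (i0 < m ∧ Touch G K {c i0}) ∧
      ∀ j, j < m → Touch G K {c j} → i0 ≤ j :=
    ⟨Nat.find hex, Nat.find_spec hex, fun j h1 h2 => Nat.find_min' hex ⟨h1, h2⟩⟩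
  have hex2 : ∃ r, r < m ∧ Touch G K {c (m - 1 - r)} := by
    refine ⟨m - 1 - i0, by omega, ?_⟩
    rw [show m - 1 - (m - 1 - i0) = i0 by omega]; exact ti0
  obtain ⟨i1, ⟨hi1, ti1⟩, hmax⟩ : ∃ i1, (i1 < m ∧ Touch G K {c i1}) ∧
      ∀ j, j < m → Touch G K {c j} → j ≤ i1 := by
    refine ⟨m - 1 - Nat.find hex2, ⟨by omega, (Nat.find_spec hex2).2⟩, fun j h1 h2 => ?_⟩
    have := Nat.find_min' hex2 (m := m - 1 - j) ⟨by omega, by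
      rw [show m - 1 - (m - 1 - j) = j by omega]; exact h2⟩
    omega
  have hgap : i0 + 1 < i1 := by
    by_contra hcon
    by_cases h : i0 + 1 < m
    · obtain ⟨j, h1, h2, h3, h4⟩ := a1 i0 h
      have := hmin j h1 h4
      have := hmax j h1 h4
      omega
    · obtain ⟨j, h1, h2, h3, h4⟩ := a1 (m - 2) (by omega)
      have := hmin j h1 h4
      have := hmax j h1 h4
      omega
  have hseg : ∀ a b, b ≤ m → Conn G (c '' Ico a b) := fun a b hb =>
    seg_conn (fun i _ hi => hadj i (by omega))
  have hsegd : ∀ a b a' b', b ≤ m → b' ≤ m → (b ≤ a' ∨ b' ≤ a) →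
      Disjoint (c '' Ico a b) (c '' Ico a' b') := by
    intro a b a' b' hb hb' h
    rw [Set.disjoint_left]
    rintro _ ⟨i, hi, rfl⟩ ⟨j, hj, e⟩
    have := hinj j i (by have := hj.2; omega) (by have := hi.2; omega) e
    have := hi.1; have := hi.2; have := hj.1; have := hj.2
    omega
  have hKseg : ∀ a b, b ≤ m → Disjoint K (c '' Ico a b) := by
    intro a b hb
    rw [Set.disjoint_left]
    rintro v hv ⟨i, hi, e⟩
    exact (hKB v hv).2 i (by have := hi.2; omega) e.symm
  have hZseg : ∀ a b, b ≤ m → Disjoint Z (c '' Ico a b) := by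
    intro a b hb
    rw [Set.disjoint_left]
    rintro v hv ⟨i, hi, rfl⟩
    exact hnZ _ (hcA i (by have := hi.2; omega)) hv
  have hKZ : Disjoint K Z := by
    rw [Set.disjoint_left]
    intro v hv hz
    exact hnZ v (hKB v hv).1 hz
  have tKZ : Touch G K Z := (touch_nb huZ).mono (by simpa using huK) subset_rfl
  have mseg : ∀ a b i, a ≤ i → i < b → c i ∈ c '' Ico a b := fun a b i h1 h2 => ⟨i, ⟨h1, h2⟩, rfl⟩
  have tZseg : ∀ a b, b ≤ m → a < b → Touch G Z (c '' Ico a b) := fun a b hb hab =>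
    (touch_nb (hcZ a (by omega))).symm.mono subset_rfl (by simpa using mseg a b a le_rfl hab)
  have tKseg : ∀ a b i, a ≤ i → i < b → Touch G K {c i} → Touch G K (c '' Ico a b) :=
    fun a b i h1 h2 h => h.mono subset_rfl (by simpa using mseg a b i h1 h2)
  have sing : ∀ i, c '' Ico i (i + 1) = {c i} := by
    intro i
    have : Ico i (i + 1) = {i} := by
      ext j; simp only [mem_Ico, mem_singleton_iff]; omega
    rw [this, image_singleton]
  by_cases hext : i0 = 0 ∧ i1 = m - 1
  · obtain ⟨j, hj, hj1, hj0, tj⟩ := a2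
    refine hG.k5 K Z (c '' Ico 0 j) (c '' Ico j (m - 1)) (c '' Ico (m - 1) m) hKc hZ
      (hseg _ _ (by omega)) (hseg _ _ (by omega)) (hseg _ _ (by omega)) hKZ
      (hKseg _ _ (by omega)) (hKseg _ _ (by omega)) (hKseg _ _ (by omega))
      (hZseg _ _ (by omega)) (hZseg _ _ (by omega)) (hZseg _ _ (by omega))
      (hsegd _ _ _ _ (by omega) (by omega) (by omega))
      (hsegd _ _ _ _ (by omega) (by omega) (by omega))
      (hsegd _ _ _ _ (by omega) (by omega) (by omega))
      tKZ (tKseg _ _ i0 (by omega) (by omega) ti0) (tKseg _ _ j (by omega) (by omega) tj)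
      (tKseg _ _ i1 (by omega) (by omega) ti1)
      (tZseg _ _ (by omega) (by omega)) (tZseg _ _ (by omega) (by omega))
      (tZseg _ _ (by omega) (by omega)) ?_ ?_ ?_
    · exact ⟨c (j - 1), mseg _ _ _ (by omega) (by omega), c j, mseg _ _ _ (by omega) (by omega),
        by have := hadj (j - 1) (by omega); rwa [show j - 1 + 1 = j by omega] at this⟩
    · exact ⟨c 0, mseg _ _ _ (by omega) (by omega), c (m - 1), mseg _ _ _ (by omega) (by omega),
        hwrap.symm⟩
    · exact ⟨c (m - 2), mseg _ _ _ (by omega) (by omega), c (m - 1),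
        mseg _ _ _ (by omega) (by omega),
        by have := hadj (m - 2) (by omega); rwa [show m - 2 + 1 = m - 1 by omega] at this⟩
  · set W : Set V := c '' Ico (i1 + 1) m ∪ c '' Ico 0 i0 with hW
    have hWc : Conn G W := by
      by_cases h1 : i0 = 0
      · subst h1; simpa [hW] using hseg (i1 + 1) m le_rfl
      by_cases h2 : i1 + 1 = m
      · rw [h2] at hW; simpa [hW] using hseg 0 i0 (by omega)
      refine (hseg _ _ le_rfl).union (hseg _ _ (by omega)) ?_
      exact ⟨_, mseg _ _ (m - 1) (by omega) (by omega), _, mseg _ _ 0 (by omega) (by omega), hwrap⟩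
    have tW0 : Touch G {c i0} W := by
      by_cases h : i0 = 0
      · subst h
        exact ⟨_, rfl, _, Or.inl (mseg _ _ (m - 1) (by omega) (by omega)), hwrap.symm⟩
      · exact ⟨_, rfl, _, Or.inr (mseg _ _ (i0 - 1) (by omega) (by omega)), by
          have := hadj (i0 - 1) (by omega)
          rw [show i0 - 1 + 1 = i0 by omega] at this
          exact this.symm⟩
    have tW1 : Touch G {c i1} W := by
      by_cases h : i1 + 1 = m
      · exact ⟨_, rfl, _, Or.inr (mseg _ _ 0 (by omega) (by omega)), by
          rwa [show i1 = m - 1 by omega]⟩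
      · exact ⟨_, rfl, _, Or.inl (mseg _ _ (i1 + 1) (by omega) (by omega)), hadj i1 (by omega)⟩
    have tWZ : Touch G Z W := by
      by_cases h : i0 = 0
      · exact (tZseg (i1 + 1) m le_rfl (by omega)).mono subset_rfl subset_union_left
      · exact (tZseg 0 i0 (by omega) (by omega)).mono subset_rfl subset_union_right
    have dW : ∀ s : Set V, Disjoint s (c '' Ico (i1 + 1) m) → Disjoint s (c '' Ico 0 i0) →
        Disjoint s W := fun s h1 h2 => disjoint_union_right.2 ⟨h1, h2⟩
    refine hG.k33 (c '' Ico i0 (i0 + 1)) (c '' Ico i1 (i1 + 1)) Z K (c '' Ico (i0 + 1) i1) W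
      (hseg _ _ (by omega)) (hseg _ _ (by omega)) hZ hKc (hseg _ _ (by omega)) hWc
      (hsegd _ _ _ _ (by omega) (by omega) (by omega)) (hZseg _ _ (by omega)).symm
      (hZseg _ _ (by omega)).symm (hKseg _ _ (by omega))
      (dW _ (hKseg _ _ (by omega)) (hKseg _ _ (by omega)))
      (dW _ (hsegd _ _ _ _ (by omega) (by omega) (by omega))
        (hsegd _ _ _ _ (by omega) (by omega) (by omega)))
      (hKseg _ _ (by omega)).symm (hsegd _ _ _ _ (by omega) (by omega) (by omega))
      (dW _ (hsegd _ _ _ _ (by omega) (by omega) (by omega))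
        (hsegd _ _ _ _ (by omega) (by omega) (by omega)))
      (hKseg _ _ (by omega)).symm (hsegd _ _ _ _ (by omega) (by omega) (by omega))
      (dW _ (hsegd _ _ _ _ (by omega) (by omega) (by omega))
        (hsegd _ _ _ _ (by omega) (by omega) (by omega)))
      hKZ.symm (hZseg _ _ (by omega)) (dW _ (hZseg _ _ (by omega)) (hZseg _ _ (by omega)))
      (by rw [sing]; exact ti0.symm) ?_ (by rw [sing]; exact tW0)
      (by rw [sing]; exact ti1.symm) ?_ (by rw [sing]; exact tW1)
      tKZ.symm (tZseg _ _ (by omega) (by omega)) tWZ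
    · exact ⟨_, mseg _ _ i0 (by omega) (by omega), _, mseg _ _ (i0 + 1) (by omega) (by omega),
        hadj i0 (by omega)⟩
    · exact ⟨_, mseg _ _ i1 (by omega) (by omega), _, mseg _ _ (i1 - 1) (by omega) (by omega), by
          have := hadj (i1 - 1) (by omega)
          rw [show i1 - 1 + 1 = i1 by omega] at this
          exact this.symm⟩

end TL

namespace TL
variable {V : Type} {G : SimpleGraph V}

/-- two vertices with lists of size two, on fewer than `n` vertices. -/
def M1 (G : SimpleGraph V) (n : ℕ) : Prop := ∀ (A Z : Set V) (L : V → Finset ℕ) (s t : V),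
  A.ncard < n → Conn G Z → Disjoint A Z → (∀ v ∈ A, 2 ≤ (L v).card) →
  (∀ v ∈ A, v ≠ s → v ≠ t → 3 ≤ (L v).card) → (∀ v ∈ A, v ∉ nb G Z → 5 ≤ (L v).card) → Ext G A L

def CL (G : SimpleGraph V) (D Z : Set V) : Prop :=
  ∀ Q, Cl2 G Q → Q ⊆ D → Q ⊆ nb G Z → Conn G (D \ Q)

def KL (G : SimpleGraph V) (D Z : Set V) (z : V) : Prop :=
  ∀ Q, Cl2 G Q → Q ⊆ D → Q ⊆ nb G Z → z ∉ Q → Conn G (D \ Q)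

open Classical in
/-- lists with three precoloured vertices -/
noncomputable def P3 (L : V → Finset ℕ) (x y w : V) (c a b : ℕ) (v : V) : Finset ℕ :=
  if v = x then {c} else if v = y then {a} else if v = w then {b} else L v

def E3 (G : SimpleGraph V) (D : Set V) (L : V → Finset ℕ) (x y w : V) (c a b : ℕ) : Prop :=
  Ext G D (P3 L x y w c a b)

structure Pth (G : SimpleGraph V) (D Z : Set V) (L : V → Finset ℕ) (x y w : V) : Prop where
  hZ : Conn G Z
  dZ : Disjoint D Z
  hx : x ∈ D
  hy : y ∈ D
  hw : w ∈ D
  xZ : x ∈ nb G Z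
  yZ : y ∈ nb G Z
  wZ : w ∈ nb G Z
  xy : G.Adj x y
  yw : G.Adj y w
  xw : x ≠ w
  l3 : ∀ v ∈ D, v ≠ x → v ≠ y → v ≠ w → 3 ≤ (L v).card
  l5 : ∀ v ∈ D, v ∉ nb G Z → 5 ≤ (L v).card

theorem Pth.symm {D Z : Set V} {L : V → Finset ℕ} {x y w : V} (h : Pth G D Z L x y w) :
    Pth G D Z L w y x :=
  ⟨h.hZ, h.dZ, h.hw, h.hy, h.hx, h.wZ, h.yZ, h.xZ, h.yw.symm, h.xy.symm, h.xw.symm,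
    fun v hv h1 h2 h3 => h.l3 v hv h3 h2 h1, h.l5⟩

theorem P3_symm {L : V → Finset ℕ} {x y w : V} {c a b : ℕ} (h1 : x ≠ y) (h2 : y ≠ w) (h3 : x ≠ w) :
    P3 L x y w c a b = P3 L w y x b a c := by
  funext v
  unfold P3
  grind

theorem E3_symm {D Z : Set V} {L : V → Finset ℕ} {x y w : V} {c a b : ℕ} (h : Pth G D Z L x y w) :
    E3 G D L x y w c a b ↔ E3 G D L w y x b a c := by
  unfold E3
  rw [P3_symm h.xy.ne h.yw.ne h.xw]

theorem E3_glue {D K : Set V} {L : V → Finset ℕ} {x z w s : V} {c p b σ : ℕ}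
    (hK : Closed G D {z, s} K) (hz : z ∈ D) (hs : s ∈ D) (hxK : x ∉ K) (hwK : w ∈ K) (hxz : x ≠ z) (hxs : x ≠ s)
    (hzs : z ≠ s) (hσ : σ ∈ L s) (h1 : E3 G (D \ K) L x z s c p σ)
    (h2 : E3 G (K ∪ {z, s}) L s z w σ p b) : E3 G D L x z w c p b := by
  obtain ⟨φ1, h1⟩ := h1
  obtain ⟨φ2, h2⟩ := h2
  have hw : w ≠ z ∧ w ≠ s := by
    have := (hK.1 hwK).2
    simpa using this
  have hzK : z ∉ K := fun h => (hK.1 h).2 (by simp)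
  have hsK : s ∉ K := fun h => (hK.1 h).2 (by simp)
  have e1 := h1.1 z ⟨hz, hzK⟩
  have e2 := h1.1 s ⟨hs, hsK⟩
  have e3 := h2.1 z (by simp)
  have e4 := h2.1 s (by simp)
  simp only [P3] at e1 e2 e3 e4
  obtain ⟨f, hf, _⟩ := glue (L := P3 L x z w c p b) hK
    (h1.mono subset_rfl (by intro v hv; simp only [P3]; grind))
    (h2.mono subset_rfl (by intro v hv; simp only [P3]; grind)) (by grind)
  exact ⟨f, hf⟩

theorem tri_good [Finite V] (hG : NoMin G) {D Z : Set V} {L : V → Finset ℕ} {x y w : V} {c a b : ℕ}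
    (h : Pth G D Z L x y w) (hCL : CL G D Z) (hxw : G.Adj x w) (h1 : c ≠ a) (h2 : a ≠ b)
    (h3 : c ≠ b) : E3 G D L x y w c a b := by
  classical
  have n1 := h.xy.ne
  have n2 := h.yw.ne
  have n3 := h.xw
  have hx := h.hx
  have hy := h.hy
  have hw := h.hw
  have hX : ∀ v ∈ D, v ∈ nb G Z → v = x ∨ v = y ∨ v = w := fun v hv hvZ =>
    tri_cyc hG h.hZ h.dZ h.xy h.yw hxw h.hx h.hy h.hw h.xZ h.yZ h.wZ
      (hCL _ (Cl2.pair h.xy) (by grind) (by have := h.xZ; have := h.yZ; grind))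
      (hCL _ (Cl2.pair h.yw) (by grind) (by have := h.wZ; have := h.yZ; grind))
      (hCL _ (Cl2.pair hxw) (by grind) (by have := h.xZ; have := h.wZ; grind)) hv hvZ
  obtain ⟨f, hf, _⟩ := tri_ext (A := D) (K := D \ {x, y, w}) (L := P3 L x y w c a b)
    (φ := fun v => if v = x then c else if v = y then a else b) hG h.xy h.yw hxw h.hx h.hy h.hw
    (⟨subset_rfl, fun k hk v hv _ => by grind⟩) (by
      constructor
      · intro v hv
        simp only [P3]
        grind
      · intro v hv v' hv' hadj
        have := hadj.ne
        grind) (by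
      intro v hv
      have := h.l5 v hv.1 (fun hZ => by have := hX v hv.1 hZ; grind)
      simp only [P3]
      grind)
  exact ⟨f, hf⟩

def F1 (G : SimpleGraph V) (n : ℕ) : Prop := ∀ (D Z : Set V) (L : V → Finset ℕ) (x z w : V)
  (c p b b' : ℕ), D.ncard ≤ n → Pth G D Z L x z w → KL G D Z z → c ≠ p → b ≠ p → b' ≠ p →
  ¬ E3 G D L x z w c p b → ¬ E3 G D L x z w c p b' → b = b'

def F2 (G : SimpleGraph V) (n : ℕ) : Prop := ∀ (D Z : Set V) (L : V → Finset ℕ) (x z w : V)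
  (c p q b : ℕ), D.ncard ≤ n → Pth G D Z L x z w → KL G D Z z → ¬ G.Adj x w → p ≠ q →
  p ≠ c → q ≠ c → p ≠ b → q ≠ b → ¬ E3 G D L x z w c p b → ¬ E3 G D L x z w c q b →
  ∃ t ∈ D, t ∈ nb G Z ∧ t ≠ x ∧ t ≠ z ∧ t ≠ w ∧ G.Adj t w ∧ L t = {p, q, b}

def LU (G : SimpleGraph V) (n : ℕ) : Prop := ∀ (D Z : Set V) (L : V → Finset ℕ) (x y w : V)
  (c a b a' b' : ℕ), D.ncard ≤ n → Pth G D Z L x y w → CL G D Z → ¬ G.Adj x w → c ≠ a → a ≠ b →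
  c ≠ a' → a' ≠ b' → ¬ E3 G D L x y w c a b → ¬ E3 G D L x y w c a' b' → a = a' ∧ b = b'

theorem Pth.sub {D D' Z : Set V} {L : V → Finset ℕ} {x y w : V} (h : Pth G D Z L x y w)
    (hD : D' ⊆ D) (h1 : x ∈ D') (h2 : y ∈ D') (h3 : w ∈ D') : Pth G D' Z L x y w :=
  ⟨h.hZ, disj_sub h.dZ hD, h1, h2, h3, h.xZ, h.yZ, h.wZ, h.xy, h.yw, h.xw,
    fun v hv => h.l3 v (hD hv), fun v hv => h.l5 v (hD hv)⟩

theorem KL.sub {D Z Q K : Set V} {z : V} (h : KL G D Z z) (hK : Closed G D Q K) (hQ : Cl2 G Q) :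
    KL G (D \ K) Z z := by
  intro R hR hRD hRZ hz v hv v' hw
  exact shortcut_cl hK hQ hv.1.2 hw.1.2
    (h R hR (fun r hr => (hRD hr).1) hRZ hz v ⟨hv.1.1, hv.2⟩ v' ⟨hw.1.1, hw.2⟩)

/-- pruning of components that miss the path -/
theorem prune [Finite V] (hG : NoMin G) {D Z : Set V} {L : V → Finset ℕ} {x z w : V}
    (h : Pth G D Z L x z w) (hKL : KL G D Z z) {Q K : Set V} (hQ : Cl2 G Q) (hQD : Q ⊆ D)
    (hQZ : Q ⊆ nb G Z) (hK : Closed G D Q K) (hx : x ∉ K) (hz : z ∉ K) (hw : w ∉ K) :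
    Pth G (D \ K) Z L x z w ∧ KL G (D \ K) Z z ∧
    ∀ c p b, ¬ E3 G D L x z w c p b → ¬ E3 G (D \ K) L x z w c p b := by
  refine ⟨h.sub sdiff_subset ⟨h.hx, hx⟩ ⟨h.hy, hz⟩ ⟨h.hw, hw⟩, hKL.sub hK hQ, ?_⟩
  rintro c p b hb ⟨φ, hφ⟩
  apply hb
  have e : ∀ v ∈ K, P3 L x z w c p b v = L v := by
    intro v hv; simp only [P3]; grind
  obtain ⟨f, hf, _⟩ := ext_closed hG h.hZ h.dZ hQ hQD hQZ hK hφ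
    (fun v hv => by rw [e v hv]; exact h.l3 v (hK.sub hv) (by grind) (by grind) (by grind))
    (fun v hv => by rw [e v hv]; exact h.l5 v (hK.sub hv))
  exact ⟨f, hf⟩

/-- if `z` separates `x` and `w` everything extends -/
theorem caseA [Finite V] (hG : NoMin G) {D Z : Set V} {L : V → Finset ℕ} {x z w : V}
    (h : Pth G D Z L x z w) (hn : ¬ Lk G (D \ {z}) x w) {c p b : ℕ} (h1 : c ≠ p) (h2 : p ≠ b) :
    E3 G D L x z w c p b := by
  classical
  have n1 := h.xy.ne
  have n2 := h.yw.ne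
  have n3 := h.xw
  set K := comp G (D \ {z}) w with hK
  have hKc : Closed G D {z} K := closed_comp
  have hw := h.hw
  have hz := h.hy
  have hwK : w ∈ K := mem_comp (by grind)
  have hxK : x ∉ K := fun h => hn (Lk.symm h)
  have hzK : z ∉ K := fun h => (hKc.1 h).2 rfl
  have hxZ := h.xZ
  have hzZ := h.yZ
  have hwZ := h.wZ
  have hx := h.hx
  set ψ : V → ℕ := fun v => if v = x then c else if v = z then p else b with hψ
  have ex : P3 L x z w c p b x = {c} := by simp [P3]
  have ez : P3 L x z w c p b z = {p} := by simp [P3, n1.symm]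
  have ew : P3 L x z w c p b w = {b} := by simp [P3, n3.symm, n2.symm]
  have e : ∀ v, v ≠ x → v ≠ z → v ≠ w → P3 L x z w c p b v = L v := by
    intro v; simp only [P3]; grind
  have hKD := hKc.sub
  have e5 : ∀ v ∈ D, v ∉ nb G Z → 5 ≤ (P3 L x z w c p b v).card := by
    intro v hv hvZ
    rw [e v (by grind) (by grind) (by grind)]
    exact h.l5 v hv hvZ
  obtain ⟨φ1, f1, g1⟩ := thomassen (A := D \ K) (Q := {x, z}) (ψ := ψ) (L := P3 L x z w c p b) hG h.hZ
    (disj_sub h.dZ sdiff_subset) (Cl2.pair h.xy) (by grind) (by grind)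
    (by rintro q (rfl | rfl)
        · rw [ex]; simp [ψ]
        · rw [ez]; simp [ψ, n1.symm]) (by grind)
    (fun v hv hvQ => by
      rw [e v (by grind) (by grind) (by grind)]
      exact h.l3 v hv.1 (by grind) (by grind) (by grind)) (fun v hv => e5 v hv.1)
  obtain ⟨φ2, f2, g2⟩ := thomassen (A := K ∪ {z}) (Q := {z, w}) (ψ := ψ) (L := P3 L x z w c p b) hG h.hZ
    (disj_sub h.dZ (by grind)) (Cl2.pair h.yw) (by grind) (by grind)
    (by rintro q (rfl | rfl)
        · rw [ez]; simp [ψ, n1.symm]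
        · rw [ew]; simp [ψ, n3.symm, n2.symm]) (by grind)
    (fun v hv hvQ => by
      rw [e v (by grind) (by grind) (by grind)]
      exact h.l3 v (by grind) (by grind) (by grind) (by grind)) (fun v hv => e5 v (by grind))
  obtain ⟨f, hf, _⟩ := glue hKc f1 f2 (by
    rintro q rfl
    rw [g1 _ (by simp), g2 _ (by simp)])
  exact ⟨f, hf⟩

end TL

namespace TL
variable {V : Type} {G : SimpleGraph V}

theorem Cl2.cases_mem {Q : Set V} (h : Cl2 G Q) {z : V} (hz : z ∈ Q) :
    Q = {z} ∨ ∃ s, G.Adj z s ∧ Q = {z, s} := by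
  rcases h with rfl | ⟨a, rfl⟩ | ⟨a, b, hab, rfl⟩
  · exact hz.elim
  · left; simp at hz; rw [hz]
  · right
    rcases hz with rfl | rfl
    · exact ⟨b, hab, rfl⟩
    · exact ⟨a, hab.symm, Set.pair_comm _ _⟩

/-- every component of `D \ Q` meets `{x, w}` -/
def NP (G : SimpleGraph V) (D Z : Set V) (x z w : V) : Prop :=
  ∀ Q, Cl2 G Q → Q ⊆ D → Q ⊆ nb G Z → z ∈ Q → ∀ v ∈ D \ Q, Lk G (D \ Q) v x ∨ Lk G (D \ Q) v w

theorem NP.conn {D Z : Set V} {x z w : V} (h : NP G D Z x z w) {Q : Set V} (hQ : Cl2 G Q)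
    (h1 : Q ⊆ D) (h2 : Q ⊆ nb G Z) (hz : z ∈ Q) (hl : x ∈ Q ∨ w ∈ Q ∨ Lk G (D \ Q) x w) :
    Conn G (D \ Q) := by
  rcases hl with hl | hl | hl
  · refine Conn.of_root w (fun v hv => ?_)
    rcases h Q hQ h1 h2 hz v hv with h | h
    · exact (h.right.2 hl).elim
    · exact h.symm
  · refine Conn.of_root x (fun v hv => ?_)
    rcases h Q hQ h1 h2 hz v hv with h | h
    · exact h.symm
    · exact (h.right.2 hl).elim
  · refine Conn.of_root w (fun v hv => ?_)
    rcases h Q hQ h1 h2 hz v hv with h | h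
    · exact (h.trans hl).symm
    · exact h.symm

theorem np_or [Finite V] (hG : NoMin G) {D Z : Set V} {L : V → Finset ℕ} {x z w : V}
    (h : Pth G D Z L x z w) (hKL : KL G D Z z) :
    NP G D Z x z w ∨ ∃ D' ⊆ D, D'.ncard < D.ncard ∧ Pth G D' Z L x z w ∧ KL G D' Z z ∧
      ∀ c p b, ¬ E3 G D L x z w c p b → ¬ E3 G D' L x z w c p b := by
  by_contra hcon
  push Not at hcon
  obtain ⟨h1, h2⟩ := hcon
  apply h1
  intro Q hQ hQD hQZ hz v hv
  by_contra hno
  push Not at hno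
  set K := comp G (D \ Q) v with hK
  have hKc : Closed G D Q K := closed_comp
  have hp := prune hG h hKL hQ hQD hQZ hKc hno.1 (fun h => (hKc.1 h).2 hz) hno.2
  obtain ⟨c, p, b, h3, h4⟩ := h2 (D \ K) sdiff_subset
    (ncard_lt sdiff_subset hv.1 (fun h => h.2 (mem_comp hv))) hp.1 hp.2.1
  exact hp.2.2 c p b h3 h4

theorem CL_of {D Z : Set V} {L : V → Finset ℕ} {x z w : V}
    (h : Pth G D Z L x z w) (hKL : KL G D Z z) (hNP : NP G D Z x z w)
    (hz : Lk G (D \ {z}) x w)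
    (hs : ∀ s ∈ D, s ∈ nb G Z → G.Adj z s → s ≠ x → s ≠ w → Lk G (D \ {z, s}) x w) :
    CL G D Z := by
  intro Q hQ hQD hQZ
  by_cases hzQ : z ∈ Q
  · apply hNP.conn hQ hQD hQZ hzQ
    by_cases hx : x ∈ Q
    · exact Or.inl hx
    by_cases hw : w ∈ Q
    · exact Or.inr (Or.inl hw)
    refine Or.inr (Or.inr ?_)
    rcases hQ.cases_mem hzQ with rfl | ⟨s, hzs, rfl⟩
    · exact hz
    · exact hs s (hQD (by simp)) (hQZ (by simp)) hzs (by rintro rfl; simp at hx)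
        (by rintro rfl; simp at hw)
  · exact hKL Q hQ hQD hQZ hzQ

structure SepD (G : SimpleGraph V) (D Z : Set V) (L : V → Finset ℕ) (x z w s : V) (K : Set V) :
    Prop where
  cl : Closed G D {z, s} K
  xK : x ∉ K
  wK : w ∈ K
  zK : z ∉ K
  sK : s ∉ K
  pl : Pth G (D \ K) Z L x z s
  pr : Pth G (K ∪ {z, s}) Z L s z w
  kl : KL G (D \ K) Z z
  kr : KL G (K ∪ {z, s}) Z z
  sub : K ∪ {z, s} ⊆ D
  xR : x ∉ K ∪ {z, s}
  clR : Closed G D {z, s} ((D \ {z, s}) \ K)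
  eR : K ∪ {z, s} = D \ ((D \ {z, s}) \ K)

theorem sepD {D Z : Set V} {L : V → Finset ℕ} {x z w s : V}
    (h : Pth G D Z L x z w) (hKL : KL G D Z z) (hs : s ∈ D) (hsZ : s ∈ nb G Z) (hzs : G.Adj z s)
    (hsx : s ≠ x) (hsw : s ≠ w) (hn : ¬ Lk G (D \ {z, s}) x w) :
    SepD G D Z L x z w s (comp G (D \ {z, s}) w) := by
  set K := comp G (D \ {z, s}) w with hK
  have n1 := h.xy.ne
  have n2 := h.yw.ne
  have n3 := hzs.ne
  have hz := h.hy
  have hw := h.hw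
  have hx := h.hx
  have cl : Closed G D {z, s} K := closed_comp
  have clR : Closed G D {z, s} ((D \ {z, s}) \ K) := closed_other
  have hKD := cl.sub
  have wK : w ∈ K := mem_comp (by grind)
  have xK : x ∉ K := fun h => hn (Lk.symm h)
  have zK : z ∉ K := fun h => (cl.1 h).2 (by simp)
  have sK : s ∉ K := fun h => (cl.1 h).2 (by simp)
  have sub : K ∪ {z, s} ⊆ D := by grind
  have eR : K ∪ {z, s} = D \ ((D \ {z, s}) \ K) := by grind
  refine ⟨cl, xK, wK, zK, sK, ?_, ?_, hKL.sub cl (Cl2.pair hzs), ?_, sub, by grind, clR, eR⟩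
  · exact ⟨h.hZ, disj_sub h.dZ sdiff_subset, ⟨hx, xK⟩, ⟨hz, zK⟩, ⟨hs, sK⟩, h.xZ, h.yZ, hsZ, h.xy,
      hzs, hsx.symm, fun v hv h1 h2 h3 => h.l3 v hv.1 h1 h2 (by grind), fun v hv => h.l5 v hv.1⟩
  · exact ⟨h.hZ, disj_sub h.dZ sub, by simp, by simp, Or.inl wK, hsZ, h.yZ, h.wZ, hzs.symm,
      h.yw, hsw, fun v hv h1 h2 h3 => h.l3 v (sub hv) (by grind) h2 h3, fun v hv => h.l5 v (sub hv)⟩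
  · rw [eR]
    exact hKL.sub clR (Cl2.pair hzs)

theorem f1_of [Finite V] (hG : NoMin G) {n : ℕ} (hU : LU G n) : ∀ m, m ≤ n → F1 G m := by
  intro m
  induction m with
  | zero =>
    intro _ D Z L x z w c p b b' hc h
    have := Set.ncard_eq_zero (Set.toFinite D) |>.1 (by omega)
    have := h.hx
    simp_all
  | succ m ih =>
    intro hmn D Z L x z w c p b b' hc h hKL hcp hbp hbp' hb hb'
    have ih := ih (by omega)
    rcases np_or hG h hKL with hNP | ⟨D', hD', hlt, h', hKL', hE⟩
    swap
    · exact ih D' Z L x z w c p b b' (by omega) h' hKL' hcp hbp hbp' (hE _ _ _ hb) (hE _ _ _ hb')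
    by_cases hz : Lk G (D \ {z}) x w
    swap
    · exact (hb (caseA hG h hz hcp hbp.symm)).elim
    by_cases hs : ∀ s ∈ D, s ∈ nb G Z → G.Adj z s → s ≠ x → s ≠ w → Lk G (D \ {z, s}) x w
    · have hCL := CL_of h hKL hNP hz hs
      by_cases hxw : G.Adj x w
      · have e1 : c = b := by
          by_contra hne
          exact hb (tri_good hG h hCL hxw hcp hbp.symm hne)
        have e2 : c = b' := by
          by_contra hne
          exact hb' (tri_good hG h hCL hxw hcp hbp'.symm hne)
        rw [← e1, ← e2]
      · exact (hU D Z L x z w c p b p b' (by omega) h hCL hxw hcp hbp.symm hcp hbp'.symm hb hb').2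
    · push Not at hs
      obtain ⟨s, hs, hsZ, hzs, hsx, hsw, hn⟩ := hs
      have hS := sepD h hKL hs hsZ hzs hsx hsw hn
      set K := comp G (D \ {z, s}) w
      have hl : (D \ K).ncard < D.ncard := ncard_lt sdiff_subset h.hw (fun h => h.2 hS.wK)
      have hr : (K ∪ {z, s}).ncard < D.ncard := ncard_lt hS.sub h.hx hS.xR
      obtain ⟨σ, hσ, hσp, hσE⟩ : ∃ σ ∈ L s, σ ≠ p ∧ E3 G (D \ K) L x z s c p σ := by
        have h3 := h.l3 s hs hsx hzs.ne.symm hsw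
        have : 1 < ((L s).erase p).card := by
          have := Finset.pred_card_le_card_erase (s := L s) (a := p)
          omega
        obtain ⟨c1, h1, c2, h2, h12⟩ := Finset.one_lt_card.1 this
        simp only [Finset.mem_erase] at h1 h2
        by_contra hcon
        push Not at hcon
        exact h12 (ih _ Z L x z s c p c1 c2 (by omega) hS.pl hS.kl hcp h1.1 h2.1
          (hcon c1 h1.2 h1.1) (hcon c2 h2.2 h2.1))
      have hg : ∀ b, ¬ E3 G D L x z w c p b → ¬ E3 G (K ∪ {z, s}) L s z w σ p b :=
        fun b hb he => hb (E3_glue hS.cl h.hy hs hS.xK hS.wK h.xy.ne hsx.symm hzs.ne hσ hσE he)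
      exact ih _ Z L s z w σ p b b' (by omega) hS.pr hS.kr hσp hbp hbp' (hg b hb) (hg b' hb')

theorem pigeon3 {p1 p2 p3 q1 q2 q3 : Prop} (o1 : p1 ∨ q1) (o2 : p2 ∨ q2) (o3 : p3 ∨ q3)
    (a : p1 → p2 → False) (b : p1 → p3 → False) (c : p2 → p3 → False)
    (d : q1 → q2 → False) (e : q1 → q3 → False) (f : q2 → q3 → False) : False := by
  tauto

set_option maxHeartbeats 1000000 in
theorem f2_of [Finite V] (hG : NoMin G) {n : ℕ} (hU : LU G n) (hF : F1 G n) :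
    ∀ m, m ≤ n → F2 G m := by
  intro m
  induction m with
  | zero =>
    intro _ D Z L x z w c p q b hc h
    have := Set.ncard_eq_zero (Set.toFinite D) |>.1 (by omega)
    have := h.hx
    simp_all
  | succ m ih =>
    intro hmn D Z L x z w c p q b hc h hKL hxw hpq hpc hqc hpb hqb hbp hbq
    have ih := ih (by omega)
    rcases np_or hG h hKL with hNP | ⟨D', hD', hlt, h', hKL', hE⟩
    swap
    · obtain ⟨t, ht, h2⟩ := ih D' Z L x z w c p q b (by omega) h' hKL' hxw hpq hpc hqc hpb hqb
        (hE _ _ _ hbp) (hE _ _ _ hbq)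
      exact ⟨t, hD' ht, h2⟩
    by_cases hz : Lk G (D \ {z}) x w
    swap
    · exact (hbp (caseA hG h hz hpc.symm hpb)).elim
    by_cases hs : ∀ s ∈ D, s ∈ nb G Z → G.Adj z s → s ≠ x → s ≠ w → Lk G (D \ {z, s}) x w
    · have hCL := CL_of h hKL hNP hz hs
      exact (hpq (hU D Z L x z w c p b q b (by omega) h hCL hxw hpc.symm hpb hqc.symm hqb
        hbp hbq).1).elim
    push Not at hs
    obtain ⟨s, ⟨hs, hsZ, hzs, hsx, hsw, hn⟩, hmin⟩ : ∃ s, (s ∈ D ∧ s ∈ nb G Z ∧ G.Adj z s ∧ s ≠ x ∧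
        s ≠ w ∧ ¬ Lk G (D \ {z, s}) x w) ∧ ∀ s', (s' ∈ D ∧ s' ∈ nb G Z ∧ G.Adj z s' ∧ s' ≠ x ∧
        s' ≠ w ∧ ¬ Lk G (D \ {z, s'}) x w) →
        (comp G (D \ {z, s}) w).ncard ≤ (comp G (D \ {z, s'}) w).ncard := by
      obtain ⟨s, hs⟩ := hs
      have := Set.exists_min_image {s | s ∈ D ∧ s ∈ nb G Z ∧ G.Adj z s ∧ s ≠ x ∧
        s ≠ w ∧ ¬ Lk G (D \ {z, s}) x w} (fun s => (comp G (D \ {z, s}) w).ncard)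
        (Set.toFinite _) ⟨s, hs⟩
      exact this
    have hS := sepD h hKL hs hsZ hzs hsx hsw hn
    set K := comp G (D \ {z, s}) w with hK
    have hl : (D \ K).ncard < D.ncard := ncard_lt sdiff_subset h.hw (fun h => h.2 hS.wK)
    have hr : (K ∪ {z, s}).ncard < D.ncard := ncard_lt hS.sub h.hx hS.xR
    have hconnz : Conn G (D \ {z}) := hNP.conn (Cl2.single z) (by simpa using h.hy)
      (by simpa using h.yZ) rfl (Or.inr (Or.inr hz))
    have n1 := h.xy.ne
    have n2 := h.yw.ne
    have n3 := hzs.ne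
    have hxs : Lk G ((D \ K) \ {z}) x s := by
      refine shortcut_cl hS.cl (Cl2.pair hzs) hS.xK hS.sK (hconnz x ⟨h.hx, n1⟩ s ⟨hs, n3.symm⟩)
    -- right side satisfies CL
    have hCL : CL G (K ∪ {z, s}) Z := by
      intro Q hQ hQD hQZ
      by_cases hzQ : z ∈ Q
      swap
      · exact hS.kr Q hQ hQD hQZ hzQ
      have pass : Conn G (D \ Q) → Conn G ((K ∪ {z, s}) \ Q) := by
        intro hc v hv v' hv'
        have := hS.eR
        rw [this] at hv hv' ⊢
        exact shortcut_cl hS.clR (Cl2.pair hzs) hv.1.2 hv'.1.2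
          (hc v ⟨hv.1.1, hv.2⟩ v' ⟨hv'.1.1, hv'.2⟩)
      have hQD' := hQD.trans hS.sub
      rcases hQ.cases_mem hzQ with rfl | ⟨s', hzs', rfl⟩
      · exact pass hconnz
      by_cases hss : s' = s
      · subst hss
        have : (K ∪ {z, s'}) \ {z, s'} = K := by
          have := hS.zK
          have := hS.sK
          grind
        rw [this]
        exact conn_comp
      have hs'K : s' ∈ K := by
        have := hQD (show s' ∈ {z, s'} by simp)
        have := hzs'.ne
        grind
      apply pass
      by_cases hsw' : s' = w
      · subst hsw'
        exact hNP.conn hQ hQD' hQZ hzQ (by simp)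
      apply hNP.conn hQ hQD' hQZ hzQ
      right; right
      by_contra hn'
      have hm := hmin s' ⟨hQD' (by simp), hQZ (by simp), hzs', fun e => hS.xK (e ▸ hs'K), hsw', hn'⟩
      have hlt : (comp G (D \ {z, s'}) w).ncard < K.ncard := by
        refine ncard_lt ?_ hs'K (fun h => (comp_sub h).2 (by simp))
        intro v hv
        have hxs' : Lk G (D \ {z, s'}) x s := hxs.mono (by
          intro a ha
          have : a ≠ s' := fun e => ha.1.2 (e ▸ hs'K)
          grind)
        have hst : Lk G ((D \ {z, s'}) ∩ {a | a ≠ s}) w v := by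
          have hm : ∀ a, Lk G (D \ {z, s'}) w a → a ≠ s := by
            rintro a ha rfl
            exact hn' (hxs'.trans ha.symm)
          refine (Lk.comp hv).mono (fun a ha => ⟨comp_sub ha, hm a ha⟩)
        exact hst.mono (by
          intro a ha
          have := ha.2
          simp only [mem_ofPred_eq] at this
          grind)
      omega
    have hls := h.l3 s hs hsx hzs.ne.symm hsw
    have claim : ∀ r, r ≠ c → r ≠ b → ¬ E3 G D L x z w c r b →
        r ∈ L s ∧ (L s).card = 3 ∧ ∃ σ ∈ L s, σ ≠ r ∧ ¬ E3 G (K ∪ {z, s}) L s z w σ r b := by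
      intro r hrc hrb hbad
      classical
      have hor : ∀ σ ∈ L s, ¬ E3 G (D \ K) L x z s c r σ ∨
          ¬ E3 G (K ∪ {z, s}) L s z w σ r b := by
        intro σ hσ
        by_contra hcon
        push Not at hcon
        exact hbad (E3_glue hS.cl h.hy hs hS.xK hS.wK h.xy.ne hsx.symm hzs.ne hσ hcon.1 hcon.2)
      have hleft : ∀ σ σ', σ ≠ r → σ' ≠ r → ¬ E3 G (D \ K) L x z s c r σ →
          ¬ E3 G (D \ K) L x z s c r σ' → σ = σ' := fun σ σ' h1 h2 h3 h4 =>
        hF _ Z L x z s c r σ σ' (by omega) hS.pl hS.kl hrc.symm h1 h2 h3 h4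
      have hright : ∀ σ σ', σ ≠ r → σ' ≠ r → ¬ E3 G (K ∪ {z, s}) L s z w σ r b →
          ¬ E3 G (K ∪ {z, s}) L s z w σ' r b → σ = σ' := fun σ σ' h1 h2 h3 h4 => by
        rw [E3_symm hS.pr] at h3 h4
        exact hF _ Z L w z s b r σ σ' (by omega) hS.pr.symm hS.kr hrb.symm h1 h2 h3 h4
      have hle : ((L s).erase r).card ≤ 2 := by
        by_contra hgt
        obtain ⟨a1, a2, a3, m1, m2, m3, e1, e2, e3⟩ := Finset.two_lt_card_iff.1
          (show 2 < ((L s).erase r).card by omega)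
        simp only [Finset.mem_erase] at m1 m2 m3
        exact pigeon3 (hor a1 m1.2) (hor a2 m2.2) (hor a3 m3.2) (fun h h' => e1 (hleft a1 a2 m1.1 m2.1 h h'))
          (fun h h' => e2 (hleft a1 a3 m1.1 m3.1 h h')) (fun h h' => e3 (hleft a2 a3 m2.1 m3.1 h h'))
          (fun h h' => e1 (hright a1 a2 m1.1 m2.1 h h')) (fun h h' => e2 (hright a1 a3 m1.1 m3.1 h h'))
          (fun h h' => e3 (hright a2 a3 m2.1 m3.1 h h'))
      have hrs : r ∈ L s := by
        by_contra hr
        rw [Finset.erase_eq_of_notMem hr] at hle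
        omega
      have hcard := Finset.card_erase_of_mem hrs
      refine ⟨hrs, by omega, ?_⟩
      obtain ⟨a1, m1, a2, m2, e1⟩ := Finset.one_lt_card.1 (show 1 < ((L s).erase r).card by omega)
      simp only [Finset.mem_erase] at m1 m2
      have l12 := hleft a1 a2 m1.1 m2.1
      rcases hor a1 m1.2 with h1 | h1
      · rcases hor a2 m2.2 with h2 | h2
        · exact (e1 (l12 h1 h2)).elim
        · exact ⟨a2, m2.2, m2.1, h2⟩
      · exact ⟨a1, m1.2, m1.1, h1⟩
    obtain ⟨hps, hcard, σp, hσp, hσpp, hEp⟩ := claim p hpc hpb hbp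
    obtain ⟨hqs, -, σq, hσq, hσqq, hEq⟩ := claim q hqc hqb hbq
    by_cases hadj : G.Adj s w
    · have e1 : σp = b := by
        by_contra hne
        exact hEp (tri_good hG hS.pr hCL hadj hσpp hpb hne)
      subst e1
      refine ⟨s, hs, hsZ, hsx, hzs.ne.symm, hsw, hadj, ?_⟩
      refine (Finset.eq_of_subset_of_card_le ?_ ?_).symm
      · intro a ha
        simp only [Finset.mem_insert, Finset.mem_singleton] at ha
        rcases ha with rfl | rfl | rfl <;> assumption
      · rw [hcard, Finset.card_eq_three.2 ⟨p, q, σp, hpq, hpb, hqb, rfl⟩]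
    · rw [E3_symm hS.pr] at hEp hEq
      exact (hpq (hU _ Z L w z s b p σp q σq (by omega) hS.pr.symm hCL (fun h => hadj h.symm)
        hpb.symm hσpp.symm hqb.symm hσqq.symm hEp hEq).1).elim

end TL

namespace TL
variable {V : Type} {G : SimpleGraph V}

theorem nb_le_one (hG : NoMin G) {D Z : Set V} (hZ : Conn G Z) (hDZ : Disjoint D Z)
    {s y : V} (hs : s ∈ D) (hsZ : s ∈ nb G Z) (hy : y ∈ D) (hyZ : y ∈ nb G Z) (hsy : G.Adj s y)
    (hc : ∀ w ∈ D, w ∈ nb G Z → G.Adj s w → Conn G (D \ {s, w})) :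
    ∃ x1, ∀ v ∈ D, v ∈ nb G Z → G.Adj s v → v ≠ y → v = x1 := by
  by_cases h : ∃ v ∈ D, v ∈ nb G Z ∧ G.Adj s v ∧ v ≠ y
  · obtain ⟨x1, m, z, ad, ne⟩ := h
    refine ⟨x1, fun v m' z' ad' ne' => ?_⟩
    by_contra hne
    exact three_nbrs hG hZ hDZ hs hsZ hc hy m m' hyZ z z' hsy ad ad' ne.symm ne'.symm
      (fun h => hne h.symm)
  · push Not at h
    exact ⟨s, fun v m z ad ne => (ne (h v m z ad)).elim⟩

theorem CL.adj {D Z : Set V} (hCL : CL G D Z) {s w : V} (hs : s ∈ D) (hsZ : s ∈ nb G Z)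
    (hw : w ∈ D) (hwZ : w ∈ nb G Z) (h : G.Adj s w) : Conn G (D \ {s, w}) :=
  hCL _ (Cl2.pair h) (by rintro v (rfl | rfl) <;> assumption) (by rintro v (rfl | rfl) <;> assumption)

theorem CL.le_one (hG : NoMin G) {D Z : Set V} (hZ : Conn G Z) (hDZ : Disjoint D Z)
    (hCL : CL G D Z) {s y : V} (hs : s ∈ D) (hsZ : s ∈ nb G Z) (hy : y ∈ D) (hyZ : y ∈ nb G Z)
    (hsy : G.Adj s y) :
    ∃ x1, ∀ v ∈ D, v ∈ nb G Z → G.Adj s v → v ≠ y → v = x1 :=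
  nb_le_one hG hZ hDZ hs hsZ hy hyZ hsy (fun w hw hwZ h => hCL.adj hs hsZ hw hwZ h)

theorem CL.mid (hG : NoMin G) {D Z : Set V} {L : V → Finset ℕ} {x y w : V} (h : Pth G D Z L x y w)
    (hCL : CL G D Z) : ∀ v ∈ D, v ∈ nb G Z → G.Adj y v → v = x ∨ v = w := by
  intro v hv hvZ hadj
  by_contra hcon
  push Not at hcon
  exact three_nbrs hG h.hZ h.dZ h.hy h.yZ (fun w hw hwZ ha => hCL.adj h.hy h.yZ hw hwZ ha) h.hx h.hw hv
    h.xZ h.wZ hvZ h.xy.symm h.yw hadj h.xw hcon.1.symm hcon.2.symm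

set_option maxHeartbeats 2000000 in
theorem bad_z [Finite V] (hG : NoMin G) {D Z : Set V} {L : V → Finset ℕ} {x y w : V} {c a b : ℕ}
    (hM : M1 G D.ncard) (h : Pth G D Z L x y w) (hCL : CL G D Z) (hxw : ¬ G.Adj x w)
    (hca : c ≠ a) (hab : a ≠ b) (hbad : ¬ E3 G D L x y w c a b) :
    ∃ z ∈ D, z ∉ nb G Z ∧ G.Adj z x ∧ G.Adj z y ∧ G.Adj z w ∧ c ≠ b ∧
      ∃ p q, p ≠ q ∧ p ≠ c ∧ p ≠ a ∧ p ≠ b ∧ q ≠ c ∧ q ≠ a ∧ q ≠ b ∧ L z = {c, a, b, p, q} := by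
  classical
  have n1 := h.xy.ne
  have n2 := h.yw.ne
  have n3 := h.xw
  obtain ⟨x1, hx1⟩ := hCL.le_one hG h.hZ h.dZ h.hx h.xZ h.hy h.yZ h.xy
  obtain ⟨t, ht⟩ := hCL.le_one hG h.hZ h.dZ h.hw h.wZ h.hy h.yZ h.yw.symm
  have hymid := hCL.mid hG h
  set R : Set V := {x, y, w} with hR
  set ψ : V → ℕ := fun v => if v = x then c else if v = y then a else b with hψ
  have px : ψ x = c := by simp [ψ]
  have py : ψ y = a := by simp [ψ, n1.symm]
  have pw : ψ w = b := by simp [ψ, n2.symm, n3.symm]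
  have hRc : Col G R (P3 L x y w c a b) ψ := by
    constructor
    · intro v hv; simp only [P3, hψ]; grind
    · have := hxw
      have h3 : ¬ G.Adj w x := fun h => hxw h.symm
      rintro v hv v' hv' hadj
      have := hadj.ne
      simp only [hR, mem_insert_iff, mem_singleton_iff] at hv hv'
      rcases hv with rfl | rfl | rfl <;> rcases hv' with rfl | rfl | rfl <;> simp_all <;> omega
  have hno : ¬ Ext G (D \ R) (resid G (P3 L x y w c a b) R ψ) := fun he => hbad (ext_resid hRc he)
  have hRZ : R ⊆ nb G Z := by
    rintro v (rfl | rfl | rfl)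
    exacts [h.xZ, h.yZ, h.wZ]
  have hP : ∀ v ∈ D \ R, P3 L x y w c a b v = L v := by
    intro v hv; simp only [P3]; grind
  have hZ' : Conn G (Z ∪ R) := h.hZ.add hRZ
  have hd' : Disjoint (D \ R) (Z ∪ R) := by
    have := h.dZ
    rw [Set.disjoint_left] at this ⊢
    grind
  have hnbR : ∀ v, v ∈ nb G R ↔ G.Adj v x ∨ G.Adj v y ∨ G.Adj v w := by
    intro v; simp [nb, hR]
  have key : ∃ z ∈ D \ R, z ∉ nb G Z ∧ (resid G (P3 L x y w c a b) R ψ z).card < 3 := by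
    by_contra hcon
    push Not at hcon
    have l5 : ∀ v ∈ D \ R, v ∉ nb G (Z ∪ R) → 5 ≤ (resid G (P3 L x y w c a b) R ψ v).card := by
      intro v hv hvZ
      rw [nb_union] at hvZ
      have := resid_card0 (G := G) (L := P3 L x y w c a b) (R := R) (ψ := ψ) (v := v)
        (fun r hr ha => hvZ (Or.inr ⟨r, hr, ha⟩))
      rw [hP v hv] at this
      exact (h.l5 v hv.1 (fun hh => hvZ (Or.inl hh))).trans this
    have l3 : ∀ v ∈ D \ R, v ≠ x1 → v ≠ t → 3 ≤ (resid G (P3 L x y w c a b) R ψ v).card := by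
      intro v hv h1 h2
      by_cases hvZ : v ∈ nb G Z
      · have := resid_card0 (G := G) (L := P3 L x y w c a b) (R := R) (ψ := ψ) (v := v) (by
          rintro r (rfl | rfl | rfl) ha
          · exact h1 (hx1 v hv.1 hvZ ha.symm (by grind))
          · have := hymid v hv.1 hvZ ha.symm; grind
          · exact h2 (ht v hv.1 hvZ ha.symm (by grind)))
        rw [hP v hv] at this
        exact (h.l3 v hv.1 (by grind) (by grind) (by grind)).trans this
      · exact hcon v hv hvZ
    by_cases hx1t : x1 = t
    · subst hx1t
      refine hno (thom_one hG hZ' hd' x1 ?_ (fun v hv h1 => l3 v hv h1 h1) l5)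
      intro hv
      by_cases hvZ : x1 ∈ nb G Z
      · have := resid_card (G := G) (L := P3 L x y w c a b) (R := R) (ψ := ψ) (v := x1) {c, b} (by
          rintro r (rfl | rfl | rfl) ha
          · simp [px]
          · have := hymid x1 hv.1 hvZ ha.symm; grind
          · simp [pw])
        rw [hP _ hv] at this
        have h2 := h.l3 x1 hv.1 (by grind) (by grind) (by grind)
        have h3 := Finset.card_le_two (a := c) (b := b)
        exact Finset.card_pos.1 (by omega)
      · exact Finset.card_pos.1 (by have := hcon _ hv hvZ; omega)
    · refine hno (hM (D \ R) (Z ∪ R) _ x1 t (ncard_lt sdiff_subset h.hx (by simp [hR])) hZ' hd' ?_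
        l3 l5)
      intro v hv
      by_cases hvZ : v ∈ nb G Z
      · have hone : ∃ d, ∀ r ∈ R, G.Adj v r → ψ r ∈ ({d} : Finset ℕ) := by
          by_cases hvx : G.Adj v x
          · refine ⟨c, ?_⟩
            rintro r (rfl | rfl | rfl) ha
            · simp [px]
            · have := hymid v hv.1 hvZ ha.symm; grind
            · exact (hx1t ((hx1 v hv.1 hvZ hvx.symm (by grind)).symm.trans
                (ht v hv.1 hvZ ha.symm (by grind)))).elim
          · refine ⟨b, ?_⟩
            rintro r (rfl | rfl | rfl) ha
            · exact (hvx ha).elim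
            · have := hymid v hv.1 hvZ ha.symm; grind
            · simp [pw]
        obtain ⟨d, hd⟩ := hone
        have := resid_card (G := G) (L := P3 L x y w c a b) (R := R) (ψ := ψ) (v := v) {d} hd
        rw [hP _ hv] at this
        have h2 := h.l3 v hv.1 (by grind) (by grind) (by grind)
        simp at this
        omega
      · have := hcon _ hv hvZ; omega
  obtain ⟨z, hz, hzZ, hzc⟩ := key
  have h5 := h.l5 z hz.1 hzZ
  have gen : ∀ C : Finset ℕ, (∀ r ∈ R, G.Adj z r → ψ r ∈ C) → 3 ≤ C.card := by
    intro C hC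
    have := resid_card (G := G) (L := P3 L x y w c a b) (R := R) (ψ := ψ) (v := z) C hC
    rw [hP _ hz] at this
    omega
  have azx : G.Adj z x := by
    by_contra hn
    have := gen {a, b} (by
      intro r hr ha
      simp only [hR, mem_insert_iff, mem_singleton_iff] at hr
      grind)
    have h3 := Finset.card_le_two (a := a) (b := b)
    omega
  have azy : G.Adj z y := by
    by_contra hn
    have := gen {c, b} (by
      intro r hr ha
      simp only [hR, mem_insert_iff, mem_singleton_iff] at hr
      grind)
    have h3 := Finset.card_le_two (a := c) (b := b)
    omega
  have azw : G.Adj z w := by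
    by_contra hn
    have := gen {c, a} (by
      intro r hr ha
      simp only [hR, mem_insert_iff, mem_singleton_iff] at hr
      grind)
    have h3 := Finset.card_le_two (a := c) (b := a)
    omega
  have hC3 := gen {c, a, b} (by
      intro r hr ha
      simp only [hR, mem_insert_iff, mem_singleton_iff] at hr
      grind)
  have hcb : c ≠ b := by
    rintro rfl
    have e : ({c, a, c} : Finset ℕ) = {c, a} := by ext; simp; tauto
    rw [e] at hC3
    have h3 := Finset.card_le_two (a := c) (b := a)
    omega
  have hres : resid G (P3 L x y w c a b) R ψ z = L z \ {c, a, b} := by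
    ext d
    rw [mem_resid, hP _ hz]
    simp only [hR, mem_insert_iff, mem_singleton_iff, forall_eq_or_imp, forall_eq, px, py, pw,
      azx, azy, azw, Finset.mem_sdiff, Finset.mem_insert, Finset.mem_singleton, true_imp_iff]
    grind
  rw [hres] at hzc
  have hC3' : ({c, a, b} : Finset ℕ).card ≤ 3 := Finset.card_le_three
  have hsub : ({c, a, b} : Finset ℕ) ⊆ L z := by
    have e1 := Finset.card_sdiff_add_card_inter (L z) {c, a, b}
    have e2 : ((L z) ∩ {c, a, b}).card ≤ _ := Finset.card_le_card Finset.inter_subset_right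
    have e3 := Finset.eq_of_subset_of_card_le (Finset.inter_subset_right (s₁ := L z) (s₂ := {c, a, b}))
      (by omega)
    exact e3 ▸ Finset.inter_subset_left
  have hcard : (L z \ {c, a, b}).card = 2 := by
    have e1 := Finset.card_sdiff_add_card_eq_card hsub
    omega
  obtain ⟨p, q, hpq, hpqe⟩ := Finset.card_eq_two.1 hcard
  have hp : p ∈ L z \ {c, a, b} := by rw [hpqe]; simp
  have hq : q ∈ L z \ {c, a, b} := by rw [hpqe]; simp
  simp only [Finset.mem_sdiff, Finset.mem_insert, Finset.mem_singleton, not_or] at hp hq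
  refine ⟨z, hz.1, hzZ, azx, azy, azw, hcb, p, q, hpq, hp.2.1, hp.2.2.1, hp.2.2.2, hq.2.1, hq.2.2.1,
    hq.2.2.2, ?_⟩
  rw [← Finset.sdiff_union_of_subset hsub, hpqe]
  ext; simp; tauto

end TL

namespace TL
variable {V : Type} {G : SimpleGraph V}

theorem sdisj {Z : Set V} {x : V} (h : x ∉ Z) : Disjoint {x} Z := Set.disjoint_singleton_left.2 h

theorem ndisj {x y : V} (h : x ≠ y) : Disjoint ({x} : Set V) {y} := by simpa using h

/-- components of `D \ {x,y,z,w}` touching `y` -/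
def Eset (G : SimpleGraph V) (D : Set V) (x y z w : V) : Set V :=
  {v | v ∈ D \ {x, y, z, w} ∧ Touch G (comp G (D \ {x, y, z, w}) v) {y}}

theorem Eset_step {D : Set V} {x y z w : V} {k v : V} (hk : k ∈ Eset G D x y z w)
    (hv : v ∈ D \ {x, y, z, w}) (ha : G.Adj k v) :
    v ∈ Eset G D x y z w ∧ comp G (D \ {x, y, z, w}) v = comp G (D \ {x, y, z, w}) k := by
  have e := comp_eq (comp_step (G := G) (mem_comp hk.1) hv ha)
  exact ⟨⟨hv, e ▸ hk.2⟩, e⟩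

structure ZV (G : SimpleGraph V) (D Z : Set V) (x y w z : V) : Prop where
  hz : z ∈ D
  zZ : z ∉ nb G Z
  zx : G.Adj z x
  zy : G.Adj z y
  zw : G.Adj z w

theorem Eset_not_both (hG : NoMin G) {D Z : Set V} {L : V → Finset ℕ} {x y w z : V}
    (h : Pth G D Z L x y w) (hz : ZV G D Z x y w z) {v : V} (hv : v ∈ Eset G D x y z w)
    (h1 : Touch G (comp G (D \ {x, y, z, w}) v) {x}) (h2 : Touch G (comp G (D \ {x, y, z, w}) v) {w}) :
    False := by
  have hs : comp G (D \ {x, y, z, w}) v ⊆ _ := comp_sub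
  set K := comp G (D \ {x, y, z, w}) v with hK
  have nZ : ∀ v ∈ D, v ∉ Z := fun v hv => Set.disjoint_left.1 h.dZ hv
  have dK : ∀ v, v ∈ ({x, y, z, w} : Set V) → Disjoint K {v} := by
    intro a ha
    rw [Set.disjoint_singleton_right]
    exact fun hh => (hs hh).2 ha
  have dKZ : Disjoint K Z := disj_sub h.dZ (fun v hv => (hs hv).1)
  exact hG.k33 K {z} Z {x} {y} {w} conn_comp (Conn.single _) h.hZ (Conn.single _) (Conn.single _)
    (Conn.single _) (dK z (by simp)) dKZ (sdisj (nZ z hz.hz)) (ndisj h.xy.ne) (ndisj h.xw) (ndisj h.yw.ne)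
    (dK x (by simp)) (dK y (by simp)) (dK w (by simp)) (ndisj hz.zx.ne) (ndisj hz.zy.ne)
    (ndisj hz.zw.ne) (sdisj (nZ x h.hx)).symm (sdisj (nZ y h.hy)).symm (sdisj (nZ w h.hw)).symm
    h1 hv.2 h2 (Touch.single hz.zx) (Touch.single hz.zy) (Touch.single hz.zw)
    (touch_nb h.xZ).symm (touch_nb h.yZ).symm (touch_nb h.wZ).symm

theorem Eset_nZ (hG : NoMin G) {D Z : Set V} {L : V → Finset ℕ} {x y w z : V}
    (h : Pth G D Z L x y w) (hCL : CL G D Z) (hz : ZV G D Z x y w z) {v : V}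
    (hv : v ∈ Eset G D x y z w) : v ∉ nb G Z := by
  intro hvZ
  have hs : comp G (D \ {x, y, z, w}) v ⊆ _ := comp_sub
  have nZ : ∀ v ∈ D, v ∉ Z := fun v hv => Set.disjoint_left.1 h.dZ hv
  have dK : ∀ a, a ∈ ({x, y, z, w} : Set V) → Disjoint {a} (comp G (D \ {x, y, z, w}) v) := by
    intro a ha
    rw [Set.disjoint_singleton_left]
    exact fun hh => (hs hh).2 ha
  have dKZ : Disjoint Z (comp G (D \ {x, y, z, w}) v) := (disj_sub h.dZ (fun v hv => (hs hv).1)).symm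
  have tKZ : Touch G Z (comp G (D \ {x, y, z, w}) v) :=
    (touch_nb hvZ).symm.mono subset_rfl (by simpa using mem_comp hv.1)
  by_cases htz : Touch G (comp G (D \ {x, y, z, w}) v) {z}
  · exact hG.k33 {y} {z} Z {x} {w} (comp G (D \ {x, y, z, w}) v) (Conn.single _) (Conn.single _) h.hZ
      (Conn.single _) (Conn.single _) conn_comp (ndisj hz.zy.ne.symm) (sdisj (nZ y h.hy))
      (sdisj (nZ z hz.hz)) (ndisj h.xw) (dK x (by simp)) (dK w (by simp)) (ndisj h.xy.ne.symm)
      (ndisj h.yw.ne) (dK y (by simp)) (ndisj hz.zx.ne) (ndisj hz.zw.ne) (dK z (by simp))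
      (sdisj (nZ x h.hx)).symm (sdisj (nZ w h.hw)).symm dKZ (Touch.single h.xy.symm)
      (Touch.single h.yw) hv.2.symm (Touch.single hz.zx) (Touch.single hz.zw) htz.symm
      (touch_nb h.xZ).symm (touch_nb h.wZ).symm tKZ
  have hvD := hv.1
  have m1 := h.hx
  have m2 := h.hw
  have n1 := h.xy.ne
  have n2 := h.yw.ne
  have n3 := h.xw
  by_cases htw : Touch G (comp G (D \ {x, y, z, w}) v) {w}
  · have htx : ¬ Touch G (comp G (D \ {x, y, z, w}) v) {x} := fun hx => Eset_not_both hG h hz hv hx htw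
    have hl := hCL.adj h.hy h.yZ h.hw h.wZ h.yw v (by grind) x (by grind)
    obtain ⟨b, hb, hbB, hbt⟩ := exit_comp hvD hl (by simp)
    have : b = x ∨ b = z := by grind
    rcases this with rfl | rfl
    · exact htx hbt
    · exact htz hbt
  · have hl := hCL.adj h.hx h.xZ h.hy h.yZ h.xy v (by grind) w (by grind)
    obtain ⟨b, hb, hbB, hbt⟩ := exit_comp hvD hl (by simp)
    have : b = w ∨ b = z := by grind
    rcases this with rfl | rfl
    · exact htw hbt
    · exact htz hbt

theorem Eset_y {D : Set V} {x y z w : V} {v : V} (hv : v ∈ D) (ha : G.Adj v y)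
    (hE : v ∉ Eset G D x y z w) : v = x ∨ v = z ∨ v = w := by
  by_contra hcon
  push Not at hcon
  have hvB : v ∈ D \ {x, y, z, w} := by have := ha.ne; grind
  exact hE ⟨hvB, v, mem_comp hvB, y, rfl, ha⟩

theorem E_ext [Finite V] (hG : NoMin G) {D Z : Set V} {L : V → Finset ℕ} {x y w z : V}
    (h : Pth G D Z L x y w) (hCL : CL G D Z) (hz : ZV G D Z x y w z) {c a b p : ℕ} (hca : c ≠ a)
    (hab : a ≠ b) (hpa : p ≠ a) (hp : p ∈ L z)
    (hE : E3 G (D \ (Eset G D x y z w ∪ {y})) L x z w c p b) : E3 G D L x y w c a b := by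
  classical
  obtain ⟨φ, hφ⟩ := hE
  have n1 := h.xy.ne
  have n2 := h.yw.ne
  have n3 := h.xw
  have n4 := hz.zx.ne
  have n5 := hz.zy.ne
  have n6 := hz.zw.ne
  have m1 := h.hx
  have m2 := h.hy
  have m3 := h.hw
  have m4 := hz.hz
  set E := Eset G D x y z w with hEdef
  have hEB : ∀ v ∈ E, v ∈ D ∧ v ≠ x ∧ v ≠ y ∧ v ≠ z ∧ v ≠ w := by
    intro v hv
    have := hv.1
    grind
  have ex : φ x = c := by
    have := hφ.1 x (by grind)
    simpa [P3] using this
  have ez : φ z = p := by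
    have := hφ.1 z (by grind)
    simpa [P3, n4] using this
  have ew : φ w = b := by
    have := hφ.1 w (by grind)
    simpa [P3, n3.symm, n6.symm] using this
  set f : V → ℕ := fun v => if v = y then a else φ v with hf
  have hyE : ∀ v ∈ D, v ∉ E → G.Adj v y → φ v ≠ a := by
    intro v hv hvE ha
    rcases Eset_y hv ha hvE with rfl | rfl | rfl <;> grind
  have c0 : Col G (D \ E) (P3 L x y w c a b) f := by
    constructor
    · intro v hv
      by_cases hvy : v = y
      · subst hvy; simp [P3, hf, n1.symm]
      · have := hφ.1 v (by grind)
        simp only [P3, hf] at this ⊢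
        grind
    · intro v hv v' hv' ha
      have := ha.ne
      by_cases hvy : v = y
      · subst hvy
        have h2 := hyE v' hv'.1 hv'.2 ha.symm
        simp only [hf]
        grind
      · by_cases hvy' : v' = y
        · subst hvy'
          have h2 := hyE v hv.1 hv.2 ha
          simp only [hf]
          grind
        · have := hφ.2 v (by grind) v' (by grind) ha
          simp only [hf]
          grind
  set Ex : Set V := {v | v ∈ E ∧ ¬ Touch G (comp G (D \ {x, y, z, w}) v) {w}} with hEx
  set Ew : Set V := {v | v ∈ E ∧ Touch G (comp G (D \ {x, y, z, w}) v) {w}} with hEw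
  have hl5 : ∀ v ∈ E, 5 ≤ (P3 L x y w c a b v).card := by
    intro v hv
    have := h.l5 v (hEB v hv).1 (Eset_nZ hG h hCL hz hv)
    have := hEB v hv
    simp only [P3]
    grind
  have clx : Closed G D {x, y, z} Ex := by
    refine ⟨fun v hv => ?_, fun k hk v hv ha => ?_⟩
    · have := hEB v hv.1; grind
    · by_cases hvB : v ∈ D \ {x, y, z, w}
      · have := Eset_step hk.1 hvB ha
        exact Or.inl ⟨this.1, by rw [this.2]; exact hk.2⟩
      · have : v ≠ w := by
          rintro rfl
          exact hk.2 ⟨k, mem_comp hk.1.1, v, rfl, ha⟩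
        right; grind
  have clw : Closed G D {y, z, w} Ew := by
    refine ⟨fun v hv => ?_, fun k hk v hv ha => ?_⟩
    · have := hEB v hv.1; grind
    · by_cases hvB : v ∈ D \ {x, y, z, w}
      · have := Eset_step hk.1 hvB ha
        exact Or.inl ⟨this.1, by rw [this.2]; exact hk.2⟩
      · have : v ≠ x := by
          rintro rfl
          exact Eset_not_both hG h hz hk.1 ⟨k, mem_comp hk.1.1, v, rfl, ha⟩ hk.2
        right; grind
  have hsplit : (D \ Ew) \ Ex = D \ E := by
    ext v
    simp only [hEx, hEw, mem_sdiff, mem_ofPred_eq]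
    tauto
  obtain ⟨f1, hf1, -⟩ := tri_ext (A := D \ Ew) (K := Ex) hG h.xy hz.zy.symm hz.zx.symm (by grind) (by grind) (by grind)
    (clx.mono sdiff_subset (fun v hv => ⟨(clx.1 hv).1, fun h => hv.2 h.2⟩)) (hsplit ▸ c0)
    (fun v hv => hl5 v hv.1)
  obtain ⟨f2, hf2, -⟩ := tri_ext hG hz.zy.symm hz.zw h.yw h.hy hz.hz h.hw clw hf1
    (fun v hv => hl5 v hv.1)
  exact ⟨f2, hf2⟩

theorem D1_pth {D Z : Set V} {L : V → Finset ℕ} {x y w z : V}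
    (h : Pth G D Z L x y w) (hz : ZV G D Z x y w z) :
    Pth G (D \ (Eset G D x y z w ∪ {y})) (Z ∪ {y}) L x z w := by
  have hEB : ∀ v ∈ Eset G D x y z w, v ≠ x ∧ v ≠ y ∧ v ≠ z ∧ v ≠ w := by
    intro v hv
    have := hv.1
    grind
  have n1 := h.xy.ne
  have n2 := h.yw.ne
  have n5 := hz.zy.ne
  have m1 := h.hx
  have m2 := h.hy
  have m3 := h.hw
  have m4 := hz.hz
  have dZ := h.dZ
  refine ⟨h.hZ.add (by simpa using h.yZ), ?_, by grind, by grind, by grind, ?_, ?_, ?_, hz.zx.symm,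
    hz.zw, h.xw, ?_, ?_⟩
  · rw [Set.disjoint_left] at dZ ⊢
    grind
  · rw [nb_union]; exact Or.inl h.xZ
  · rw [nb_union]; exact Or.inr (nb_single.2 hz.zy)
  · rw [nb_union]; exact Or.inl h.wZ
  · intro v hv h1 h2 h3
    exact h.l3 v hv.1 h1 (by grind) h3
  · intro v hv hvZ
    rw [nb_union] at hvZ
    exact h.l5 v hv.1 (fun hh => hvZ (Or.inl hh))

theorem D1_nb {D Z : Set V} {L : V → Finset ℕ} {x y w z : V}
    (h : Pth G D Z L x y w) {v : V} (hv : v ∈ D \ (Eset G D x y z w ∪ {y})) (hvz : v ≠ z)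
    (hvZ : v ∈ nb G (Z ∪ {y})) : v ∈ nb G Z := by
  rw [nb_union] at hvZ
  rcases hvZ with hvZ | hvy
  · exact hvZ
  · rcases Eset_y hv.1 (nb_single.1 hvy) (fun h => hv.2 (Or.inl h)) with rfl | rfl | rfl
    · exact h.xZ
    · exact (hvz rfl).elim
    · exact h.wZ

theorem D1_KL {D Z : Set V} {L : V → Finset ℕ} {x y w z : V}
    (h : Pth G D Z L x y w) (hCL : CL G D Z) (hz : ZV G D Z x y w z) :
    KL G (D \ (Eset G D x y z w ∪ {y})) (Z ∪ {y}) z := by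
  have hEB : ∀ v ∈ Eset G D x y z w, v ∈ D ∧ v ≠ x ∧ v ≠ y ∧ v ≠ z ∧ v ≠ w := by
    intro v hv
    have := hv.1
    grind
  have n1 := h.xy.ne
  have n2 := h.yw.ne
  have n5 := hz.zy.ne
  have m1 := h.hx
  have m2 := h.hy
  have m3 := h.hw
  have m4 := hz.hz
  intro Q hQ hQD hQZ hzQ
  have hc := hCL Q hQ (hQD.trans sdiff_subset) (fun q hq => D1_nb h (hQD hq) (by grind) (hQZ hq))
  have hcl : Closed G D {x, z, w} (Eset G D x y z w ∪ {y}) := by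
    constructor
    · intro v hv
      rcases hv with hv | rfl
      · have := hEB v hv; grind
      · grind
    · intro k hk v hv ha
      by_cases hvE : v ∈ Eset G D x y z w
      · exact Or.inl (Or.inl hvE)
      rcases hk with hk | rfl
      · by_cases hvB : v ∈ D \ {x, y, z, w}
        · exact Or.inl (Or.inl (Eset_step hk hvB ha).1)
        · grind
      · have := Eset_y hv ha.symm hvE
        right; grind
  intro v hv v' hv'
  refine shortcut hcl ?_ hv.1.2 hv'.1.2 (hc v ⟨hv.1.1, hv.2⟩ v' ⟨hv'.1.1, hv'.2⟩)
  set A := (D \ (Eset G D x y z w ∪ {y})) \ Q with hA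
  have zA : z ∈ A := by grind
  have toz : ∀ a ∈ ({x, z, w} : Set V) \ Q, Lk G A a z := by
    rintro a ⟨ha, haQ⟩
    have haA : a ∈ A := by grind
    rcases ha with rfl | rfl | rfl
    · exact Lk.of_adj haA zA hz.zx.symm
    · exact Lk.refl haA
    · exact Lk.of_adj haA zA hz.zw.symm
  intro a ha a' ha' _ _
  exact (toz a ha).trans (toz a' ha').symm

theorem bad_struct [Finite V] (hG : NoMin G) {n : ℕ} {D Z : Set V} {L : V → Finset ℕ} {x y w : V}
    {c a b : ℕ} (hM : M1 G D.ncard) (hF : F2 G n) (hn : D.ncard ≤ n + 1)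
    (h : Pth G D Z L x y w) (hCL : CL G D Z) (hxw : ¬ G.Adj x w)
    (hca : c ≠ a) (hab : a ≠ b) (hbad : ¬ E3 G D L x y w c a b) :
    ∃ z, ZV G D Z x y w z ∧ c ≠ b ∧
      ∃ p q, p ≠ q ∧ p ≠ c ∧ p ≠ a ∧ p ≠ b ∧ q ≠ c ∧ q ≠ a ∧ q ≠ b ∧ L z = {c, a, b, p, q} ∧
      (∃ t ∈ D, t ∈ nb G Z ∧ t ≠ y ∧ G.Adj w t ∧ L t = {p, q, b}) ∧
      (∃ t ∈ D, t ∈ nb G Z ∧ t ≠ y ∧ G.Adj x t ∧ L t = {p, q, c}) := by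
  obtain ⟨z, hzD, hzZ, zx, zy, zw, hcb, p, q, hpq, hpc, hpa, hpb, hqc, hqa, hqb, hLz⟩ :=
    bad_z hG hM h hCL hxw hca hab hbad
  have hz : ZV G D Z x y w z := ⟨hzD, hzZ, zx, zy, zw⟩
  refine ⟨z, hz, hcb, p, q, hpq, hpc, hpa, hpb, hqc, hqa, hqb, hLz, ?_⟩
  have hp1 : ¬ E3 G (D \ (Eset G D x y z w ∪ {y})) L x z w c p b := fun he =>
    hbad (E_ext hG h hCL hz hca hab hpa (by simp [hLz]) he)
  have hq1 : ¬ E3 G (D \ (Eset G D x y z w ∪ {y})) L x z w c q b := fun he =>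
    hbad (E_ext hG h hCL hz hca hab hqa (by simp [hLz]) he)
  have hP := D1_pth h hz
  have hK := D1_KL h hCL hz
  have hc : (D \ (Eset G D x y z w ∪ {y})).ncard ≤ n := by
    have := ncard_lt (A := D) (B := D \ (Eset G D x y z w ∪ {y})) sdiff_subset h.hy (by simp)
    omega
  constructor
  · obtain ⟨t, ht, htZ, -, t2, -, ta, tL⟩ := hF _ _ L x z w c p q b hc hP hK hxw hpq hpc hqc hpb hqb hp1 hq1
    exact ⟨t, ht.1, D1_nb h ht t2 htZ, fun e => ht.2 (Or.inr e), ta.symm, tL⟩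
  · rw [E3_symm hP] at hp1 hq1
    obtain ⟨t, ht, htZ, -, t2, -, ta, tL⟩ := hF _ _ L w z x b p q c hc hP.symm hK (fun e => hxw e.symm) hpq
      hpb hqb hpc hqc hp1 hq1
    exact ⟨t, ht.1, D1_nb h ht t2 htZ, fun e => ht.2 (Or.inr e), ta.symm, tL⟩

theorem lu_succ [Finite V] (hG : NoMin G) {n : ℕ} (hM : M1 G (n + 1)) (hF : F2 G n) : LU G (n + 1) := by
  intro D Z L x y w c a b a' b' hn h hCL hxw hca hab hca' hab' hb hb'
  have hM' : M1 G D.ncard := fun A Z L s t hA => hM A Z L s t (by omega)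
  obtain ⟨z, hz, hcb, p, q, hpq, hpc, hpa, hpb, hqc, hqa, hqb, hLz, ⟨t, t1, t2, t3, t4, t5⟩,
    ⟨r, r1, r2, r3, r4, r5⟩⟩ := bad_struct hG hM' hF hn h hCL hxw hca hab hb
  obtain ⟨z', hz', hcb', p', q', hpq', hpc', hpa', hpb', hqc', hqa', hqb', hLz', ⟨t', t1', t2', t3', t4', t5'⟩,
    ⟨r', r1', r2', r3', r4', r5'⟩⟩ := bad_struct hG hM' hF hn h hCL hxw hca' hab' hb'
  have nZ : ∀ v ∈ D, v ∉ Z := fun v hv => Set.disjoint_left.1 h.dZ hv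
  have ez : z = z' := by
    by_contra hne
    exact hG.k33 {z} {z'} Z {x} {y} {w} (Conn.single _) (Conn.single _) h.hZ (Conn.single _)
      (Conn.single _) (Conn.single _) (ndisj hne) (sdisj (nZ z hz.hz)) (sdisj (nZ z' hz'.hz))
      (ndisj h.xy.ne) (ndisj h.xw) (ndisj h.yw.ne) (ndisj hz.zx.ne) (ndisj hz.zy.ne)
      (ndisj hz.zw.ne) (ndisj hz'.zx.ne) (ndisj hz'.zy.ne) (ndisj hz'.zw.ne)
      (sdisj (nZ x h.hx)).symm (sdisj (nZ y h.hy)).symm (sdisj (nZ w h.hw)).symm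
      (Touch.single hz.zx) (Touch.single hz.zy) (Touch.single hz.zw)
      (Touch.single hz'.zx) (Touch.single hz'.zy) (Touch.single hz'.zw)
      (touch_nb h.xZ).symm (touch_nb h.yZ).symm (touch_nb h.wZ).symm
  obtain ⟨x1, hx1⟩ := hCL.le_one hG h.hZ h.dZ h.hx h.xZ h.hy h.yZ h.xy
  obtain ⟨w1, hw1⟩ := hCL.le_one hG h.hZ h.dZ h.hw h.wZ h.hy h.yZ h.yw.symm
  have et : t = t' := (hw1 t t1 t2 t4 t3).trans (hw1 t' t1' t2' t4' t3').symm
  have er : r = r' := (hx1 r r1 r2 r4 r3).trans (hx1 r' r1' r2' r4' r3').symm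
  subst ez et er
  have hz2 := fun d => congrArg (d ∈ ·) (hLz.symm.trans hLz')
  have ht2 := fun d => congrArg (d ∈ ·) (t5.symm.trans t5')
  have hr2 := fun d => congrArg (d ∈ ·) (r5.symm.trans r5')
  simp only [Finset.mem_insert, Finset.mem_singleton, eq_iff_iff] at hz2 ht2 hr2
  have ea : a = a' := by
    have := hz2 a
    have := ht2 a
    grind
  subst ea
  refine ⟨rfl, ?_⟩
  have := hz2 b
  have := hr2 b
  grind

theorem F1.mono {m n : ℕ} (h : F1 G n) (hm : m ≤ n) : F1 G m :=
  fun D Z L x z w c p b b' hD => h D Z L x z w c p b b' (hD.trans hm)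

theorem lu_all [Finite V] (hG : NoMin G) : ∀ n, M1 G n → LU G n ∧ F2 G n := by
  intro n
  induction n with
  | zero =>
    intro _
    have hU : LU G 0 := by
      intro D Z L x y w c a b a' b' hn h
      have := Set.ncard_eq_zero (Set.toFinite D) |>.1 (by omega)
      have := h.hx
      simp_all
    exact ⟨hU, f2_of hG hU (f1_of hG hU 0 le_rfl) 0 le_rfl⟩
  | succ n ih =>
    intro hM
    have hU := lu_succ hG hM (ih (fun A Z L s t hA => hM A Z L s t (by omega))).2
    exact ⟨hU, f2_of hG hU (f1_of hG hU _ le_rfl) _ le_rfl⟩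

end TL

namespace TL
variable {V : Type} {G : SimpleGraph V}

structure MH (G : SimpleGraph V) (A Z : Set V) (L : V → Finset ℕ) (L0 : Finset ℕ) (k : ℕ)
    (p : ℕ → V) (u : V) : Prop where
  hZ : Conn G Z
  dZ : Disjoint A Z
  k1 : 1 ≤ k
  inj : ∀ i j, i < k → j < k → p i = p j → i = j
  pA : ∀ i, i < k → p i ∈ A
  pZ : ∀ i, i < k → p i ∈ nb G Z
  adj : ∀ i, i + 1 < k → G.Adj (p i) (p (i + 1))
  uA : u ∈ A
  uZ : u ∈ nb G Z
  up : ∀ i, i < k → u ≠ p i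
  c0 : L0.card = 2
  lp : ∀ i, i < k → L0 ⊆ L (p i)
  lu : 2 ≤ (L u).card
  l3 : ∀ v ∈ A, v ≠ u → (∀ i, i < k → v ≠ p i) → 3 ≤ (L v).card
  l5 : ∀ v ∈ A, v ∉ nb G Z → 5 ≤ (L v).card
  N : 2 ≤ k → ∀ Q, Cl2 G Q → Q ⊆ A → Q ⊆ nb G Z →
    (Q = ∅ ∨ (∃ x, Q = {x}) ∨ ∃ i, i < k ∧ p i ∈ Q) → u ∉ Q → ∀ i, i < k → p i ∉ Q →
    Lk G (A \ Q) (p i) u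
  int : 2 ≤ k → ∀ i, 0 < i → i + 1 < k → ¬ G.Adj u (p i)

/-- exceptional configuration -/
def Exc (G : SimpleGraph V) (L : V → Finset ℕ) (L0 : Finset ℕ) (k : ℕ) (p : ℕ → V) (u : V) : Prop :=
  L u = L0 ∧ Even k ∧ G.Adj u (p 0) ∧ G.Adj u (p (k - 1))

def MLt (G : SimpleGraph V) (n : ℕ) : Prop := ∀ A Z L L0 k p u, A.ncard < n →
  MH G A Z L L0 k p u → Ext G A L ∨ Exc G L L0 k p u

def MK (G : SimpleGraph V) (n k : ℕ) : Prop := ∀ A Z L L0 k' p u, A.ncard = n → k < k' →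
  MH G A Z L L0 k' p u → Ext G A L ∨ Exc G L L0 k' p u

structure Cx (G : SimpleGraph V) (n : ℕ) (A Z : Set V) (L : V → Finset ℕ) (L0 : Finset ℕ) (k : ℕ)
    (p : ℕ → V) (u : V) : Prop extends MH G A Z L L0 k p u where
  nm : NoMin G
  lt : MLt G n
  bk : MK G n k
  card : A.ncard = n
  no : ¬ Ext G A L
  ex : ¬ Exc G L L0 k p u

section
variable {n : ℕ} {A Z : Set V} {L : V → Finset ℕ} {L0 : Finset ℕ} {k : ℕ} {p : ℕ → V} {u : V}

theorem MH.rev (h : MH G A Z L L0 k p u) : MH G A Z L L0 k (fun i => p (k - 1 - i)) u := by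
  have k1 := h.k1
  refine ⟨h.hZ, h.dZ, h.k1, ?_, ?_, ?_, ?_, h.uA, h.uZ, ?_, h.c0, ?_, h.lu, ?_, h.l5, ?_, ?_⟩
  · intro i j hi hj e
    have := h.inj _ _ (by omega) (by omega) e
    omega
  · exact fun i hi => h.pA _ (by omega)
  · exact fun i hi => h.pZ _ (by omega)
  · intro i hi
    have := h.adj (k - 1 - (i + 1)) (by omega)
    have e : k - 1 - (i + 1) + 1 = k - 1 - i := by omega
    rw [e] at this
    exact this.symm
  · exact fun i hi => h.up _ (by omega)
  · exact fun i hi => h.lp _ (by omega)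
  · intro v hv hvu hvp
    refine h.l3 v hv hvu (fun i hi => ?_)
    have := hvp (k - 1 - i) (by omega)
    have e : k - 1 - (k - 1 - i) = i := by omega
    rwa [e] at this
  · intro hk Q hQ hQA hQZ hc huQ i hi hpi
    refine h.N hk Q hQ hQA hQZ ?_ huQ _ (by omega) hpi
    rcases hc with hc | hc | ⟨j, hj, hc⟩
    · exact Or.inl hc
    · exact Or.inr (Or.inl hc)
    · exact Or.inr (Or.inr ⟨_, by omega, hc⟩)
  · intro hk i hi hik
    exact h.int hk _ (by omega) (by omega)

theorem Cx.rev (h : Cx G n A Z L L0 k p u) : Cx G n A Z L L0 k (fun i => p (k - 1 - i)) u := by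
  refine ⟨h.toMH.rev, h.nm, h.lt, h.bk, h.card, h.no, ?_⟩
  rintro ⟨h1, h2, h3, h4⟩
  refine h.ex ⟨h1, h2, ?_, ?_⟩
  · simpa using h4
  · simpa using h3

theorem MH.sub {K Q : Set V} (h : MH G A Z L L0 k p u) (hQ : Cl2 G Q) (hK : Closed G A Q K)
    (hp : ∀ i, i < k → p i ∉ K) (hu : u ∉ K) : MH G (A \ K) Z L L0 k p u := by
  refine ⟨h.hZ, disj_sub h.dZ sdiff_subset, h.k1, h.inj, fun i hi => ⟨h.pA i hi, hp i hi⟩, h.pZ, h.adj,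
    ⟨h.uA, hu⟩, h.uZ, h.up, h.c0, h.lp, h.lu, fun v hv => h.l3 v hv.1, fun v hv => h.l5 v hv.1, ?_, h.int⟩
  intro hk Q' hQ' hQA hQZ hc huQ i hi hpi
  exact shortcut_cl hK hQ (hp i hi) hu
    (h.N hk Q' hQ' (hQA.trans sdiff_subset) hQZ hc huQ i hi hpi)

theorem Cx.star [Finite V] (h : Cx G n A Z L L0 k p u) {Q : Set V} (hQ : Cl2 G Q) (hQA : Q ⊆ A)
    (hQZ : Q ⊆ nb G Z) {v : V} (hv : v ∈ A \ Q) :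
    (∃ i, i < k ∧ Lk G (A \ Q) v (p i)) ∨ Lk G (A \ Q) v u := by
  by_contra hcon
  push Not at hcon
  obtain ⟨h1, h2⟩ := hcon
  have hK : Closed G A Q (comp G (A \ Q) v) := closed_comp
  have hlt : (A \ comp G (A \ Q) v).ncard < n := by
    rw [← h.card]
    exact ncard_lt sdiff_subset hv.1 (fun hh => hh.2 (mem_comp hv))
  rcases h.lt _ _ _ _ _ _ _ hlt (h.toMH.sub hQ hK h1 h2) with ⟨φ, hφ⟩ | he
  · obtain ⟨f, hf, -⟩ := ext_closed h.nm h.hZ h.dZ hQ hQA hQZ hK hφ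
      (fun w hw => h.l3 w (hK.sub hw) (by rintro rfl; exact h2 hw)
        (by rintro i hi rfl; exact h1 i hi hw)) (fun w hw => h.l5 w (hK.sub hw))
    exact h.no ⟨f, hf⟩
  · exact h.ex he

theorem m1_of_mlt [Finite V] (hG : NoMin G) (h : MLt G n) : M1 G n := by
  intro A Z L s t hA hZ hd h2 h3 h5
  have one : ∀ s, (∀ v ∈ A, v ≠ s → 3 ≤ (L v).card) → Ext G A L := by
    intro s hs
    exact thom_one hG hZ hd s (fun hs => Finset.card_pos.1 (by have := h2 s hs; omega)) hs h5
  by_cases hst : s = t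
  · subst hst
    exact one s (fun v hv hne => h3 v hv hne hne)
  by_cases hs : s ∈ A ∧ s ∈ nb G Z
  swap
  · refine one t (fun v hv hne => ?_)
    by_cases e : v = s
    · subst e
      have := h5 v hv (fun hh => hs ⟨hv, hh⟩)
      omega
    · exact h3 v hv e hne
  by_cases ht : t ∈ A ∧ t ∈ nb G Z
  swap
  · refine one s (fun v hv hne => ?_)
    by_cases e : v = t
    · subst e
      have := h5 v hv (fun hh => ht ⟨hv, hh⟩)
      omega
    · exact h3 v hv hne e
  obtain ⟨L0, hL0, hc⟩ := Finset.exists_subset_card_eq (h2 s hs.1)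
  have := h A Z L L0 1 (fun _ => s) t hA ⟨hZ, hd, le_rfl, fun i j hi hj _ => by omega, fun _ _ => hs.1,
    fun _ _ => hs.2, fun i hi => by omega, ht.1, ht.2, fun _ _ => fun e => hst e.symm, hc, fun _ _ => hL0,
    h2 t ht.1, fun v hv h1 h2 => h3 v hv (h2 0 (by omega)) h1, h5, fun h => by omega, fun h => by omega⟩
  rcases this with h | ⟨_, h, _⟩
  · exact h
  · exact absurd h (by decide)

theorem Cx.m1 [Finite V] (h : Cx G n A Z L L0 k p u) : M1 G n := m1_of_mlt h.nm h.lt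

theorem MH.plk (h : MH G A Z L L0 k p u) {Q : Set V} {a b : ℕ} (hb : b ≤ k)
    (hQ : ∀ i, a ≤ i → i < b → p i ∉ Q) {i j : ℕ} (hi : a ≤ i) (hi' : i < b) (hj : a ≤ j) (hj' : j < b) :
    Lk G (A \ Q) (p i) (p j) := by
  have := seg_conn (G := G) (c := p) (a := a) (b := b) (fun i h1 h2 => h.adj i (by omega))
  refine (this (p i) ⟨i, ⟨hi, hi'⟩, rfl⟩ (p j) ⟨j, ⟨hj, hj'⟩, rfl⟩).mono ?_
  rintro _ ⟨i, ⟨h1, h2⟩, rfl⟩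
  exact ⟨h.pA i (by omega), hQ i h1 h2⟩

theorem MH.plk0 (h : MH G A Z L L0 k p u) {Q : Set V} (hQ : ∀ i, i < k → p i ∉ Q) {i j : ℕ}
    (hi : i < k) (hj : j < k) : Lk G (A \ Q) (p i) (p j) :=
  h.plk (a := 0) le_rfl (fun i _ => hQ i) (by omega) hi (by omega) hj

theorem conn_of_root' {B : Set V} (r : V) (h : ∀ x ∈ B, Lk G B x r) : Conn G B :=
  Conn.of_root r (fun x hx => (h x hx).symm)

theorem Cx.conn_lk [Finite V] (h : Cx G n A Z L L0 k p u) {Q : Set V} (hQ : Cl2 G Q) (hQA : Q ⊆ A)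
    (hQZ : Q ⊆ nb G Z) (hl : ∀ i, i < k → p i ∉ Q → Lk G (A \ Q) (p i) u) : Conn G (A \ Q) := by
  refine conn_of_root' u (fun v hv => ?_)
  rcases h.star hQ hQA hQZ hv with ⟨i, hi, hh⟩ | hh
  · exact hh.trans (hl i hi hh.right.2)
  · exact hh

/-- the cut vertex case for `k = 1` -/
theorem Cx.cut1 [Finite V] (h : Cx G n A Z L L0 k p u) (hk : k = 1) {x : V} (hx : x ∈ A)
    (hxZ : x ∈ nb G Z) (hxp : x ≠ p 0) (hxu : x ≠ u) : Lk G (A \ {x}) (p 0) u := by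
  classical
  by_contra hn
  have hup := h.up 0 (by omega)
  set K := comp G (A \ {x}) u with hK
  have cl : Closed G A {x} K := closed_comp
  have uK : u ∈ K := mem_comp ⟨h.uA, fun e => hxu (by simpa using e.symm)⟩
  have pK : p 0 ∉ K := fun hh => hn (Lk.symm hh)
  have xK : x ∉ K := fun hh => (cl.1 hh).2 rfl
  have hp0 := h.pA 0 (by omega)
  have h3x : 3 ≤ (L x).card := h.l3 x hx hxu (fun i hi => by
    have : i = 0 := by omega
    rw [this]; exact hxp)
  have hM := h.m1
  have l3 : ∀ v ∈ A, v ≠ u → v ≠ p 0 → 3 ≤ (L v).card := fun v hv h1 h2 => h.l3 v hv h1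
    (fun i hi => by have : i = 0 := by omega
                    rw [this]; exact h2)
  have l2 : ∀ v ∈ A, 2 ≤ (L v).card := by
    intro v hv
    by_cases e1 : v = u
    · rw [e1]; exact h.lu
    by_cases e2 : v = p 0
    · rw [e2, ← h.c0]; exact Finset.card_le_card (h.lp 0 (by omega))
    · exact (l3 v hv e1 e2).trans' (by omega)
  have side : ∀ (B : Set V) (s : V), B ⊆ A → B.ncard < n → (∀ v ∈ B, v ≠ s → v ≠ x → 3 ≤ (L v).card) →
      ∀ γ ∈ L x, ∀ γ' ∈ L x, γ ≠ γ' → (∃ φ, Col G B L φ ∧ (x ∈ B → φ x = γ)) ∨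
        (∃ φ, Col G B L φ ∧ (x ∈ B → φ x = γ')) := by
    intro B s hB hBn hs γ hγ γ' hγ' hne
    obtain ⟨φ, hφ⟩ := hM B Z (fun v => if v = x then {γ, γ'} else L v) s x hBn h.hZ (disj_sub h.dZ hB)
      (by
        intro v hv
        by_cases e : v = x
        · simp [e, Finset.card_pair hne]
        · simp [e, l2 v (hB hv)])
      (by
        intro v hv h1 h2
        simpa [h2] using hs v hv h1 h2)
      (by
        intro v hv hvZ
        have : v ≠ x := by rintro rfl; exact hvZ hxZ
        simpa [this] using h.l5 v (hB hv) hvZ)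
    have hφ' : Col G B L φ := hφ.mono subset_rfl (by
      intro v hv hm
      by_cases e : v = x
      · subst e
        simp at hm
        rcases hm with e | e <;> rw [e] <;> assumption
      · simpa [e] using hm)
    by_cases hxB : x ∈ B
    · have := hφ.1 x hxB
      simp at this
      rcases this with e | e
      · exact Or.inl ⟨φ, hφ', fun _ => e⟩
      · exact Or.inr ⟨φ, hφ', fun _ => e⟩
    · exact Or.inl ⟨φ, hφ', fun h => (hxB h).elim⟩
  have s1 := side (A \ K) (p 0) sdiff_subset (by
      rw [← h.card]; exact ncard_lt sdiff_subset h.uA (fun hh => hh.2 uK)) (by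
      intro v hv h1 h2
      exact l3 v hv.1 (by rintro rfl; exact hv.2 uK) h1)
  have hKA := cl.sub
  have s2 := side (K ∪ {x}) u (by grind) (by
      rw [← h.card]; exact ncard_lt (by grind) hp0 (by grind)) (by
      intro v hv h1 h2
      exact l3 v (by grind) h1 (by grind))
  have fin : ∀ γ ∈ L x, ¬ (∃ φ, Col G (A \ K) L φ ∧ (x ∈ A \ K → φ x = γ)) ∨
      ¬ (∃ φ, Col G (K ∪ {x}) L φ ∧ (x ∈ K ∪ {x} → φ x = γ)) := by
    intro γ hγ
    by_contra hcon
    push Not at hcon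
    obtain ⟨⟨φ1, c1, e1⟩, ⟨φ2, c2, e2⟩⟩ := hcon
    obtain ⟨f, hf, -⟩ := glue cl c1 c2 (by
      rintro q rfl
      rw [e1 ⟨hx, xK⟩, e2 (by simp)])
    exact h.no ⟨f, hf⟩
  obtain ⟨a1, a2, a3, m1, m2, m3, e1, e2, e3⟩ := Finset.two_lt_card_iff.1
    (show 2 < (L x).card by omega)
  have t12 := s1 a1 m1 a2 m2 e1
  have t13 := s1 a1 m1 a3 m3 e2
  have t23 := s1 a2 m2 a3 m3 e3
  have r12 := s2 a1 m1 a2 m2 e1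
  have r13 := s2 a1 m1 a3 m3 e2
  have r23 := s2 a2 m2 a3 m3 e3
  exact pigeon3 (fin a1 m1) (fin a2 m2) (fin a3 m3) (fun a b => t12.elim a b) (fun a b => t13.elim a b)
    (fun a b => t23.elim a b) (fun a b => r12.elim a b) (fun a b => r13.elim a b)
    (fun a b => r23.elim a b)

theorem Cx.conn0 [Finite V] (h : Cx G n A Z L L0 k p u) : Lk G (A \ ∅) (p 0) u := by
  classical
  have k1 := h.k1
  by_cases hk : 2 ≤ k
  · exact h.N hk ∅ Cl2.empty (by simp) (by simp) (Or.inl rfl) (by simp) 0 (by omega) (by simp)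
  by_contra hn
  set K := comp G (A \ ∅) u with hK
  have cl : Closed G A ∅ K := closed_comp
  have uK : u ∈ K := mem_comp ⟨h.uA, by simp⟩
  have pK : p 0 ∉ K := fun hh => hn (Lk.symm hh)
  have l3 : ∀ v ∈ A, v ≠ u → v ≠ p 0 → 3 ≤ (L v).card := fun v hv h1 h2 => h.l3 v hv h1
    (fun i hi => by have : i = 0 := by omega
                    rw [this]; exact h2)
  obtain ⟨φ1, c1⟩ := thom_one (A := A \ K) (L := L) h.nm h.hZ (disj_sub h.dZ sdiff_subset) (p 0)
    (fun _ => Finset.card_pos.1 (by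
      have := Finset.card_le_card (h.lp 0 (by omega))
      have := h.c0
      omega))
    (fun v hv h1 => l3 v hv.1 (by rintro rfl; exact hv.2 uK) h1) (fun v hv => h.l5 v hv.1)
  obtain ⟨φ2, c2⟩ := thom_one (A := K ∪ ∅) (L := L) h.nm h.hZ (disj_sub h.dZ (by simpa using cl.sub)) u
    (fun _ => Finset.card_pos.1 (by have := h.lu; omega))
    (fun v hv h1 => l3 v (cl.sub (by simpa using hv)) h1 (by rintro rfl; exact pK (by simpa using hv)))
    (fun v hv => h.l5 v (cl.sub (by simpa using hv)))
  obtain ⟨f, hf, -⟩ := glue cl c1 c2 (by simp)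
  exact h.no ⟨f, hf⟩

theorem Cx.conn [Finite V] (h : Cx G n A Z L L0 k p u) {Q : Set V} (hQ : Cl2 G Q) (hQA : Q ⊆ A)
    (hQZ : Q ⊆ nb G Z)
    (hc : Q = ∅ ∨ (∃ x, Q = {x}) ∨ (∃ i, i < k ∧ p i ∈ Q) ∨ u ∈ Q) : Conn G (A \ Q) := by
  have k1 := h.k1
  by_cases huQ : u ∈ Q
  · -- all remaining path vertices are linked
    have hpl : ∀ i j, i < k → j < k → p i ∉ Q → p j ∉ Q → Lk G (A \ Q) (p i) (p j) := by
      intro i j hi hj hiQ hjQ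
      by_cases hmeet : ∃ m, m < k ∧ p m ∈ Q
      · obtain ⟨m, hm, hmQ⟩ := hmeet
        have hadj := hQ.adj huQ hmQ (h.up m hm)
        have hne : ∀ i, i < k → i ≠ m → p i ∉ Q := by
          intro i hi hne hiQ
          rcases hQ.cases_mem huQ with rfl | ⟨s, _, rfl⟩
          · exact h.up i hi hiQ.symm
          · have e1 : p i = s := by
              rcases hiQ with e | e
              · exact (h.up i hi e.symm).elim
              · exact e
            have e2 : p m = s := by
              rcases hmQ with e | e
              · exact (h.up m hm e.symm).elim
              · exact e
            exact hne (h.inj i m hi hm (e1.trans e2.symm))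
        by_cases hk2 : 2 ≤ k
        · have hend : m = 0 ∨ m + 1 = k := by
            by_contra hcon
            push Not at hcon
            exact h.int hk2 m (by omega) (by omega) hadj
          have him : i ≠ m := by rintro rfl; exact hiQ hmQ
          have hjm : j ≠ m := by rintro rfl; exact hjQ hmQ
          rcases hend with e | e
          · exact h.plk (a := 1) (b := k) le_rfl (fun i h1 h2 => hne i h2 (by omega)) (by omega) hi
              (by omega) hj
          · exact h.plk (a := 0) (b := m) (by omega) (fun i h1 h2 => hne i (by omega) (by omega))
              (by omega) (by omega) (by omega) (by omega)
        · have e1 : i = j := by omega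
          subst e1
          exact Lk.refl ⟨h.pA i hi, hiQ⟩
      · push Not at hmeet
        exact h.plk0 hmeet hi hj
    intro v hv v' hv'
    rcases h.star hQ hQA hQZ hv with ⟨i, hi, hh⟩ | hh
    · rcases h.star hQ hQA hQZ hv' with ⟨j, hj, hh'⟩ | hh'
      · exact hh.trans ((hpl i j hi hj hh.right.2 hh'.right.2).trans hh'.symm)
      · exact (hh'.right.2 huQ).elim
    · exact (hh.right.2 huQ).elim
  · refine h.conn_lk hQ hQA hQZ (fun i hi hiQ => ?_)
    by_cases hk : 2 ≤ k
    · refine h.N hk Q hQ hQA hQZ ?_ huQ i hi hiQ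
      rcases hc with hc | hc | hc | hc
      · exact Or.inl hc
      · exact Or.inr (Or.inl hc)
      · exact Or.inr (Or.inr hc)
      · exact (huQ hc).elim
    · have e : i = 0 := by omega
      subst e
      rcases hc with rfl | ⟨x, rfl⟩ | ⟨j, hj, hc⟩ | hc
      · exact h.conn0
      · exact h.cut1 (by omega) (hQA rfl) (hQZ rfl) (by rintro rfl; exact hiQ rfl)
          (by rintro rfl; exact huQ rfl)
      · have e : j = 0 := by omega
        subst e
        exact (hiQ hc).elim
      · exact (huQ hc).elim

theorem Cx.conn1 [Finite V] (h : Cx G n A Z L L0 k p u) {x : V} (hx : x ∈ A) (hxZ : x ∈ nb G Z) :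
    Conn G (A \ {x}) :=
  h.conn (Cl2.single x) (by simpa using hx) (by simpa using hxZ) (Or.inr (Or.inl ⟨x, rfl⟩))

theorem Cx.connp [Finite V] (h : Cx G n A Z L L0 k p u) {i : ℕ} (hi : i < k) {x : V} (hx : x ∈ A)
    (hxZ : x ∈ nb G Z) (ha : G.Adj (p i) x) : Conn G (A \ {p i, x}) :=
  h.conn (Cl2.pair ha) (by rintro v (rfl | rfl); exacts [h.pA i hi, hx])
    (by rintro v (rfl | rfl); exacts [h.pZ i hi, hxZ]) (Or.inr (Or.inr (Or.inl ⟨i, hi, by simp⟩)))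

theorem Cx.connu [Finite V] (h : Cx G n A Z L L0 k p u) {x : V} (hx : x ∈ A)
    (hxZ : x ∈ nb G Z) (ha : G.Adj u x) : Conn G (A \ {u, x}) :=
  h.conn (Cl2.pair ha) (by rintro v (rfl | rfl); exacts [h.uA, hx])
    (by rintro v (rfl | rfl); exacts [h.uZ, hxZ]) (Or.inr (Or.inr (Or.inr (by simp))))

/-- the path is induced -/
theorem MH.induced (hG : NoMin G) (h : MH G A Z L L0 k p u) {i j : ℕ} (hij : i + 1 < j) (hj : j < k) :
    ¬ G.Adj (p i) (p j) := by
  intro ha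
  have lk : ∀ a b c, a < k → b < k → c < k → c ≠ a → c ≠ b → G.Adj (p a) (p b) →
      Lk G (A \ {p a, p b}) (p c) u := by
    intro a b c h1 h2 h3 h4 h5 hadj
    refine h.N (by omega) _ (Cl2.pair hadj) (by rintro v (rfl | rfl); exacts [h.pA a h1, h.pA b h2])
      (by rintro v (rfl | rfl); exacts [h.pZ a h1, h.pZ b h2]) (Or.inr (Or.inr ⟨a, h1, by simp⟩)) ?_ c h3 ?_
    · rintro (e | e)
      · exact h.up a h1 e
      · exact h.up b h2 e
    · rintro (e | e)
      · exact h4 (h.inj _ _ h3 h1 e)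
      · exact h5 (h.inj _ _ h3 h2 e)
  refine cyc hG h.hZ h.dZ (c := fun t => p (i + t)) (m := j - i + 1) (by omega) ?_ ?_ ?_ ?_ ?_ h.uA h.uZ
    ?_ ?_ ?_
  · intro a b h1 h2 e
    have := h.inj _ _ (by omega) (by omega) e
    omega
  · exact fun a h1 => h.pA _ (by omega)
  · exact fun a h1 => h.pZ _ (by omega)
  · exact fun a h1 => h.adj (i + a) (by omega)
  · have e : i + (j - i + 1 - 1) = j := by omega
    simp only [e]
    exact ha.symm
  · exact fun a h1 => h.up _ (by omega)
  · intro a h1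
    by_cases h0 : a = 0
    · exact ⟨2, by omega, lk _ _ _ (by omega) (by omega) (by omega) (by omega) (by omega)
        (h.adj (i + a) (by omega))⟩
    · exact ⟨0, by omega, lk _ _ _ (by omega) (by omega) (by omega) (by omega) (by omega)
        (h.adj (i + a) (by omega))⟩
  · have e : i + (j - i + 1 - 1) = j := by omega
    simp only [e]
    exact ⟨1, by omega, lk _ _ _ (by omega) (by omega) (by omega) (by omega) (by omega) ha.symm⟩

/-- no boundary vertex is adjacent to both ends -/
theorem Cx.ends [Finite V] (h : Cx G n A Z L L0 k p u) (hk : 2 ≤ k) {v : V} (hv : v ∈ A)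
    (hvZ : v ∈ nb G Z) (hvp : ∀ i, i < k → v ≠ p i) (hvu : v ≠ u) (h1 : G.Adj (p 0) v)
    (h2 : G.Adj (p (k - 1)) v) : False := by
  have pc : ∀ i, i < k → (if i < k then p i else v) = p i := fun i hi => by simp [hi]
  have pk : (if k < k then p k else v) = v := by simp
  refine cyc h.nm h.hZ h.dZ (c := fun t => if t < k then p t else v) (m := k + 1) (by omega) ?_ ?_ ?_ ?_ ?_
    h.uA h.uZ ?_ ?_ ?_
  · intro a b ha hb e
    by_cases ha' : a < k <;> by_cases hb' : b < k <;> simp only [ha', hb', if_true, if_false] at e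
    · exact h.inj _ _ ha' hb' e
    · exact (hvp a ha' e.symm).elim
    · exact (hvp b hb' e).elim
    · omega
  · intro a ha
    by_cases ha' : a < k <;> simp only [ha', if_true, if_false]
    exacts [h.pA a ha', hv]
  · intro a ha
    by_cases ha' : a < k <;> simp only [ha', if_true, if_false]
    exacts [h.pZ a ha', hvZ]
  · intro a ha
    by_cases ha' : a + 1 < k
    · simp only [ha', show a < k by omega, if_true]
      exact h.adj a ha'
    · have e : a = k - 1 := by omega
      simp only [ha', show a < k by omega, if_true, if_false]
      rw [e]; exact h2
  · simp only [Nat.add_sub_cancel, lt_irrefl, if_false, show 0 < k by omega, if_true]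
    exact h1.symm
  · intro a ha
    by_cases ha' : a < k <;> simp only [ha', if_true, if_false]
    exacts [h.up a ha', hvu.symm]
  · intro a ha
    by_cases ha' : a + 1 < k
    · refine ⟨k, by omega, ?_⟩
      simp only [ha', show a < k by omega, if_true, lt_irrefl, if_false]
      exact h.connp (by omega) (h.pA _ ha') (h.pZ _ ha') (h.adj a ha') v
        ⟨hv, by rintro (e | e); exacts [hvp _ (by omega) e, hvp _ ha' e]⟩ u
        ⟨h.uA, by rintro (e | e); exacts [h.up _ (by omega) e, h.up _ ha' e]⟩
    · have e : a = k - 1 := by omega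
      refine ⟨0, by omega, ?_⟩
      simp only [ha', show a < k by omega, if_true, if_false, show 0 < k by omega]
      rw [e]
      refine h.connp (by omega) hv hvZ h2 (p 0) ⟨h.pA _ (by omega), ?_⟩ u ⟨h.uA, ?_⟩
      · rintro (e | e)
        · have := h.inj _ _ (by omega) (by omega) e
          omega
        · exact hvp _ (by omega) e.symm
      · rintro (e | e)
        · exact h.up _ (by omega) e
        · exact hvu e.symm
  · refine ⟨k - 1, by omega, ?_⟩
    simp only [Nat.add_sub_cancel, lt_irrefl, if_false, show 0 < k by omega, show k - 1 < k by omega, if_true]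
    rw [Set.pair_comm]
    refine h.connp (by omega) hv hvZ h1 (p (k - 1)) ⟨h.pA _ (by omega), ?_⟩ u ⟨h.uA, ?_⟩
    · rintro (e | e)
      · have := h.inj _ _ (by omega) (by omega) e
        omega
      · exact hvp _ (by omega) e.symm
    · rintro (e | e)
      · exact h.up _ (by omega) e
      · exact hvu e.symm

end
end TL

namespace TL
variable {V : Type} {G : SimpleGraph V}

def PS (k : ℕ) (p : ℕ → V) : Set V := {v | ∃ i, i < k ∧ v = p i}

section
variable {n : ℕ} {A Z : Set V} {L : V → Finset ℕ} {L0 : Finset ℕ} {k : ℕ} {p : ℕ → V} {u : V}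

theorem mem_PS {i : ℕ} (hi : i < k) : p i ∈ PS k p := ⟨i, hi, rfl⟩

theorem MH.PA (h : MH G A Z L L0 k p u) : PS k p ⊆ A := by
  rintro _ ⟨i, hi, rfl⟩; exact h.pA i hi

theorem MH.PZ (h : MH G A Z L L0 k p u) : PS k p ⊆ nb G Z := by
  rintro _ ⟨i, hi, rfl⟩; exact h.pZ i hi

theorem MH.uP (h : MH G A Z L L0 k p u) : u ∉ PS k p := by
  rintro ⟨i, hi, e⟩; exact h.up i hi e

theorem MH.zP (h : MH G A Z L L0 k p u) : Conn G (Z ∪ PS k p) := h.hZ.add h.PZ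

/-- colouring the path alternately -/
theorem MH.del (hG : NoMin G) (h : MH G A Z L L0 k p u) {α : ℕ} (hα : α ∈ L0) :
    ∃ (β : ℕ) (ψ : V → ℕ), β ∈ L0 ∧ β ≠ α ∧ (∀ c ∈ L0, c = α ∨ c = β) ∧
      (∀ i, i < k → ψ (p i) = if Even i then α else β) ∧ Col G (PS k p) L ψ ∧
      ∀ r ∈ PS k p, ψ r ∈ L0 := by
  classical
  obtain ⟨β, hβ, hne⟩ := exists_ne_of_card (le_of_eq h.c0.symm) α
  have hL : ∀ c ∈ L0, c = α ∨ c = β := by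
    intro c hc
    by_contra hcon
    push Not at hcon
    have : ({α, β, c} : Finset ℕ) ⊆ L0 := by
      intro x hx; simp at hx; rcases hx with rfl | rfl | rfl <;> assumption
    have h3 : ({α, β, c} : Finset ℕ).card = 3 := by
      rw [Finset.card_eq_three]
      exact ⟨α, β, c, hne.symm, hcon.1.symm, hcon.2.symm, rfl⟩
    have := Finset.card_le_card this
    have := h.c0
    omega
  let ψ : V → ℕ := fun v => if ∃ i, i < k ∧ Even i ∧ v = p i then α else β
  have hψ : ∀ i, i < k → ψ (p i) = if Even i then α else β := by
    intro i hi
    by_cases he : Even i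
    · have : ∃ j, j < k ∧ Even j ∧ p i = p j := ⟨i, hi, he, rfl⟩
      simp only [ψ, this, he, if_true]
    · have : ¬ ∃ j, j < k ∧ Even j ∧ p i = p j := by
        rintro ⟨j, hj, hej, e⟩
        rw [h.inj i j hi hj e] at he
        exact he hej
      simp only [ψ, this, he, if_false]
  have hm : ∀ r ∈ PS k p, ψ r ∈ L0 := by
    rintro _ ⟨i, hi, rfl⟩
    rw [hψ i hi]
    split_ifs <;> assumption
  refine ⟨β, ψ, hβ, hne, hL, hψ, ⟨?_, ?_⟩, hm⟩
  · rintro _ ⟨i, hi, rfl⟩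
    exact h.lp i hi (hm _ (mem_PS hi))
  · have key : ∀ i j, i < k → j < k → i < j → G.Adj (p i) (p j) → ψ (p i) ≠ ψ (p j) := by
      intro i j hi hj hij ha
      have : ¬ i + 1 < j := fun hh => h.induced hG hh hj ha
      have e : j = i + 1 := by omega
      subst e
      rw [hψ i hi, hψ _ hj]
      by_cases he : Even i
      · have : ¬ Even (i + 1) := by rw [Nat.even_add_one]; simpa using he
        simp only [he, this, if_true, if_false]; exact hne.symm
      · have : Even (i + 1) := by rw [Nat.even_add_one]; exact he
        simp only [he, this, if_true, if_false]; exact hne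
    rintro _ ⟨i, hi, rfl⟩ _ ⟨j, hj, rfl⟩ ha
    rcases lt_trichotomy i j with hij | rfl | hij
    · exact key i j hi hj hij ha
    · exact (ha.ne rfl).elim
    · exact (key j i hj hi hij ha.symm).symm

theorem del3 (hc : L0.card = 2) {R : Set V} {ψ : V → ℕ} (hR : ∀ r ∈ R, ψ r ∈ L0) {v : V}
    (hv : 5 ≤ (L v).card) : 3 ≤ (resid G L R ψ v).card := by
  have := resid_card (G := G) (L := L) (R := R) (ψ := ψ) (v := v) L0 (fun r hr _ => hR r hr)
  omega

theorem del5 {R : Set V} {ψ : V → ℕ} {v : V} (h5 : v ∉ nb G Z → 5 ≤ (L v).card)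
    (hv : v ∉ nb G (Z ∪ R)) : 5 ≤ (resid G L R ψ v).card := by
  rw [nb_union] at hv
  refine (h5 (fun h => hv (Or.inl h))).trans (resid_card0 (fun r hr ha => hv (Or.inr ⟨r, hr, ha⟩)))

theorem del1 {R : Set V} {ψ : V → ℕ} {v r0 : V} (h : ∀ r ∈ R, G.Adj v r → r = r0) :
    (L v).card ≤ (resid G L R ψ v).card + 1 := by
  have := resid_card (G := G) (L := L) (R := R) (ψ := ψ) (v := v) {ψ r0}
    (fun r hr ha => by rw [h r hr ha]; simp)
  simpa using this

theorem Cx.nbmid [Finite V] (h : Cx G n A Z L L0 k p u) {i : ℕ} (hi : i + 2 < k) {v : V} (hv : v ∈ A)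
    (hvZ : v ∈ nb G Z) (hvP : v ∉ PS k p) : ¬ G.Adj (p (i + 1)) v := by
  intro ha
  refine three_nbrs h.nm h.hZ h.dZ (h.pA (i + 1) (by omega)) (h.pZ _ (by omega))
    (fun w hw hwZ haw => h.connp (by omega) hw hwZ haw) (h.pA i (by omega)) (h.pA (i + 2) (by omega)) hv
    (h.pZ _ (by omega)) (h.pZ _ (by omega)) hvZ (h.adj i (by omega)).symm (h.adj (i + 1) (by omega)) ha
    ?_ ?_ ?_
  · intro e
    have := h.inj _ _ (by omega) (by omega) e
    omega
  · rintro rfl; exact hvP (mem_PS (by omega))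
  · rintro rfl; exact hvP (mem_PS (by omega))

theorem Cx.nbend [Finite V] (h : Cx G n A Z L L0 k p u) (hk : 2 ≤ k) :
    ∃ v1, ∀ v ∈ A, v ∈ nb G Z → v ∉ PS k p → G.Adj (p 0) v → v = v1 := by
  obtain ⟨x1, hx⟩ := nb_le_one h.nm h.hZ h.dZ (h.pA 0 (by omega)) (h.pZ 0 (by omega)) (h.pA 1 (by omega))
    (h.pZ 1 (by omega)) (h.adj 0 (by omega)) (fun w hw hwZ haw => h.connp (by omega) hw hwZ haw)
  exact ⟨x1, fun v hv hvZ hvP ha => hx v hv hvZ ha (by rintro rfl; exact hvP (mem_PS (by omega)))⟩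

theorem PS_rev : PS k (fun i => p (k - 1 - i)) = PS k p := by
  ext v
  constructor
  · rintro ⟨i, hi, rfl⟩; exact mem_PS (by omega)
  · rintro ⟨i, hi, rfl⟩
    refine ⟨k - 1 - i, by omega, ?_⟩
    have e : k - 1 - (k - 1 - i) = i := by omega
    simp only [e]

theorem Cx.nb12 [Finite V] (h : Cx G n A Z L L0 k p u) (hk : 2 ≤ k) :
    ∃ v1 v2, ∀ v ∈ A, v ∈ nb G Z → v ∉ PS k p → ∀ i, i < k → G.Adj (p i) v →
      (v = v1 ∧ i = 0) ∨ (v = v2 ∧ i = k - 1) := by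
  obtain ⟨v1, h1⟩ := h.nbend hk
  obtain ⟨v2, h2⟩ := h.rev.nbend hk
  rw [PS_rev] at h2
  simp only [Nat.sub_zero] at h2
  refine ⟨v1, v2, fun v hv hvZ hvP i hi ha => ?_⟩
  by_cases e0 : i = 0
  · subst e0; exact Or.inl ⟨h1 v hv hvZ hvP ha, rfl⟩
  by_cases e1 : i = k - 1
  · subst e1; exact Or.inr ⟨h2 v hv hvZ hvP ha, rfl⟩
  · obtain ⟨j, rfl⟩ : ∃ j, i = j + 1 := ⟨i - 1, by omega⟩
    exact (h.nbmid (by omega) hv hvZ hvP ha).elim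

theorem MH.l3' (h : MH G A Z L L0 k p u) {v : V} (hv : v ∈ A) (hvP : v ∉ PS k p) (hvu : v ≠ u) :
    3 ≤ (L v).card := h.l3 v hv hvu (fun i hi e => hvP ⟨i, hi, e⟩)

theorem Cx.lt' [Finite V] (h : Cx G n A Z L L0 k p u) {B : Set V} (hB : B ⊆ A) {x : V} (hx : x ∈ A)
    (hxB : x ∉ B) : B.ncard < n := by
  rw [← h.card]; exact ncard_lt hB hx hxB

/-- Case I, `k = 1` -/
theorem Cx.caseI1 [Finite V] (h : Cx G n A Z L L0 k p u) (hk : k = 1) (ha : G.Adj (p 0) u) : False := by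
  classical
  subst hk
  have hA : ∀ v ∈ A, v = p 0 ∨ v = u := by
    intro v hv
    by_contra hcon
    push Not at hcon
    rcases h.star (Cl2.pair ha) (by rintro v (rfl | rfl); exacts [h.pA 0 (by omega), h.uA])
      (by rintro v (rfl | rfl); exacts [h.pZ 0 (by omega), h.uZ]) (v := v) ⟨hv, by simpa using hcon⟩
      with ⟨i, hi, hh⟩ | hh
    · have e : i = 0 := by omega
      subst e
      exact hh.right.2 (by simp)
    · exact hh.right.2 (by simp)
  obtain ⟨c, hc⟩ : (L u).Nonempty := Finset.card_pos.1 (by have := h.lu; omega)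
  obtain ⟨α, hα, hne⟩ := exists_ne_of_card (le_of_eq h.c0.symm) c
  have hpu := h.up 0 (by omega)
  refine h.no ⟨fun v => if v = u then c else α, ?_, ?_⟩
  · intro v hv
    rcases hA v hv with rfl | rfl
    · simpa [hpu.symm] using h.lp 0 (by omega) hα
    · simpa using hc
  · intro x hx y hy hadj
    rcases hA x hx with rfl | rfl <;> rcases hA y hy with rfl | rfl
    · exact (hadj.ne rfl).elim
    · simpa [hpu.symm] using hne
    · simpa [hpu.symm] using hne.symm
    · exact (hadj.ne rfl).elim

/-- Case I, `k ≥ 2` -/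
theorem Cx.caseI2 [Finite V] (h : Cx G n A Z L L0 k p u) (hk : 2 ≤ k) (ha : G.Adj (p 0) u) : False := by
  classical
  obtain ⟨v1, v2, hnb⟩ := h.nb12 hk
  have ev1 : u = v1 := by
    rcases hnb u h.uA h.uZ h.uP 0 (by omega) ha with e | e
    · exact e.1
    · have := e.2; omega
  subst ev1
  have hp0 : p 0 ∉ A \ PS k p := fun hh => hh.2 (mem_PS (by omega))
  have hlt : (A \ PS k p).ncard < n := h.lt' sdiff_subset (h.pA 0 (by omega)) hp0
  have hM := h.m1
  -- vertices other than u, v2 keep three colours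
  have base : ∀ ψ : V → ℕ, (∀ r ∈ PS k p, ψ r ∈ L0) → ∀ v ∈ A \ PS k p, v ≠ u → v ≠ v2 →
      3 ≤ (resid G L (PS k p) ψ v).card := by
    intro ψ hψ v hv h1 h2
    by_cases hvZ : v ∈ nb G Z
    · refine (h.l3' hv.1 hv.2 h1).trans (resid_card0 ?_)
      rintro _ ⟨i, hi, rfl⟩ hadj
      rcases hnb v hv.1 hvZ hv.2 i hi hadj.symm with e | e
      · exact h1 e.1
      · exact h2 e.1
    · exact del3 h.c0 hψ (h.l5 v hv.1 hvZ)
  by_cases hb : G.Adj (p (k - 1)) u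
  · have ev2 : u = v2 := by
      rcases hnb u h.uA h.uZ h.uP (k - 1) (by omega) hb with e | e
      · have := e.2; omega
      · exact e.1
    subst ev2
    have main : ∀ α ∈ L0, ∀ d ∈ L u, d ≠ α → (Even k → d ∉ L0) → False := by
      intro α hα d hd hdα hdk
      obtain ⟨β, ψ, hβ, hne, hL, hψ, hcol, hm⟩ := h.del h.nm hα
      refine h.no (ext_resid hcol (thom_one h.nm h.zP (disj_add h.dZ) u (fun _ => ⟨d, ?_⟩)
        (fun v hv hvu => base ψ hm v hv hvu hvu) (fun v hv hvZ => del5 (h.l5 v hv.1) hvZ)))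
      refine mem_resid.2 ⟨hd, ?_⟩
      rintro _ ⟨i, hi, rfl⟩ hadj
      by_cases hke : Even k
      · intro e
        exact hdk hke (e ▸ hm _ (mem_PS hi))
      · rcases hnb u h.uA h.uZ h.uP i hi hadj.symm with e | e
        · rw [e.2, hψ 0 (by omega)]; simpa using hdα.symm
        · rw [e.2, hψ _ (by omega)]
          have : Even (k - 1) := by
            rcases Nat.even_or_odd k with h | h
            · exact (hke h).elim
            · exact Nat.Odd.sub_odd h odd_one
          simpa [this] using hdα.symm
    by_cases hke : Even k
    · have hLu : L u ≠ L0 := fun e => h.ex ⟨e, hke, ha.symm, hb.symm⟩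
      obtain ⟨d, hd, hd0⟩ : ∃ d ∈ L u, d ∉ L0 := by
        by_contra hcon
        push Not at hcon
        exact hLu (Finset.eq_of_subset_of_card_le hcon (by rw [h.c0]; exact h.lu))
      obtain ⟨α, hα⟩ : L0.Nonempty := Finset.card_pos.1 (by have := h.c0; omega)
      exact main α hα d hd (by rintro rfl; exact hd0 hα) (fun _ => hd0)
    · obtain ⟨d, hd⟩ : (L u).Nonempty := Finset.card_pos.1 (by have := h.lu; omega)
      obtain ⟨α, hα, hne⟩ := exists_ne_of_card (le_of_eq h.c0.symm) d
      exact main α hα d hd hne.symm (fun hh => (hke hh).elim)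
  · have unbr : ∀ r ∈ PS k p, G.Adj u r → r = p 0 := by
      rintro _ ⟨i, hi, rfl⟩ hadj
      rcases hnb u h.uA h.uZ h.uP i hi hadj.symm with e | e
      · rw [e.2]
      · rw [e.2] at hadj; exact (hb hadj.symm).elim
    have v2nbr : ∀ v ∈ A, v ∈ nb G Z → v ∉ PS k p → v ≠ u → ∀ r ∈ PS k p, G.Adj v r → v = v2 ∧ r = p (k - 1) := by
      rintro v hv hvZ hvP hvu _ ⟨i, hi, rfl⟩ hadj
      rcases hnb v hv hvZ hvP i hi hadj.symm with e | e
      · exact (hvu e.1).elim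
      · rw [e.2]; exact ⟨e.1, rfl⟩
    by_cases hex : ∃ α ∈ L0, 2 ≤ ((L u).erase α).card
    · obtain ⟨α, hα, h2⟩ := hex
      obtain ⟨β, ψ, hβ, hne, hL, hψ, hcol, hm⟩ := h.del h.nm hα
      refine h.no (ext_resid hcol (hM _ _ _ u v2 hlt h.zP (disj_add h.dZ) ?_ (base ψ hm)
        (fun v hv hvZ => del5 (h.l5 v hv.1) hvZ)))
      intro v hv
      by_cases e1 : v = u
      · subst e1
        refine h2.trans (Finset.card_le_card ?_)
        intro c hc
        rw [Finset.mem_erase] at hc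
        refine mem_resid.2 ⟨hc.2, fun r hr hadj => ?_⟩
        rw [unbr r hr hadj, hψ 0 (by omega)]
        simpa using hc.1.symm
      · by_cases hvZ : v ∈ nb G Z
        · have := del1 (G := G) (L := L) (ψ := ψ) (v := v) (R := PS k p) (r0 := p (k - 1))
            (fun r hr hadj => (v2nbr v hv.1 hvZ hv.2 e1 r hr hadj).2)
          have := h.l3' hv.1 hv.2 e1
          omega
        · have := del3 (G := G) h.c0 hm (h.l5 v hv.1 hvZ)
          omega
    · push Not at hex
      have hLu : L0 = L u := by
        have hsub : L0 ⊆ L u := by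
          intro α hα
          by_contra hc
          have := hex α hα
          rw [Finset.erase_eq_of_notMem hc] at this
          have := h.lu
          omega
        obtain ⟨α, hα⟩ : L0.Nonempty := Finset.card_pos.1 (by have := h.c0; omega)
        have h1 := hex α hα
        rw [Finset.card_erase_of_mem (hsub hα)] at h1
        exact Finset.eq_of_subset_of_card_le hsub (by rw [h.c0]; omega)
      obtain ⟨α, hα⟩ : L0.Nonempty := Finset.card_pos.1 (by have := h.c0; omega)
      obtain ⟨β, ψ, hβ, hne, hL, hψ, hcol, hm⟩ := h.del h.nm hα
      obtain ⟨v', hv'⟩ := nb_le_one h.nm h.hZ h.dZ h.uA h.uZ (h.pA 0 (by omega)) (h.pZ 0 (by omega)) ha.symm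
        (fun w hw hwZ haw => h.connu hw hwZ haw)
      let ψ' : V → ℕ := fun v => if v = u then β else ψ v
      have hψP : ∀ r ∈ PS k p, ψ' r = ψ r := by
        intro r hr
        have : r ≠ u := by rintro rfl; exact h.uP hr
        simp [ψ', this]
      have hψu : ψ' u = β := by simp [ψ']
      set R := PS k p ∪ {u} with hR
      have hm' : ∀ r ∈ R, ψ' r ∈ L0 := by
        rintro r (hr | rfl)
        · rw [hψP r hr]; exact hm r hr
        · rw [hψu]; exact hβ
      have key : ∀ r ∈ PS k p, G.Adj u r → ψ' r ≠ β := by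
        intro r hr hadj
        rw [hψP r hr, unbr r hr hadj, hψ 0 (by omega)]
        simpa using hne.symm
      have hcol' : Col G R L ψ' := by
        constructor
        · rintro r (hr | rfl)
          · rw [hψP r hr]; exact hcol.1 r hr
          · rw [hψu, ← hLu]; exact hβ
        · rintro x (hx | rfl) y (hy | rfl) hadj
          · rw [hψP x hx, hψP y hy]; exact hcol.2 x hx y hy hadj
          · rw [hψu]; exact key x hx hadj.symm
          · rw [hψu]; exact (key y hy hadj).symm
          · exact (hadj.ne rfl).elim
      have hzR : Conn G (Z ∪ R) := h.hZ.add (by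
        rintro r (hr | rfl)
        · exact h.PZ hr
        · exact h.uZ)
      have hlt' : (A \ R).ncard < n := h.lt' sdiff_subset h.uA (fun hh => hh.2 (Or.inr rfl))
      have uout : ∀ v ∈ A \ R, v ≠ u ∧ v ∉ PS k p := fun v hv =>
        ⟨fun e => hv.2 (Or.inr e), fun e => hv.2 (Or.inl e)⟩
      have nbR : ∀ v ∈ A \ R, v ∈ nb G Z → ∀ r ∈ R, G.Adj v r → (v = v2 ∧ r = p (k - 1)) ∨ (v = v' ∧ r = u) := by
        rintro v hv hvZ r (hr | rfl) hadj
        · exact Or.inl (v2nbr v hv.1 hvZ (uout v hv).2 (uout v hv).1 r hr hadj)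
        · refine Or.inr ⟨hv' v hv.1 hvZ hadj.symm ?_, rfl⟩
          rintro rfl
          exact (uout _ hv).2 (mem_PS (by omega))
      have h3 : ∀ v ∈ A \ R, v ≠ v2 → v ≠ v' → 3 ≤ (resid G L R ψ' v).card := by
        intro v hv h1 h2
        by_cases hvZ : v ∈ nb G Z
        · refine (h.l3' hv.1 (uout v hv).2 (uout v hv).1).trans (resid_card0 ?_)
          intro r hr hadj
          rcases nbR v hv hvZ r hr hadj with e | e
          · exact h1 e.1
          · exact h2 e.1
        · exact del3 h.c0 hm' (h.l5 v hv.1 hvZ)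
      have h5 : ∀ v ∈ A \ R, v ∉ nb G (Z ∪ R) → 5 ≤ (resid G L R ψ' v).card :=
        fun v hv hvZ => del5 (h.l5 v hv.1) hvZ
      refine h.no (ext_resid hcol' ?_)
      by_cases e : v2 = v'
      · refine thom_one h.nm hzR (disj_add h.dZ) v2 (fun hv => Finset.card_pos.1 ?_)
          (fun v hv h1 => h3 v hv h1 (e ▸ h1)) h5
        have h1 := h.l3' hv.1 (uout _ hv).2 (uout _ hv).1
        have := resid_card (G := G) (L := L) (R := R) (ψ := ψ') (v := v2) L0 (fun r hr _ => hm' r hr)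
        have := h.c0
        omega
      · refine hM _ _ _ v2 v' hlt' hzR (disj_add h.dZ) ?_ h3 h5
        intro v hv
        by_cases hvZ : v ∈ nb G Z
        · have h1 := h.l3' hv.1 (uout v hv).2 (uout v hv).1
          by_cases e2 : v = v2
          · have := del1 (G := G) (L := L) (ψ := ψ') (v := v) (R := R) (r0 := p (k - 1))
              (fun r hr hadj => (nbR v hv hvZ r hr hadj).elim (fun e => e.2)
                (fun e' => (e (e2.symm.trans e'.1)).elim))
            omega
          · have := del1 (G := G) (L := L) (ψ := ψ') (v := v) (R := R) (r0 := u)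
              (fun r hr hadj => (nbR v hv hvZ r hr hadj).elim (fun e => (e2 e.1).elim) (fun e' => e'.2))
            omega
        · have := del3 (G := G) h.c0 hm' (h.l5 v hv.1 hvZ)
          omega

/-- `u` is not adjacent to the path -/
theorem Cx.caseI [Finite V] (h : Cx G n A Z L L0 k p u) {i : ℕ} (hi : i < k) : ¬ G.Adj (p i) u := by
  intro ha
  by_cases hk : 2 ≤ k
  · by_cases e0 : i = 0
    · subst e0; exact h.caseI2 hk ha
    by_cases e1 : i + 1 < k
    · exact h.int hk i (by omega) e1 ha.symm
    · have e : i = k - 1 := by omega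
      subst e
      exact h.rev.caseI2 hk (by simpa using ha)
  · have e : i = 0 := by omega
    subst e
    exact h.caseI1 (by have := h.k1; omega) ha

end
end TL

namespace TL
variable {V : Type} {G : SimpleGraph V}

structure C1 (G : SimpleGraph V) (n : ℕ) (A Z : Set V) (L : V → Finset ℕ) (L0 : Finset ℕ) (k : ℕ)
    (p : ℕ → V) (u v1 v2 : V) : Prop extends Cx G n A Z L L0 k p u where
  n12 : v1 ≠ v2
  nbr : ∀ v ∈ A, v ∈ nb G Z → v ∉ PS k p → ∀ i, i < k → G.Adj (p i) v →
      (v = v1 ∧ i = 0) ∨ (v = v2 ∧ i = k - 1)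

structure C2 (G : SimpleGraph V) (n : ℕ) (A Z : Set V) (L : V → Finset ℕ) (L0 : Finset ℕ) (k : ℕ)
    (p : ℕ → V) (u v1 v2 : V) : Prop extends C1 G n A Z L L0 k p u v1 v2 where
  v1A : v1 ∈ A
  v1Z : v1 ∈ nb G Z
  v1P : v1 ∉ PS k p
  a1 : G.Adj (p 0) v1
  c1 : (L v1).card = 3
  s1 : L0 ⊆ L v1
  v2A : v2 ∈ A
  v2Z : v2 ∈ nb G Z
  v2P : v2 ∉ PS k p
  a2 : G.Adj (p (k - 1)) v2
  c2 : (L v2).card = 3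
  s2 : L0 ⊆ L v2

def Ess (G : SimpleGraph V) (A Z : Set V) (k : ℕ) (p : ℕ → V) (u x w : V) : Prop :=
  w ∈ A ∧ w ∈ nb G Z ∧ w ≠ u ∧ w ∉ PS k p ∧ G.Adj x w ∧ ∀ i, i < k → ¬ Lk G (A \ {x, w}) (p i) u

section
variable {n : ℕ} {A Z : Set V} {L : V → Finset ℕ} {L0 : Finset ℕ} {k : ℕ} {p : ℕ → V} {u v1 v2 : V}

theorem Cx.getC1 [Finite V] (h : Cx G n A Z L L0 k p u) : ∃ v1 v2, C1 G n A Z L L0 k p u v1 v2 := by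
  have k1 := h.k1
  have hup := h.up 0 (by omega)
  by_cases hk : 2 ≤ k
  · obtain ⟨w1, w2, hw⟩ := h.nb12 hk
    have e1 : ∃ v1, (v1 = u ∨ (v1 ∈ A ∧ v1 ∈ nb G Z ∧ v1 ∉ PS k p ∧ G.Adj (p 0) v1)) ∧
        ∀ v ∈ A, v ∈ nb G Z → v ∉ PS k p → G.Adj (p 0) v → v = v1 := by
      by_cases hx : ∃ v, v ∈ A ∧ v ∈ nb G Z ∧ v ∉ PS k p ∧ G.Adj (p 0) v
      · obtain ⟨v, hv⟩ := hx
        refine ⟨v, Or.inr hv, fun v' m z q ad => ?_⟩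
        have := hw v hv.1 hv.2.1 hv.2.2.1 0 (by omega) hv.2.2.2
        have := hw v' m z q 0 (by omega) ad
        grind
      · push Not at hx
        exact ⟨u, Or.inl rfl, fun v m z q ad => (hx v m z q ad).elim⟩
    have e2 : ∃ v2, (v2 = p 0 ∨ (v2 ∈ A ∧ v2 ∈ nb G Z ∧ v2 ∉ PS k p ∧ G.Adj (p (k - 1)) v2)) ∧
        ∀ v ∈ A, v ∈ nb G Z → v ∉ PS k p → G.Adj (p (k - 1)) v → v = v2 := by
      by_cases hx : ∃ v, v ∈ A ∧ v ∈ nb G Z ∧ v ∉ PS k p ∧ G.Adj (p (k - 1)) v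
      · obtain ⟨v, hv⟩ := hx
        refine ⟨v, Or.inr hv, fun v' m z q ad => ?_⟩
        have := hw v hv.1 hv.2.1 hv.2.2.1 (k - 1) (by omega) hv.2.2.2
        have := hw v' m z q (k - 1) (by omega) ad
        grind
      · push Not at hx
        exact ⟨p 0, Or.inl rfl, fun v m z q ad => (hx v m z q ad).elim⟩
    obtain ⟨v1, o1, f1⟩ := e1
    obtain ⟨v2, o2, f2⟩ := e2
    refine ⟨v1, v2, ⟨h, ?_, ?_⟩⟩
    · rintro rfl
      rcases o1 with rfl | o1
      · rcases o2 with e | o2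
        · exact hup e
        · exact h.caseI (by omega) o2.2.2.2
      · rcases o2 with e | o2
        · exact o1.2.2.1 (e ▸ mem_PS (by omega))
        · refine h.ends hk o1.1 o1.2.1 (fun i hi e => o1.2.2.1 ⟨i, hi, e⟩) ?_ o1.2.2.2 o2.2.2.2
          rintro rfl
          exact h.caseI (by omega) o1.2.2.2
    · intro v m z q i hi ad
      rcases hw v m z q i hi ad with ⟨_, e⟩ | ⟨_, e⟩
      · subst e; exact Or.inl ⟨f1 v m z q ad, rfl⟩
      · subst e; exact Or.inr ⟨f2 v m z q ad, rfl⟩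
  · have hk : k = 1 := by omega
    subst hk
    by_cases hx : ∃ v, v ∈ A ∧ v ∈ nb G Z ∧ v ∉ PS 1 p ∧ G.Adj (p 0) v
    · obtain ⟨v1, m1, z1, q1, ad1⟩ := hx
      by_cases hy : ∃ v, v ∈ A ∧ v ∈ nb G Z ∧ v ∉ PS 1 p ∧ G.Adj (p 0) v ∧ v ≠ v1
      · obtain ⟨v2, m2, z2, q2, ad2, hne⟩ := hy
        refine ⟨v1, v2, ⟨h, hne.symm, ?_⟩⟩
        intro v m z q i hi ad
        have e : i = 0 := by omega
        subst e
        by_contra hcon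
        push Not at hcon
        exact three_nbrs h.nm h.hZ h.dZ (h.pA 0 (by omega)) (h.pZ 0 (by omega))
          (fun w hw hwZ haw => h.connp (by omega) hw hwZ haw) m m1 m2 z z1 z2 ad ad1 ad2
          (fun e => hcon.1 e rfl) (fun e => hcon.2 e rfl) hne.symm
      · push Not at hy
        refine ⟨v1, p 0, ⟨h, fun e => q1 (e ▸ mem_PS (by omega)), ?_⟩⟩
        intro v m z q i hi ad
        have e : i = 0 := by omega
        subst e
        exact Or.inl ⟨hy v m z q ad, rfl⟩
    · push Not at hx
      refine ⟨u, p 0, ⟨h, hup, ?_⟩⟩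
      intro v m z q i hi ad
      have e : i = 0 := by omega
      subst e
      exact (hx v m z q ad).elim

theorem C1.rev (h : C1 G n A Z L L0 k p u v1 v2) :
    C1 G n A Z L L0 k (fun i => p (k - 1 - i)) u v2 v1 := by
  refine ⟨h.toCx.rev, h.n12.symm, ?_⟩
  rw [PS_rev]
  intro v m z q i hi ad
  rcases h.nbr v m z q _ (by omega) ad with ⟨e, e'⟩ | ⟨e, e'⟩
  · exact Or.inr ⟨e, by omega⟩
  · exact Or.inl ⟨e, by omega⟩

theorem C1.v1prop [Finite V] (h : C1 G n A Z L L0 k p u v1 v2) :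
    v1 ∈ A ∧ v1 ∈ nb G Z ∧ v1 ∉ PS k p ∧ G.Adj (p 0) v1 ∧ (L v1).card = 3 ∧ L0 ⊆ L v1 := by
  classical
  have k1 := h.k1
  by_contra hcon
  have hlt : (A \ PS k p).ncard < n :=
    h.lt' sdiff_subset (h.pA 0 (by omega)) (fun hh => hh.2 (mem_PS (by omega)))
  -- choice of α
  obtain ⟨α, hα, hch⟩ : ∃ α ∈ L0, v1 ∈ A → v1 ∈ nb G Z → v1 ∉ PS k p → G.Adj (p 0) v1 →
      3 ≤ (L v1).card → 3 ≤ ((L v1).erase α).card := by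
    obtain ⟨α0, hα0⟩ : L0.Nonempty := Finset.card_pos.1 (by have := h.c0; omega)
    by_cases hsub : L0 ⊆ L v1
    · refine ⟨α0, hα0, fun m z q ad hc => ?_⟩
      rw [Finset.card_erase_of_mem (hsub hα0)]
      have : (L v1).card ≠ 3 := fun e => hcon ⟨m, z, q, ad, e, hsub⟩
      omega
    · obtain ⟨α, hα, hn⟩ := Finset.not_subset.1 hsub
      refine ⟨α, hα, fun m z q ad hc => ?_⟩
      rwa [Finset.erase_eq_of_notMem hn]
  obtain ⟨β, ψ, hβ, hne, hL, hψ, hcol, hm⟩ := h.del h.nm hα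
  have unot : ∀ r ∈ PS k p, ¬ G.Adj u r := by
    rintro _ ⟨i, hi, rfl⟩ hadj
    exact h.caseI hi hadj.symm
  have hu2 : 2 ≤ (resid G L (PS k p) ψ u).card := h.lu.trans (resid_card0 unot)
  have hr : ∀ v ∈ A \ PS k p, v ≠ u → v ≠ v2 → 3 ≤ (resid G L (PS k p) ψ v).card := by
    intro v hv h1 h2
    by_cases hvZ : v ∈ nb G Z
    · have hl := h.l3' hv.1 hv.2 h1
      by_cases hadj : ∃ r ∈ PS k p, G.Adj v r
      · have key : ∀ r ∈ PS k p, G.Adj v r → v = v1 ∧ r = p 0 := by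
          rintro _ ⟨i, hi, rfl⟩ had
          rcases h.nbr v hv.1 hvZ hv.2 i hi had.symm with e | e
          · exact ⟨e.1, by rw [e.2]⟩
          · exact (h2 e.1).elim
        obtain ⟨r, hr, had⟩ := hadj
        obtain ⟨e1, e2⟩ := key r hr had
        subst e1 e2
        refine (hch hv.1 hvZ hv.2 had.symm hl).trans (Finset.card_le_card ?_)
        intro c hc
        rw [Finset.mem_erase] at hc
        refine mem_resid.2 ⟨hc.2, fun r hr hadj => ?_⟩
        rw [(key r hr hadj).2, hψ 0 (by omega)]
        simpa using hc.1.symm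
      · push Not at hadj
        exact hl.trans (resid_card0 hadj)
    · exact del3 h.c0 hm (h.l5 v hv.1 hvZ)
  refine h.no (ext_resid hcol (h.m1 _ _ _ u v2 hlt h.zP (disj_add h.dZ) ?_ hr
        (fun v hv hvZ => del5 (h.l5 v hv.1) hvZ)))
  intro v hv
  by_cases e1 : v = u
  · rw [e1]; exact hu2
  by_cases e2 : v = v2
  · subst e2
    by_cases hvZ : v ∈ nb G Z
    · have := del1 (G := G) (L := L) (ψ := ψ) (v := v) (R := PS k p) (r0 := p (k - 1)) (by
        rintro _ ⟨i, hi, rfl⟩ had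
        rcases h.nbr v hv.1 hvZ hv.2 i hi had.symm with e | e
        · exact (h.n12 e.1.symm).elim
        · rw [e.2])
      have := h.l3' hv.1 hv.2 e1
      omega
    · have := del3 (G := G) h.c0 hm (h.l5 v hv.1 hvZ)
      omega
  · have := hr v hv e1 e2
    omega

theorem C1.getC2 [Finite V] (h : C1 G n A Z L L0 k p u v1 v2) : C2 G n A Z L L0 k p u v1 v2 := by
  obtain ⟨h1, h2, h3, h4, h5, h6⟩ := h.v1prop
  obtain ⟨g1, g2, g3, g4, g5, g6⟩ := h.rev.v1prop
  rw [PS_rev] at g3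
  exact ⟨h, h1, h2, h3, h4, h5, h6, g1, g2, g3, by simpa using g4, g5, g6⟩

theorem C2.rev (h : C2 G n A Z L L0 k p u v1 v2) :
    C2 G n A Z L L0 k (fun i => p (k - 1 - i)) u v2 v1 := by
  have k1 := h.k1
  refine ⟨h.toC1.rev, h.v2A, h.v2Z, ?_, ?_, h.c2, h.s2, h.v1A, h.v1Z, ?_, ?_, h.c1, h.s1⟩
  · rw [PS_rev]; exact h.v2P
  · simpa using h.a2
  · rw [PS_rev]; exact h.v1P
  · simpa using h.a1

theorem C2.v1u [Finite V] (h : C2 G n A Z L L0 k p u v1 v2) : v1 ≠ u := by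
  rintro rfl; exact h.caseI (by have := h.k1; omega) h.a1

theorem C2.v2u [Finite V] (h : C2 G n A Z L L0 k p u v1 v2) : v2 ≠ u := by
  rintro rfl; exact h.caseI (by have := h.k1; omega) h.a2

theorem Ess_rev {x w : V} (h : Ess G A Z k (fun i => p (k - 1 - i)) u x w) : Ess G A Z k p u x w := by
  obtain ⟨h1, h2, h3, h4, h5, h6⟩ := h
  rw [PS_rev] at h4
  refine ⟨h1, h2, h3, h4, h5, fun i hi => ?_⟩
  have := h6 (k - 1 - i) (by omega)
  have e : k - 1 - (k - 1 - i) = i := by omega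
  simpa only [e] using this

theorem Ess_rev' {x w : V} (h : Ess G A Z k p u x w) : Ess G A Z k (fun i => p (k - 1 - i)) u x w := by
  obtain ⟨h1, h2, h3, h4, h5, h6⟩ := h
  refine ⟨h1, h2, h3, by rwa [PS_rev], h5, fun i hi => h6 _ (by omega)⟩

theorem C2.ess1 [Finite V] (h : C2 G n A Z L L0 k p u v1 v2) : ∃ w, Ess G A Z k p u v1 w := by
  classical
  by_contra hcon
  push Not at hcon
  have k1 := h.k1
  let q : ℕ → V := fun i => if i = 0 then v1 else p (i - 1)
  have q0 : q 0 = v1 := by simp [q]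
  have qs : ∀ i, q (i + 1) = p i := by intro i; simp [q]
  have qc : ∀ i, i < k + 1 → (i = 0 ∧ q i = v1) ∨ ∃ j, j < k ∧ i = j + 1 ∧ q i = p j := by
    intro i hi
    rcases i with _ | j
    · exact Or.inl ⟨rfl, q0⟩
    · exact Or.inr ⟨j, by omega, rfl, qs j⟩
  have v1p : ∀ i, i < k → v1 ≠ p i := fun i hi e => h.v1P ⟨i, hi, e⟩
  have hMH : MH G A Z L L0 (k + 1) q u := by
    refine ⟨h.hZ, h.dZ, by omega, ?_, ?_, ?_, ?_, h.uA, h.uZ, ?_, h.c0, ?_, h.lu, ?_, h.l5, ?_, ?_⟩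
    · intro i j hi hj e
      rcases qc i hi with ⟨e1, e2⟩ | ⟨i', hi', e1, e2⟩ <;> rcases qc j hj with ⟨f1, f2⟩ | ⟨j', hj', f1, f2⟩
      · omega
      · rw [e2, f2] at e; exact (v1p _ hj' e).elim
      · rw [e2, f2] at e; exact (v1p _ hi' e.symm).elim
      · rw [e2, f2] at e
        have := h.inj _ _ hi' hj' e
        omega
    · intro i hi
      rcases qc i hi with ⟨e1, e2⟩ | ⟨i', hi', e1, e2⟩ <;> rw [e2]
      exacts [h.v1A, h.pA _ hi']
    · intro i hi
      rcases qc i hi with ⟨e1, e2⟩ | ⟨i', hi', e1, e2⟩ <;> rw [e2]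
      exacts [h.v1Z, h.pZ _ hi']
    · intro i hi
      rw [qs]
      rcases qc i (by omega) with ⟨e1, e2⟩ | ⟨i', hi', e1, e2⟩ <;> rw [e2]
      · rw [e1]; exact h.a1.symm
      · rw [e1]; exact h.adj _ (by omega)
    · intro i hi
      rcases qc i hi with ⟨e1, e2⟩ | ⟨i', hi', e1, e2⟩ <;> rw [e2]
      exacts [h.v1u.symm, h.up _ hi']
    · intro i hi
      rcases qc i hi with ⟨e1, e2⟩ | ⟨i', hi', e1, e2⟩ <;> rw [e2]
      exacts [h.s1, h.lp _ hi']
    · intro v hv hvu hvp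
      refine h.l3 v hv hvu (fun i hi => ?_)
      have := hvp (i + 1) (by omega)
      rwa [qs] at this
    · intro _ Q hQ hQA hQZ hc huQ i hi hiQ
      by_cases hcc : Conn G (A \ Q)
      · refine hcc _ ⟨?_, hiQ⟩ _ ⟨h.uA, huQ⟩
        rcases qc i hi with ⟨e1, e2⟩ | ⟨i', hi', e1, e2⟩ <;> rw [e2]
        exacts [h.v1A, h.pA _ hi']
      · have hnP : ∀ j, j < k → p j ∉ Q := fun j hj hjQ =>
          hcc (h.conn hQ hQA hQZ (Or.inr (Or.inr (Or.inl ⟨j, hj, hjQ⟩))))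
        have hv1Q : v1 ∈ Q := by
          rcases hc with hc | hc | ⟨j, hj, hjQ⟩
          · exact (hcc (h.conn hQ hQA hQZ (Or.inl hc))).elim
          · exact (hcc (h.conn hQ hQA hQZ (Or.inr (Or.inl hc)))).elim
          · rcases qc j hj with ⟨e1, e2⟩ | ⟨i', hi', e1, e2⟩
            · rwa [e2] at hjQ
            · rw [e2] at hjQ; exact (hnP _ hi' hjQ).elim
        rcases hQ.cases_mem hv1Q with rfl | ⟨w, hw, rfl⟩
        · exact (hcc (h.conn hQ hQA hQZ (Or.inr (Or.inl ⟨_, rfl⟩)))).elim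
        · have hE := hcon w
          have hE : ∃ j, j < k ∧ Lk G (A \ {v1, w}) (p j) u := by
            by_contra hno
            push Not at hno
            refine hE ⟨hQA (by simp), hQZ (by simp), ?_, ?_, hw, hno⟩
            · rintro rfl; exact huQ (by simp)
            · rintro ⟨j, hj, rfl⟩; exact hnP j hj (by simp)
          obtain ⟨j, hj, hl⟩ := hE
          rcases qc i hi with ⟨e1, e2⟩ | ⟨i', hi', e1, e2⟩
          · rw [e2] at hiQ; exact (hiQ (by simp)).elim
          · rw [e2]; exact (h.plk0 hnP hi' hj).trans hl
    · intro _ i hi hik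
      rcases qc i (by omega) with ⟨e1, e2⟩ | ⟨i', hi', e1, e2⟩
      · omega
      · rw [e2]; exact fun hadj => h.caseI hi' hadj.symm
  rcases h.bk A Z L L0 (k + 1) q u h.card (by omega) hMH with he | ⟨_, _, _, he⟩
  · exact h.no he
  · obtain ⟨j, rfl⟩ : ∃ j, k = j + 1 := ⟨k - 1, by omega⟩
    simp only [Nat.add_sub_cancel] at he
    rw [qs] at he
    exact h.caseI (by omega) he.symm

theorem C2.ess2 [Finite V] (h : C2 G n A Z L L0 k p u v1 v2) : ∃ w, Ess G A Z k p u v2 w := by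
  obtain ⟨w, hw⟩ := h.rev.ess1
  exact ⟨w, Ess_rev hw⟩

theorem C2.cross [Finite V] (h : C2 G n A Z L L0 k p u v1 v2) {w w' : V} (h1 : Ess G A Z k p u v1 w)
    (h2 : Ess G A Z k p u v2 w') (n1 : w ≠ v2) (n2 : w' ≠ v1) : False := by
  have k1 := h.k1
  obtain ⟨wA, wZ, wu, wP, aw, hs⟩ := h1
  obtain ⟨wA', wZ', wu', wP', aw', hs'⟩ := h2
  have hv1u := h.v1u
  have hv2u := h.v2u
  have n12 := h.n12
  have pP : ∀ i, i < k → p i ∈ PS k p := fun i hi => mem_PS hi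
  have hPq : ∀ i, i < k → p i ∉ ({v1, w} : Set V) := by
    rintro i hi (e | e)
    · exact h.v1P (e ▸ pP i hi)
    · exact wP (e ▸ pP i hi)
  have nv1 := aw.ne
  have nv2 := aw'.ne
  have uB : u ∈ A \ {v1, w} := ⟨h.uA, by rintro (e | e); exacts [hv1u e.symm, wu e.symm]⟩
  set Cu := comp G (A \ {v1, w}) u with hCu
  have pCu : ∀ i, i < k → p i ∉ Cu := fun i hi hh => hs i hi (Lk.symm hh)
  have v2B : v2 ∈ A \ {v1, w} := ⟨h.v2A, by rintro (e | e); exacts [n12 e.symm, n1 e.symm]⟩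
  have v2Cu : v2 ∉ Cu := fun hh => pCu (k - 1) (by omega)
    (comp_step hh ⟨h.pA _ (by omega), hPq _ (by omega)⟩ h.a2.symm)
  have w'Cu : w' ∉ Cu := fun hh => v2Cu (comp_step hh v2B aw'.symm)
  have sub : Cu ⊆ A \ {v2, w'} := by
    intro x hx
    refine ⟨(comp_sub hx).1, ?_⟩
    rintro (rfl | rfl)
    exacts [v2Cu hx, w'Cu hx]
  have fin : ∀ x ∈ Cu, ∀ b ∈ A \ {v2, w'}, G.Adj x b → Lk G (A \ {v2, w'}) u b := fun x hx b hb ha =>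
    ((Lk.comp hx).mono sub).tail hb ha
  have v1in : v1 ∈ A \ {v2, w'} := ⟨h.v1A, by rintro (e | e); exacts [n12 e, n2 e.symm]⟩
  have p0in : p 0 ∈ A \ {v2, w'} := ⟨h.pA 0 (by omega), by
    rintro (e | e)
    · exact h.v2P (e ▸ pP 0 (by omega))
    · exact wP' (e ▸ pP 0 (by omega))⟩
  refine hs' 0 (by omega) (Lk.symm (Lk.tail (y := v1) ?_ p0in h.a1.symm))
  by_cases e : w = w'
  · subst e
    obtain ⟨b, hb, hb', x, hx, c, hc, ha⟩ := exit_comp (B := A \ {v1, w}) (w := v1) uB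
      (h.conn1 wA wZ u ⟨h.uA, fun e => wu e.symm⟩ v1 ⟨h.v1A, fun e => nv1 e⟩) (by simp)
    have : c = v1 := by grind
    subst this
    exact fin x hx _ v1in ha
  · obtain ⟨b, hb, hb', x, hx, c, hc, ha⟩ := exit_comp (B := A \ {v1, w}) (w := w) uB
      (h.conn1 h.v1A h.v1Z u ⟨h.uA, fun e => hv1u e.symm⟩ w ⟨wA, fun e => nv1 e.symm⟩) (by simp)
    have : c = w := by grind
    subst this
    exact (fin x hx _ ⟨wA, by rintro (e' | e'); exacts [n1 e', e e']⟩ ha).tail v1in aw.symm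

theorem C2.v12 [Finite V] (h : C2 G n A Z L L0 k p u v1 v2) :
    G.Adj v1 v2 ∧ ∀ i, i < k → ¬ Lk G (A \ {v1, v2}) (p i) u := by
  obtain ⟨w, hw⟩ := h.ess1
  obtain ⟨w', hw'⟩ := h.ess2
  by_cases e : w = v2
  · subst e
    exact hw.2.2.2.2
  by_cases e' : w' = v1
  · subst e'
    rw [Set.pair_comm]
    exact ⟨hw'.2.2.2.2.1.symm, hw'.2.2.2.2.2⟩
  · exact (h.cross hw hw' e e').elim

end
end TL

namespace TL
variable {V : Type} {G : SimpleGraph V}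

def KU (G : SimpleGraph V) (A : Set V) (v1 v2 u : V) : Set V :=
  (A \ {v1, v2}) \ comp G (A \ {v1, v2}) u

section
variable {n : ℕ} {A Z : Set V} {L : V → Finset ℕ} {L0 : Finset ℕ} {k : ℕ} {p : ℕ → V} {u v1 v2 : V}

theorem KU_closed : Closed G A {v1, v2} (KU G A v1 v2 u) := closed_other

theorem KU_comm : KU G A v1 v2 u = KU G A v2 v1 u := by
  unfold KU; rw [Set.pair_comm]

theorem mem_AU {x : V} : x ∈ A \ KU G A v1 v2 u ↔
    x ∈ A ∧ (x = v1 ∨ x = v2 ∨ x ∈ comp G (A \ {v1, v2}) u) := by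
  simp only [KU, mem_sdiff, mem_insert_iff, mem_singleton_iff]
  tauto

theorem C2.PK [Finite V] (h : C2 G n A Z L L0 k p u v1 v2) : PS k p ⊆ KU G A v1 v2 u := by
  rintro _ ⟨i, hi, rfl⟩
  refine ⟨⟨h.pA i hi, ?_⟩, fun hh => h.v12.2 i hi (Lk.symm hh)⟩
  rintro (e | e)
  · exact h.v1P ⟨i, hi, e.symm⟩
  · exact h.v2P ⟨i, hi, e.symm⟩

theorem C2.uB [Finite V] (h : C2 G n A Z L L0 k p u v1 v2) : u ∈ A \ {v1, v2} :=
  ⟨h.uA, by rintro (e | e); exacts [h.v1u e.symm, h.v2u e.symm]⟩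

theorem C2.uK [Finite V] (h : C2 G n A Z L L0 k p u v1 v2) : u ∉ KU G A v1 v2 u :=
  fun hh => hh.2 (mem_comp h.uB)

theorem C2.v1K (_ : C2 G n A Z L L0 k p u v1 v2) : v1 ∉ KU G A v1 v2 u :=
  fun hh => hh.1.2 (by simp)

theorem C2.v2K (_ : C2 G n A Z L L0 k p u v1 v2) : v2 ∉ KU G A v1 v2 u :=
  fun hh => hh.1.2 (by simp)

/-- a colouring of the `u` side extends -/
theorem C2.X' [Finite V] (h : C2 G n A Z L L0 k p u v1 v2) {φ : V → ℕ}
    (hφ : Col G (A \ KU G A v1 v2 u) L φ) (hc : Even k ∨ φ v1 ∉ L0 ∨ φ v2 ∉ L0) : False := by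
  classical
  have k1 := h.k1
  set K := KU G A v1 v2 u with hK
  have cl : Closed G A {v1, v2} K := KU_closed
  have hne : φ v1 ≠ φ v2 := hφ.2 v1 ⟨h.v1A, h.v1K⟩ v2 ⟨h.v2A, h.v2K⟩ h.v12.1
  have hα : ∃ α ∈ L0, α ≠ φ v1 ∧ (¬ Even k → α ≠ φ v2) ∧
      (Even k → ∀ β ∈ L0, β ≠ α → β ≠ φ v2) := by
    have c0 := h.c0
    by_cases he : Even k
    · by_cases h1 : φ v1 ∈ L0
      · obtain ⟨α, hα, hn⟩ := exists_ne_of_card (le_of_eq c0.symm) (φ v1)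
        refine ⟨α, hα, hn, fun h => (h he).elim, fun _ β hβ hβα e => ?_⟩
        have : ({α, β, φ v1} : Finset ℕ) ⊆ L0 := by
          intro x hx; simp at hx; rcases hx with rfl | rfl | rfl <;> assumption
        have h3 : ({α, β, φ v1} : Finset ℕ).card = 3 := by
          rw [Finset.card_eq_three]
          exact ⟨α, β, φ v1, hβα.symm, hn, by rw [e]; exact hne.symm, rfl⟩
        have := Finset.card_le_card this
        omega
      · by_cases h2 : φ v2 ∈ L0
        · exact ⟨φ v2, h2, hne.symm, fun h => (h he).elim, fun _ β hβ hβα => hβα⟩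
        · obtain ⟨α, hα⟩ : L0.Nonempty := Finset.card_pos.1 (by omega)
          exact ⟨α, hα, fun e => h1 (e ▸ hα), fun _ e => h2 (e ▸ hα), fun _ β hβ _ e => h2 (e ▸ hβ)⟩
    · rcases hc with hc | hc | hc
      · exact (he hc).elim
      · obtain ⟨α, hα, hn⟩ := exists_ne_of_card (le_of_eq c0.symm) (φ v2)
        exact ⟨α, hα, fun e => hc (e ▸ hα), fun _ => hn, fun h => (he h).elim⟩
      · obtain ⟨α, hα, hn⟩ := exists_ne_of_card (le_of_eq c0.symm) (φ v1)
        exact ⟨α, hα, hn, fun _ e => hc (e ▸ hα), fun h => (he h).elim⟩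
  obtain ⟨α, hα, hα1, hα2, hα3⟩ := hα
  obtain ⟨β, ψ, hβ, hβα, hL, hψ, hcol, hm⟩ := h.del h.nm hα
  have hend : ψ (p (k - 1)) ≠ φ v2 := by
    rw [hψ _ (by omega)]
    by_cases he : Even k
    · have : ¬ Even (k - 1) := by
        rcases he with ⟨r, rfl⟩
        rintro ⟨s, hs⟩
        omega
      simpa [this] using hα3 he β hβ hβα
    · have : Even (k - 1) := Nat.Odd.sub_odd (Nat.not_even_iff_odd.1 he) odd_one
      simpa [this] using hα2 he
  set B := K ∪ {v1, v2} with hB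
  have hBA : B ⊆ A := by
    rintro x (hx | rfl | rfl)
    exacts [cl.sub hx, h.v1A, h.v2A]
  have huB : u ∉ B := by
    rintro (hx | e)
    · exact h.uK hx
    · exact h.uB.2 e
  have only1 : ∀ r ∈ PS k p, G.Adj v1 r → r = p 0 := by
    rintro _ ⟨i, hi, rfl⟩ ha
    rcases h.nbr v1 h.v1A h.v1Z h.v1P i hi ha.symm with e | e
    · rw [e.2]
    · exact (h.n12 e.1).elim
  have only2 : ∀ r ∈ PS k p, G.Adj v2 r → r = p (k - 1) := by
    rintro _ ⟨i, hi, rfl⟩ ha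
    rcases h.nbr v2 h.v2A h.v2Z h.v2P i hi ha.symm with e | e
    · exact (h.n12 e.1.symm).elim
    · rw [e.2]
  obtain ⟨φ', hφ', hQ⟩ := thomassen (A := B \ PS k p) (L := resid G L (PS k p) ψ) (ψ := φ)
    (Q := {v1, v2}) h.nm h.zP (disj_add (disj_sub h.dZ hBA)) (Cl2.pair h.v12.1)
    (by
      rintro x (rfl | rfl)
      · exact ⟨Or.inr (by simp), h.v1P⟩
      · exact ⟨Or.inr (by simp), h.v2P⟩)
    (by
      rw [nb_union]
      rintro x (rfl | rfl)
      exacts [Or.inl h.v1Z, Or.inl h.v2Z])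
    (by
      rintro x (rfl | rfl)
      · refine mem_resid.2 ⟨hφ.1 _ ⟨h.v1A, h.v1K⟩, fun r hr ha => ?_⟩
        rw [only1 r hr ha, hψ 0 (by omega)]
        simpa using hα1
      · refine mem_resid.2 ⟨hφ.1 _ ⟨h.v2A, h.v2K⟩, fun r hr ha => ?_⟩
        rw [only2 r hr ha]
        exact hend)
    (by
      rintro x (rfl | rfl) y (rfl | rfl) hxy
      exacts [(hxy rfl).elim, hne, hne.symm, (hxy rfl).elim])
    (by
      intro v hv hvQ
      by_cases hvZ : v ∈ nb G Z
      · refine (h.l3' (hBA hv.1) hv.2 (fun e => huB (e ▸ hv.1))).trans (resid_card0 ?_)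
        rintro _ ⟨i, hi, rfl⟩ ha
        rcases h.nbr v (hBA hv.1) hvZ hv.2 i hi ha.symm with e | e
        · exact hvQ (Or.inl e.1)
        · exact hvQ (Or.inr e.1)
      · exact del3 h.c0 hm (h.l5 v (hBA hv.1) hvZ))
    (fun v hv hvZ => del5 (h.l5 v (hBA hv.1)) hvZ)
  obtain ⟨f, hf, -, hf2⟩ := col_resid hcol hφ'
  obtain ⟨g, hg, -⟩ := glue cl hφ hf (by
    rintro q (rfl | rfl)
    · rw [hf2 _ h.v1P, hQ _ (by simp)]
    · rw [hf2 _ h.v2P, hQ _ (by simp)])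
  exact h.no ⟨g, hg⟩

theorem C2.AUlt [Finite V] (h : C2 G n A Z L L0 k p u v1 v2) {B : Set V}
    (hB : B ⊆ A \ KU G A v1 v2 u) : B.ncard < n :=
  h.lt' (hB.trans sdiff_subset) (h.pA 0 (by have := h.k1; omega))
    (fun hh => (hB hh).2 (h.PK (mem_PS (by have := h.k1; omega))))

theorem C2.odd [Finite V] (h : C2 G n A Z L L0 k p u v1 v2) : ¬ Even k := by
  intro he
  obtain ⟨φ, hφ⟩ := thom_one (A := A \ KU G A v1 v2 u) (L := L) h.nm h.hZ (disj_sub h.dZ sdiff_subset) u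
    (fun _ => Finset.card_pos.1 (by have := h.lu; omega))
    (fun v hv hvu => h.l3' hv.1 (fun hh => hv.2 (h.PK hh)) hvu) (fun v hv => h.l5 v hv.1)
  exact h.X' hφ (Or.inl he)

theorem third {L0 M : Finset ℕ} (h0 : L0.card = 2) (h3 : M.card = 3) (hs : L0 ⊆ M) :
    ∃ c, c ∉ L0 ∧ M = insert c L0 := by
  obtain ⟨c, hc, hn⟩ : ∃ c ∈ M, c ∉ L0 := by
    by_contra hcon
    push Not at hcon
    have := Finset.card_le_card (show M ⊆ L0 from hcon)
    omega
  refine ⟨c, hn, (Finset.eq_of_subset_of_card_le ?_ ?_).symm⟩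
  · intro x hx
    rw [Finset.mem_insert] at hx
    rcases hx with rfl | hx
    exacts [hc, hs hx]
  · rw [Finset.card_insert_of_notMem hn]; omega

/-- no further essential chord at `v2` -/
def NE2 (G : SimpleGraph V) (A Z : Set V) (k : ℕ) (p : ℕ → V) (u v1 v2 : V) : Prop :=
  ∀ w, w ≠ v1 → ¬ Ess G A Z k p u v2 w

theorem C2.conn2 [Finite V] (h : C2 G n A Z L L0 k p u v1 v2) (hE : NE2 G A Z k p u v1 v2) {w : V}
    (hw : w ∈ A) (hwZ : w ∈ nb G Z) (ha : G.Adj v2 w) (hne : w ≠ v1) : Conn G (A \ {v2, w}) := by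
  have hQA : ({v2, w} : Set V) ⊆ A := by rintro v (rfl | rfl); exacts [h.v2A, hw]
  have hQZ : ({v2, w} : Set V) ⊆ nb G Z := by rintro v (rfl | rfl); exacts [h.v2Z, hwZ]
  by_cases hu : w = u
  · exact h.conn (Cl2.pair ha) hQA hQZ (Or.inr (Or.inr (Or.inr (by simp [hu]))))
  by_cases hP : w ∈ PS k p
  · obtain ⟨i, hi, e⟩ := hP
    exact h.conn (Cl2.pair ha) hQA hQZ (Or.inr (Or.inr (Or.inl ⟨i, hi, by simp [e]⟩)))
  have := hE w hne
  have : ∃ j, j < k ∧ Lk G (A \ {v2, w}) (p j) u := by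
    by_contra hno
    push Not at hno
    exact this ⟨hw, hwZ, hu, hP, ha, hno⟩
  obtain ⟨j, hj, hl⟩ := this
  refine h.conn_lk (Cl2.pair ha) hQA hQZ (fun i hi _ => (h.plk0 ?_ hi hj).trans hl)
  rintro i hi (e | e)
  · exact h.v2P ⟨i, hi, e.symm⟩
  · exact hP ⟨i, hi, e.symm⟩

theorem C2.nb2 [Finite V] (h : C2 G n A Z L L0 k p u v1 v2) (hE : NE2 G A Z k p u v1 v2) :
    ∃ x', ∀ x ∈ A, x ∈ nb G Z → G.Adj v2 x → x ≠ v1 → x ≠ p (k - 1) → x = x' := by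
  have k1 := h.k1
  by_cases hx : ∃ x ∈ A, x ∈ nb G Z ∧ G.Adj v2 x ∧ x ≠ v1 ∧ x ≠ p (k - 1)
  · obtain ⟨x', m', z', ad', n1', n2'⟩ := hx
    refine ⟨x', fun x m z ad n1 n2 => ?_⟩
    by_contra hne
    have hp := h.pA (k - 1) (by omega)
    have hpZ := h.pZ (k - 1) (by omega)
    have pv : p (k - 1) ≠ v2 := h.a2.ne
    have pv1 : p (k - 1) ≠ v1 := fun e => h.v1P ⟨_, by omega, e.symm⟩
    have c1 := h.conn2 hE m z ad n1
    have c2 := h.conn2 hE m' z' ad' n1'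
    have c3 := h.conn2 hE hp hpZ h.a2.symm pv1
    have q1 := ad.ne
    have q2 := ad'.ne
    exact RL h.nm h.hZ h.dZ h.v2A h.v2Z hpZ z z' h.a2.symm ad ad' n2.symm n2'.symm hne
      (c2 _ (by grind) _ (by grind)) (c1 _ (by grind) _ (by grind)) (c3 _ (by grind) _ (by grind))
  · push Not at hx
    exact ⟨v1, fun x m z ad n1 n2 => (n2 (hx x m z ad n1)).elim⟩

theorem C2.six_a [Finite V] (h : C2 G n A Z L L0 k p u v1 v2) (hE : NE2 G A Z k p u v1 v2) {c : ℕ}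
    (hc0 : c ∉ L0) (hc2 : c ∈ L v2) (hc1 : c ∉ L v1) : False := by
  classical
  obtain ⟨x', hx'⟩ := h.nb2 hE
  set U := A \ KU G A v1 v2 u with hU
  have hUA : U ⊆ A := sdiff_subset
  have pU : p (k - 1) ∉ U := fun hh => hh.2 (h.PK (mem_PS (by have := h.k1; omega)))
  let ψ : V → ℕ := fun _ => c
  have hcol : Col G {v2} L ψ := Col.single hc2
  have hz : Conn G (Z ∪ {v2}) := h.hZ.add (by rintro v rfl; exact h.v2Z)
  have h5 : ∀ v ∈ U \ {v2}, v ∉ nb G (Z ∪ {v2}) → 5 ≤ (resid G L {v2} ψ v).card :=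
    fun v hv hvZ => del5 (h.l5 v (hUA hv.1)) hvZ
  have hPU : ∀ v ∈ U, v ∉ PS k p := fun v hv hh => hv.2 (h.PK hh)
  have d1 : ∀ v, (L v).card ≤ (resid G L {v2} ψ v).card + 1 := fun v =>
    del1 (r0 := v2) (fun r hr _ => hr)
  have h3 : ∀ v ∈ U \ {v2}, v ≠ u → v ≠ x' → 3 ≤ (resid G L {v2} ψ v).card := by
    intro v hv h1 h2
    by_cases hvZ : v ∈ nb G Z
    · have hl := h.l3' (hUA hv.1) (hPU v hv.1) h1
      by_cases e : v = v1
      · subst e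
        refine hl.trans (Finset.card_le_card (fun d hd => mem_resid.2 ⟨hd, fun r _ _ e => ?_⟩))
        exact hc1 (by rw [show c = d from e]; exact hd)
      · refine hl.trans (resid_card0 ?_)
        rintro r rfl ha
        exact h2 (hx' v (hUA hv.1) hvZ ha.symm e (by rintro rfl; exact pU hv.1))
    · have := d1 v
      have := h.l5 v (hUA hv.1) hvZ
      omega
  have fin : ¬ Ext G (U \ {v2}) (resid G L {v2} ψ) := by
    rintro ⟨φ, hφ⟩
    obtain ⟨f, hf, hf1, -⟩ := col_resid hcol hφ
    exact h.X' hf (Or.inr (Or.inr (by rw [hf1 v2 rfl]; exact hc0)))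
  refine fin ?_
  by_cases e : u = x'
  · refine thom_one h.nm hz (disj_add (disj_sub h.dZ hUA)) u (fun _ => Finset.card_pos.1 ?_)
      (fun v hv h1 => h3 v hv h1 (e ▸ h1)) h5
    have := d1 u
    have := h.lu
    omega
  · refine h.m1 _ _ _ u x' (h.AUlt sdiff_subset) hz (disj_add (disj_sub h.dZ hUA)) ?_ h3 h5
    intro v hv
    by_cases e1 : v = u
    · subst e1
      refine h.lu.trans (resid_card0 ?_)
      rintro r rfl ha
      exact e (hx' _ h.uA h.uZ ha.symm h.v1u.symm (h.up _ (by have := h.k1; omega)))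
    · have := h.l3' (hUA hv.1) (hPU v hv.1) e1
      have := d1 v
      omega

theorem NE2_of_rev (hE : ∀ w, w ≠ v2 → ¬ Ess G A Z k p u v1 w) :
    NE2 G A Z k (fun i => p (k - 1 - i)) u v2 v1 := fun w hw h => hE w hw (Ess_rev h)

theorem C2.six_b [Finite V] (h : C2 G n A Z L L0 k p u v1 v2) (hE2 : NE2 G A Z k p u v1 v2)
    (hE1 : ∀ w, w ≠ v2 → ¬ Ess G A Z k p u v1 w) {c : ℕ}
    (hc0 : c ∉ L0) (hc2 : c ∈ L v2) (hc1 : c ∈ L v1) : False := by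
  classical
  set U := A \ KU G A v1 v2 u with hU
  have hUA : U ⊆ A := sdiff_subset
  have v1U : v1 ∈ U := ⟨h.v1A, h.v1K⟩
  have v2U : v2 ∈ U := ⟨h.v2A, h.v2K⟩
  obtain ⟨α, hα, hne⟩ : ∃ α ∈ L0, L u ≠ {c, α} := by
    obtain ⟨α, β, hab, e⟩ := Finset.card_eq_two.1 h.c0
    have ha : α ∈ L0 := by rw [e]; simp
    have hb : β ∈ L0 := by rw [e]; simp
    by_cases hh : L u = {c, α}
    · refine ⟨β, hb, fun h2 => ?_⟩
      have : α ∈ ({c, β} : Finset ℕ) := by rw [← h2, hh]; simp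
      simp at this
      rcases this with e | e
      · exact hc0 (e ▸ ha)
      · exact hab e
    · exact ⟨α, ha, hh⟩
  have hcα : c ≠ α := fun e => hc0 (e ▸ hα)
  let L' : V → Finset ℕ := fun v => if v = v1 ∨ v = v2 then {c, α} else L v
  let q : ℕ → V := fun i => if i = 0 then v1 else v2
  have qc : ∀ i, i < 2 → (i = 0 ∧ q i = v1) ∨ (i = 1 ∧ q i = v2) := by
    intro i hi
    rcases i with _ | j
    · left; simp [q]
    · right
      have : j = 0 := by omega
      subst this
      simp [q]
  have nu1 := h.v1u
  have nu2 := h.v2u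
  have n12 := h.n12
  have hL'u : L' u = L u := by simp [L', nu1.symm, nu2.symm]
  have hMH : MH G U Z L' {c, α} 2 q u := by
    refine ⟨h.hZ, disj_sub h.dZ hUA, by omega, ?_, ?_, ?_, ?_, ⟨h.uA, h.uK⟩, h.uZ, ?_,
      Finset.card_pair hcα, ?_, ?_, ?_, ?_, ?_, ?_⟩
    · intro i j hi hj e
      have := qc i hi
      have := qc j hj
      grind
    · intro i hi
      rcases qc i hi with ⟨e1, e2⟩ | ⟨e1, e2⟩ <;> rw [e2]
      exacts [v1U, v2U]
    · intro i hi
      rcases qc i hi with ⟨e1, e2⟩ | ⟨e1, e2⟩ <;> rw [e2]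
      exacts [h.v1Z, h.v2Z]
    · intro i hi
      have e : i = 0 := by omega
      subst e
      simpa [q] using h.v12.1
    · intro i hi
      rcases qc i hi with ⟨e1, e2⟩ | ⟨e1, e2⟩ <;> rw [e2]
      exacts [nu1.symm, nu2.symm]
    · intro i hi
      rcases qc i hi with ⟨e1, e2⟩ | ⟨e1, e2⟩ <;> rw [e2] <;> simp [L']
    · rw [hL'u]; exact h.lu
    · intro v hv hvu hvp
      have e1 : v ≠ v1 := by simpa [q] using hvp 0 (by omega)
      have e2 : v ≠ v2 := by simpa [q] using hvp 1 (by omega)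
      simpa [L', e1, e2] using h.l3' (hUA hv) (fun hh => hv.2 (h.PK hh)) hvu
    · intro v hv hvZ
      have e1 : v ≠ v1 := by rintro rfl; exact hvZ h.v1Z
      have e2 : v ≠ v2 := by rintro rfl; exact hvZ h.v2Z
      simpa [L', e1, e2] using h.l5 v (hUA hv) hvZ
    · intro _ Q hQ hQU hQZ hc huQ i hi hiQ
      have hQA := hQU.trans hUA
      have qiU : q i ∈ U := by
        rcases qc i hi with ⟨e1, e2⟩ | ⟨e1, e2⟩ <;> rw [e2]
        exacts [v1U, v2U]
      refine shortcut_cl KU_closed (Cl2.pair h.v12.1) qiU.2 h.uK ?_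
      suffices hs : Conn G (A \ Q) from hs _ ⟨hUA qiU, hiQ⟩ _ ⟨h.uA, huQ⟩
      rcases hc with hc | hc | ⟨j, hj, hjQ⟩
      · exact h.conn hQ hQA hQZ (Or.inl hc)
      · exact h.conn hQ hQA hQZ (Or.inr (Or.inl hc))
      · rcases hQ.cases_mem hjQ with rfl | ⟨w, hw, rfl⟩
        · exact h.conn hQ hQA hQZ (Or.inr (Or.inl ⟨_, rfl⟩))
        · have wA : w ∈ A := hQA (by simp)
          have wZ : w ∈ nb G Z := hQZ (by simp)
          rcases qc j hj with ⟨e1, e2⟩ | ⟨e1, e2⟩ <;> rw [e2] at hw hiQ ⊢ <;>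
            rcases qc i hi with ⟨f1, f2⟩ | ⟨f1, f2⟩ <;> rw [f2] at hiQ
          · exact (hiQ (by simp)).elim
          · exact h.rev.conn2 (NE2_of_rev hE1) wA wZ hw (by rintro rfl; exact hiQ (by simp))
          · exact h.conn2 hE2 wA wZ hw (by rintro rfl; exact hiQ (by simp))
          · exact (hiQ (by simp)).elim
    · intro _ i hi hi2; omega
  rcases h.lt U Z L' {c, α} 2 q u (h.AUlt subset_rfl) hMH with ⟨φ, hφ⟩ | ⟨he, _⟩
  · have m1 : φ v1 = c ∨ φ v1 = α := by simpa [L'] using hφ.1 v1 v1U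
    have m2 : φ v2 = c ∨ φ v2 = α := by simpa [L'] using hφ.1 v2 v2U
    have hne := hφ.2 v1 v1U v2 v2U h.v12.1
    refine h.X' (φ := φ) (hφ.mono subset_rfl ?_) (Or.inr ?_)
    · intro v hv hm
      by_cases e1 : v = v1
      · subst e1
        rcases m1 with e | e <;> rw [e]
        exacts [hc1, h.s1 hα]
      by_cases e2 : v = v2
      · subst e2
        rcases m2 with e | e <;> rw [e]
        exacts [hc2, h.s2 hα]
      · simpa [L', e1, e2] using hm
    · rcases m1 with e | e
      · left; rw [e]; exact hc0
      · rcases m2 with e' | e'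
        · right; rw [e']; exact hc0
        · exact (hne (e.trans e'.symm)).elim
  · rw [hL'u] at he; exact hne he

end
end TL

namespace TL
variable {V : Type} {G : SimpleGraph V}
section
variable {n : ℕ} {A Z : Set V} {L : V → Finset ℕ} {L0 : Finset ℕ} {k : ℕ} {p : ℕ → V} {u v1 v2 : V}

set_option maxHeartbeats 1000000 in
theorem C2.six_c [Finite V] (h : C2 G n A Z L L0 k p u v1 v2)
    (hE1 : ∃ w, w ≠ v2 ∧ Ess G A Z k p u v1 w) {c : ℕ}
    (hc0 : c ∉ L0) (hc2 : c ∈ L v2) (hc1 : c ∈ L v1) : False := by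
  classical
  have k1 := h.k1
  obtain ⟨w, ⟨n1, hEw⟩, hmin⟩ : ∃ w, (w ≠ v2 ∧ Ess G A Z k p u v1 w) ∧
      ∀ s, (s ≠ v2 ∧ Ess G A Z k p u v1 s) →
        (comp G (A \ {v1, w}) (p 0)).ncard ≤ (comp G (A \ {v1, s}) (p 0)).ncard := by
    have := Set.exists_min_image {w | w ≠ v2 ∧ Ess G A Z k p u v1 w}
      (fun s => (comp G (A \ {v1, s}) (p 0)).ncard) (Set.toFinite _) hE1
    exact this
  obtain ⟨wA, wZ, wu, wP, aw, hs⟩ := hEw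
  have hv1u := h.v1u
  have hv2u := h.v2u
  have n12 := h.n12
  have pP : ∀ i, i < k → p i ∈ PS k p := fun i hi => mem_PS hi
  have nv1 := aw.ne
  have hPq : ∀ i, i < k → p i ∉ ({v1, w} : Set V) := by
    rintro i hi (e | e)
    · exact h.v1P (e ▸ pP i hi)
    · exact wP (e ▸ pP i hi)
  have uB : u ∈ A \ {v1, w} := ⟨h.uA, by rintro (e | e); exacts [hv1u e.symm, wu e.symm]⟩
  set Cu := comp G (A \ {v1, w}) u with hCu
  set Cp := comp G (A \ {v1, w}) (p 0) with hCp
  have pCp : ∀ i, i < k → p i ∈ Cp := fun i hi => h.plk0 hPq (by omega) hi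
  have v2B : v2 ∈ A \ {v1, w} := ⟨h.v2A, by rintro (e | e); exacts [n12 e.symm, n1 e.symm]⟩
  have v2Cp : v2 ∈ Cp := comp_step (pCp (k - 1) (by omega)) v2B h.a2
  have dis : ∀ x, x ∈ Cp → x ∉ Cu := fun x h1 h2 => hs 0 (by omega) (Lk.trans h1 (Lk.symm h2))
  have uCp : u ∉ Cp := fun hh => dis u hh (mem_comp uB)
  have CpB : Cp ⊆ A \ {v1, w} := comp_sub
  have CuB : Cu ⊆ A \ {v1, w} := comp_sub
  obtain ⟨xw, hxw, axw⟩ : ∃ x ∈ Cu, G.Adj x w := by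
    obtain ⟨b, hb, hb', x, hx, c, hc, ha⟩ := exit_comp (B := A \ {v1, w}) (w := w) uB
      (h.conn1 h.v1A h.v1Z u ⟨h.uA, fun e => hv1u e.symm⟩ w ⟨wA, fun e => nv1 e.symm⟩) (by simp)
    have : c = w := by grind
    subst this
    exact ⟨x, hx, ha⟩
  obtain ⟨xv, hxv, axv⟩ : ∃ x ∈ Cu, G.Adj x v1 := by
    obtain ⟨b, hb, hb', x, hx, c, hc, ha⟩ := exit_comp (B := A \ {v1, w}) (w := v1) uB
      (h.conn1 wA wZ u ⟨h.uA, fun e => wu e.symm⟩ v1 ⟨h.v1A, fun e => nv1 e⟩) (by simp)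
    have : c = v1 := by grind
    subst this
    exact ⟨x, hx, ha⟩
  -- walking inside `Cu`
  have walk : ∀ S : Set V, (∀ x ∈ Cu, x ∉ S) → ∀ x ∈ Cu, ∀ b ∈ A \ S, G.Adj x b → Lk G (A \ S) u b := by
    intro S hS x hx b hb ha
    have sub : Cu ⊆ A \ S := fun y hy => ⟨(CuB hy).1, hS y hy⟩
    exact ((Lk.comp hx).mono sub).tail hb ha
  have v2Cu : v2 ∉ Cu := dis _ v2Cp
  have wU' : w ∈ comp G (A \ {v1, v2}) u := by
    refine walk {v1, v2} ?_ xw hxw w ⟨wA, ?_⟩ axw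
    · rintro x hx (rfl | rfl)
      · exact (CuB hx).2 (by simp)
      · exact v2Cu hx
    · rintro (e | e); exacts [nv1 e.symm, n1 e]
  set U := A \ KU G A v1 v2 u with hU
  have hUA : U ⊆ A := sdiff_subset
  have v1U : v1 ∈ U := ⟨h.v1A, h.v1K⟩
  have v2U : v2 ∈ U := ⟨h.v2A, h.v2K⟩
  have uU : u ∈ U := ⟨h.uA, h.uK⟩
  have wU : w ∈ U := mem_AU.2 ⟨wA, Or.inr (Or.inr wU')⟩
  have hPU : ∀ v ∈ U, v ∉ PS k p := fun v hv hh => hv.2 (h.PK hh)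
  set K := Cp ∩ U with hK
  set D := K ∪ {v1, w} with hD
  have DU : D ⊆ U := by
    rintro x (hx | rfl | rfl)
    exacts [hx.2, v1U, wU]
  have clK : Closed G U {v1, w} K := by
    refine ⟨fun x hx => ⟨hx.2, (CpB hx.1).2⟩, fun x hx v hv ha => ?_⟩
    by_cases e : v ∈ ({v1, w} : Set V)
    · exact Or.inr e
    · exact Or.inl ⟨comp_step hx.1 ⟨hUA hv, e⟩ ha, hv⟩
  have cl2 : Closed G U {v1, w} (U \ D) := by
    refine ⟨fun x hx => ⟨hx.1, fun e => hx.2 (Or.inr e)⟩, fun x hx v hv ha => ?_⟩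
    by_cases e : v ∈ ({v1, w} : Set V)
    · exact Or.inr e
    · refine Or.inl ⟨hv, ?_⟩
      rintro (hh | hh)
      · exact hx.2 (Or.inl ⟨comp_step hh.1 ⟨hUA hx.1, fun e => hx.2 (Or.inr e)⟩ ha.symm, hx.1⟩)
      · exact e hh
  have DCu : ∀ x ∈ Cu, x ∉ D := by
    rintro x hx (hh | hh)
    · exact dis x hh.1 hx
    · exact (CuB hx).2 hh
  have p0A := h.pA 0 (by omega)
  have p0U : p 0 ∉ U := fun hh => hPU _ hh (pP 0 (by omega))
  -- no chords at `v1` inside `D`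
  have chord : ∀ s ∈ D, s ∈ nb G Z → G.Adj v1 s → s = v2 ∨ s = w := by
    intro s hsD hsZ has
    by_contra hcon
    push Not at hcon
    obtain ⟨s2, sw⟩ := hcon
    have sv1 := has.ne
    have hsK : s ∈ K := by
      rcases hsD with hh | hh | hh
      · exact hh
      · exact (sv1 hh.symm).elim
      · exact (sw hh).elim
    have sA := hUA hsK.2
    have sCu : s ∉ Cu := dis s hsK.1
    have avoid : ∀ x ∈ Cu, x ∉ ({v1, s} : Set V) := by
      rintro x hx (rfl | rfl)
      · exact (CuB hx).2 (by simp)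
      · exact sCu hx
    have uw : Lk G (A \ {v1, s}) u w := walk _ avoid xw hxw w ⟨wA, by
      rintro (e | e); exacts [nv1 e.symm, sw e.symm]⟩ axw
    have sP : s ∉ PS k p := hPU s hsK.2
    have hPs : ∀ i, i < k → p i ∉ ({v1, s} : Set V) := by
      rintro i hi (e | e)
      · exact h.v1P (e ▸ pP i hi)
      · exact sP (e ▸ pP i hi)
    have su : s ≠ u := by rintro rfl; exact uCp hsK.1
    have p0s : p 0 ≠ s := by rintro e; exact sP (e ▸ pP 0 (by omega))
    have p0w : p 0 ≠ w := by rintro e; exact wP (e ▸ pP 0 (by omega))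
    refine RL h.nm h.hZ h.dZ h.v1A h.v1Z (h.pZ 0 (by omega)) hsZ wZ h.a1.symm has aw p0s p0w sw
      hsK.1 ?_ ?_
    · by_cases hEs : Ess G A Z k p u v1 s
      · exfalso
        have hm := hmin s ⟨s2, hEs⟩
        have hss := hEs.2.2.2.2.2
        have wn : w ∉ comp G (A \ {v1, s}) (p 0) := fun hh =>
          hss 0 (by omega) (Lk.trans hh uw.symm)
        have sub : comp G (A \ {v1, s}) (p 0) ⊆ Cp := by
          intro x hx
          refine Lk.ind hx (fun x => x ∈ Cp) (pCp 0 (by omega)) ?_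
          intro a b ha haC hb hab
          refine comp_step haC ⟨hb.1, ?_⟩ hab
          rintro (e | e)
          · exact hb.2 (by simp [e])
          · rw [mem_singleton_iff] at e
            subst e
            exact wn (Lk.tail ha hb hab)
        have := ncard_lt sub hsK.1 (fun hh => (comp_sub hh).2 (by simp))
        omega
      · have : ∃ j, j < k ∧ Lk G (A \ {v1, s}) (p j) u := by
          by_contra hno
          push Not at hno
          exact hEs ⟨sA, hsZ, su, sP, has, hno⟩
        obtain ⟨j, hj, hl⟩ := this
        exact ((h.plk0 hPs (by omega) hj).trans hl).trans uw
    · have := h.connp (i := 0) (by omega) h.v1A h.v1Z h.a1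
      rw [Set.pair_comm]
      exact this _ ⟨sA, by rintro (e | e); exacts [p0s e.symm, sv1 e.symm]⟩ _
        ⟨wA, by rintro (e | e); exacts [p0w e.symm, nv1 e.symm]⟩
  have hCL : CL G D Z := by
    intro Q hQ hQD hQZ
    have hQA := (hQD.trans DU).trans hUA
    have main : ∀ x ∈ D \ Q, ∀ y ∈ D \ Q, Lk G (A \ Q) x y := by
      by_cases hv : v1 ∈ Q
      · rcases hQ.cases_mem hv with rfl | ⟨s, hs, rfl⟩
        · intro x hx y hy
          exact h.conn1 h.v1A h.v1Z _ ⟨hUA (DU hx.1), hx.2⟩ _ ⟨hUA (DU hy.1), hy.2⟩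
        · rcases chord s (hQD (by simp)) (hQZ (by simp)) hs with rfl | rfl
          · have : ∀ x ∈ D \ {v1, s}, Lk G (A \ {v1, s}) u x := by
              intro x hx
              rcases (mem_AU.1 (DU hx.1)).2 with e | e | e
              · exact (hx.2 (by simp [e])).elim
              · exact (hx.2 (by simp [e])).elim
              · exact e
            exact fun x hx y hy => (this x hx).symm.trans (this y hy)
          · have : ∀ x ∈ D \ {v1, s}, Lk G (A \ {v1, s}) (p 0) x := by
              intro x hx
              rcases hx.1 with e | e
              · exact e.1
              · exact (hx.2 e).elim
            exact fun x hx y hy => (this x hx).symm.trans (this y hy)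
      · have hcon : Conn G (A \ Q) := by
          refine h.conn_lk hQ hQA hQZ (fun i hi _ => ?_)
          have hPQ : ∀ i, i < k → p i ∉ Q := fun i hi hh => hPU _ (DU (hQD hh)) (pP i hi)
          have l1 := h.plk0 (Q := Q) hPQ hi (j := 0) (by omega)
          have l2 := walk Q (fun x hx hh => DCu x hx (hQD hh)) xv hxv v1 ⟨h.v1A, hv⟩ axv
          exact (l1.tail ⟨h.v1A, hv⟩ h.a1).trans l2.symm
        intro x hx y hy
        exact hcon _ ⟨hUA (DU hx.1), hx.2⟩ _ ⟨hUA (DU hy.1), hy.2⟩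
    intro x hx y hy
    have e1 := shortcut_cl (KU_closed (u := u)) (Cl2.pair h.v12.1) (DU hx.1).2 (DU hy.1).2 (main x hx y hy)
    have e2 := shortcut_cl cl2 (Cl2.pair aw) (fun hh => hh.2 hx.1) (fun hh => hh.2 hy.1) e1
    refine e2.mono ?_
    rintro z ⟨⟨hz1, hz2⟩, hz3⟩
    exact ⟨by_contra (fun hh => hz2 ⟨hz1, hh⟩), hz3⟩
  have uD : u ∉ D := by
    rintro (hh | hh)
    · exact uCp hh.1
    · exact uB.2 hh
  have hP : Pth G D Z L v2 v1 w :=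
    ⟨h.hZ, disj_sub h.dZ (DU.trans hUA), Or.inl ⟨v2Cp, v2U⟩, Or.inr (by simp), Or.inr (by simp),
      h.v2Z, h.v1Z, wZ, h.v12.1.symm, aw, n1.symm,
      fun v hv _ _ _ => h.l3' (hUA (DU hv)) (hPU v (DU hv)) (by rintro rfl; exact uD hv),
      fun v hv => h.l5 v (hUA (DU hv))⟩
  obtain ⟨b0, hb0⟩ : ∃ b0, ∀ γ b, c ≠ γ → γ ≠ b → b ≠ b0 → E3 G D L v2 v1 w c γ b := by
    by_cases ha : G.Adj v2 w
    · exact ⟨c, fun γ b e1 e2 e3 => tri_good h.nm hP hCL ha e1 e2 e3.symm⟩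
    by_cases hex : ∃ γ b, c ≠ γ ∧ γ ≠ b ∧ ¬ E3 G D L v2 v1 w c γ b
    · obtain ⟨γ, b, e1, e2, e3⟩ := hex
      refine ⟨b, fun γ' b' f1 f2 f3 => by_contra fun f4 => ?_⟩
      exact f3 ((lu_all h.nm n h.m1).1 D Z L v2 v1 w c γ b γ' b' (h.AUlt DU).le hP hCL ha
        e1 e2 f1 f2 e3 f4).2.symm
    · push Not at hex
      exact ⟨c, fun γ b e1 e2 _ => hex γ b e1 e2⟩
  have l3U : ∀ v ∈ U, v ≠ u → 3 ≤ (L v).card := fun v hv hvu => h.l3' (hUA hv) (hPU v hv) hvu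
  let L' : V → Finset ℕ := fun v => if v = w then (L w).erase b0 else L v
  obtain ⟨φ, hφ⟩ : Ext G (U \ K) L' := by
    refine h.m1 (U \ K) Z L' u w (h.AUlt sdiff_subset) h.hZ (disj_sub h.dZ (sdiff_subset.trans hUA)) ?_ ?_ ?_
    · intro v hv
      by_cases e : v = w
      · subst e
        have := l3U v wU wu
        have := Finset.pred_card_le_card_erase (s := L v) (a := b0)
        simp only [L', if_true]
        omega
      · simp only [L', e, if_false]
        by_cases e' : v = u
        · subst e'; exact h.lu
        · have := l3U v hv.1 e'; omega
    · intro v hv e1 e2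
      simp only [L', e2, if_false]
      exact l3U v hv.1 e1
    · intro v hv hvZ
      have e : v ≠ w := by rintro rfl; exact hvZ wZ
      simp only [L', e, if_false]
      exact h.l5 v (hUA hv.1) hvZ
  have hφL : Col G (U \ K) L φ := by
    refine hφ.mono subset_rfl (fun v hv => ?_)
    by_cases e : v = w
    · subst e; simp only [L', if_true]; exact fun hh => Finset.erase_subset _ _ hh
    · simp [L', e]
  have v1UK : v1 ∈ U \ K := ⟨v1U, fun hh => (CpB hh.1).2 (by simp)⟩
  have wUK : w ∈ U \ K := ⟨wU, fun hh => (CpB hh.1).2 (by simp)⟩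
  have hwb : φ w ≠ b0 := by
    have := hφ.1 w wUK
    simp only [L', if_true, Finset.mem_erase] at this
    exact this.1
  by_cases hc : φ v1 = c
  · obtain ⟨f, hf, hf2⟩ := ext_closed h.nm h.hZ (disj_sub h.dZ hUA) (Cl2.pair aw)
      (by rintro x (rfl | rfl); exacts [v1U, wU]) (by rintro x (rfl | rfl); exacts [h.v1Z, wZ])
      clK hφL (fun v hv => l3U v hv.2 (by rintro rfl; exact uCp hv.1)) (fun v hv => h.l5 v (hUA hv.2))
    exact h.X' hf (Or.inr (Or.inl (by rw [hf2 v1 v1UK.2, hc]; exact hc0)))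
  · obtain ⟨φ2, h2⟩ := hb0 (φ v1) (φ w) (Ne.symm hc) (hφL.2 v1 v1UK w wUK aw) hwb
    have m1 := h2.1 v1 hP.hy
    have m2 := h2.1 v2 hP.hx
    have m3 := h2.1 w hP.hw
    simp only [P3] at m1 m2 m3
    have q1 := hφL.1 v1 v1UK
    have q2 := hφL.1 w wUK
    obtain ⟨f, hf, hf1, -⟩ := glue (L := L) clK hφL
      (h2.mono subset_rfl (by intro v hv; simp only [P3]; grind)) (by grind)
    refine h.X' hf (Or.inr (Or.inr ?_))
    rw [hf1 v2 ⟨v2Cp, v2U⟩]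
    grind

theorem Cx.absurd [Finite V] (h : Cx G n A Z L L0 k p u) : False := by
  obtain ⟨v1, v2, h1⟩ := h.getC1
  have h2 := h1.getC2
  obtain ⟨c1, hc1, e1⟩ := third h.c0 h2.c1 h2.s1
  obtain ⟨c2, hc2, e2⟩ := third h.c0 h2.c2 h2.s2
  have hE : NE2 G A Z k p u v1 v2 ∨ (∀ w, w ≠ v2 → ¬ Ess G A Z k p u v1 w) := by
    by_contra hcon
    push Not at hcon
    obtain ⟨ha, w, hw, hw'⟩ := hcon
    unfold NE2 at ha
    push Not at ha
    obtain ⟨w', hw2, hw3⟩ := ha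
    exact h2.cross hw' hw3 hw hw2
  by_cases e : c1 = c2
  · subst e
    have q1 : c1 ∈ L v1 := by rw [e1]; simp
    have q2 : c1 ∈ L v2 := by rw [e2]; simp
    by_cases hE1 : ∃ w, w ≠ v2 ∧ Ess G A Z k p u v1 w
    · exact h2.six_c hE1 hc1 q2 q1
    by_cases hE2 : ∃ w, w ≠ v1 ∧ Ess G A Z k p u v2 w
    · obtain ⟨w, hw, hw'⟩ := hE2
      exact h2.rev.six_c ⟨w, hw, Ess_rev' hw'⟩ hc1 q1 q2
    push Not at hE1 hE2
    exact h2.six_b hE2 hE1 hc1 q2 q1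
  · rcases hE with hE | hE
    · refine h2.six_a hE hc2 (by rw [e2]; simp) ?_
      rw [e1, Finset.mem_insert]
      rintro (e' | e')
      exacts [e e'.symm, hc2 e']
    · refine h2.rev.six_a (NE2_of_rev hE) hc1 (by rw [e1]; simp) ?_
      rw [e2, Finset.mem_insert]
      rintro (e' | e')
      exacts [e e', hc1 e']

end

theorem main_M [Finite V] (hG : NoMin G) : ∀ n, MLt G n := by
  intro n
  induction n with
  | zero => intro A Z L L0 k p u hA; omega
  | succ n ih =>
    have key : ∀ m k, n - k ≤ m → MK G n k := by
      intro m
      induction m with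
      | zero =>
        intro k hk A Z L L0 k' p u hA hkk h
        exfalso
        classical
        have h2 : (PS k' p).ncard ≤ A.ncard := by
          refine Set.ncard_le_ncard ?_ (Set.toFinite _)
          rintro _ ⟨i, hi, rfl⟩
          exact h.pA i hi
        have h3 : (PS k' p).ncard = k' := by
          have : PS k' p = p '' (Set.Iio k') := by
            ext x; simp [PS, eq_comm]
          rw [this, Set.InjOn.ncard_image]
          · simp [Set.ncard_eq_toFinset_card']
          · intro i hi j hj e
            exact h.inj i j hi hj e
        omega
      | succ m ihm =>
        intro k hk A Z L L0 k' p u hA hkk h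
        by_contra hcon
        push Not at hcon
        exact Cx.absurd (⟨h, hG, ih, ihm k' (by omega), hA, hcon.1, hcon.2⟩ : Cx G n A Z L L0 k' p u)
    intro A Z L L0 k p u hA h
    rcases Nat.lt_succ_iff_lt_or_eq.1 hA with h1 | h1
    · exact ih _ _ _ _ _ _ _ h1 h
    · exact key n 0 (by omega) _ _ _ _ _ _ _ h1 (by have := h.k1; omega) h

theorem main_MH [Finite V] (hG : NoMin G) {A Z : Set V} {L : V → Finset ℕ} {L0 : Finset ℕ} {k : ℕ}
    {p : ℕ → V} {u : V} (h : MH G A Z L L0 k p u) : Ext G A L ∨ Exc G L L0 k p u :=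
  main_M hG (A.ncard + 1) _ _ _ _ _ _ _ (by omega) h

end TL

namespace TL

theorem lift_exp {E : Type*} [NormedAddCommGroup E] [NormedSpace ℝ E] {g : E → ℂ} (hg : Continuous g)
    (h0 : ∀ x, g x ≠ 0) : ∃ f : E → ℂ, Continuous f ∧ ∀ x, Complex.exp (f x) = g x := by
  obtain ⟨f, -, hf⟩ := Complex.isCoveringMapOn_exp.existsUnique_continuousMap_lifts
    (A := E) ⟨g, hg⟩ (a₀ := 0) (Complex.exp_log (h0 0)) h0 |>.exists
  exact ⟨f, f.2, fun x => congr_fun hf x⟩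

theorem lift_unique {f g : ℝ → ℂ} (hf : Continuous f) (hg : Continuous g)
    (c : ℂ)
    (h : ∀ x, Complex.exp (f x) = c * Complex.exp (g x)) (x y : ℝ) :
    f x - f y = g x - g y := by
  have h1 : ∀ x, ∃ n : ℤ, (f x - g x) - (f 0 - g 0) = n * (2 * Real.pi * Complex.I) := by
    intro x
    rw [← Complex.exp_eq_one_iff]
    have hc : c ≠ 0 := by
      rintro rfl
      have := h 0
      simp at this
    rw [Complex.exp_sub, Complex.exp_sub, Complex.exp_sub, h x, h 0]
    have := Complex.exp_ne_zero (g x)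
    have := Complex.exp_ne_zero (g 0)
    field_simp
  choose n hn using h1
  have hp : (2 * Real.pi * Complex.I : ℂ) ≠ 0 := Complex.two_pi_I_ne_zero
  have hnc : Continuous (fun x => (n x : ℝ)) := by
    have : (fun x => (n x : ℝ)) = fun x => (((f x - g x) - (f 0 - g 0)) / (2 * Real.pi * Complex.I)).re := by
      funext x
      rw [hn x, mul_div_cancel_right₀ _ hp]
      simp
    rw [this]
    fun_prop
  have hnc' : Continuous n := by
    exact Int.isClosedEmbedding_coe_real.isEmbedding.continuous_iff.2 hnc
  have := PreconnectedSpace.constant (inferInstance : PreconnectedSpace ℝ) hnc' (x := x) (y := y)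
  have e1 := hn x
  have e2 := hn y
  rw [this] at e1
  linear_combination e1 - e2

/-- sign -/
def sg {m : ℕ} (i j : Fin m) : ℤ := if i < j then 1 else -1

theorem wind {m : ℕ} (r : Fin m → ℂ) (Ed : Fin m → Fin m → Prop) (γ : Fin m → Fin m → ℝ → ℂ)
    (hr : Function.Injective r)
    (hc : ∀ c d, Ed c d → Continuous (γ c d) ∧ γ c d 0 = r c ∧ γ c d 1 = r d)
    (hv : ∀ a c d, Ed c d → a ≠ c → a ≠ d → ∀ t, γ c d t ≠ r a)
    (he : ∀ a b c d, Ed a b → Ed c d → a ≠ c → a ≠ d → b ≠ c → b ≠ d → ∀ s t, γ a b s ≠ γ c d t) :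
    ∃ n : Fin m → Fin m → Fin m → ℤ, ∀ a b c d, Ed a b → Ed c d → a ≠ c → a ≠ d → b ≠ c → b ≠ d →
      2 * (n a c d + n d a b - n c a b - n b c d) = sg a d - sg a c - sg b d + sg b c := by
  let l : Fin m → Fin m → ℂ := fun i j => if i < j then Complex.log (r j - r i) else
    Complex.log (r i - r j) + Real.pi * Complex.I
  have hl : ∀ i j, i ≠ j → Complex.exp (l i j) = r j - r i := by
    intro i j hij
    have h1 : r j - r i ≠ 0 := sub_ne_zero.2 (fun e => hij (hr e).symm)
    have h2 : r i - r j ≠ 0 := sub_ne_zero.2 (fun e => hij (hr e))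
    by_cases h : i < j
    · simp only [l, h, if_true]
      exact Complex.exp_log h1
    · simp only [l, h, if_false]
      rw [Complex.exp_add, Complex.exp_log h2, Complex.exp_pi_mul_I]
      ring
  have hll : ∀ i j, i ≠ j → l i j - l j i = - sg i j * (Real.pi * Complex.I) := by
    intro i j hij
    rcases lt_or_gt_of_ne hij with h | h
    · simp only [l, sg, h, if_true, not_lt_of_gt h, if_false]
      push_cast
      ring
    · simp only [l, sg, h, if_true, not_lt_of_gt h, if_false]
      push_cast
      ring
  have hh : ∀ a c d, ∃ n : ℤ, ∃ h : ℝ → ℂ, Ed c d → a ≠ c → a ≠ d → Continuous h ∧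
      (∀ t, Complex.exp (h t) = γ c d t - r a) ∧
      h 1 - h 0 = l a d - l a c + n * (2 * Real.pi * Complex.I) := by
    intro a c d
    by_cases H : Ed c d ∧ a ≠ c ∧ a ≠ d
    swap
    · exact ⟨0, fun _ => 0, fun h1 h2 h3 => (H ⟨h1, h2, h3⟩).elim⟩
    obtain ⟨h1, h2, h3⟩ := H
    obtain ⟨c1, c2, c3⟩ := hc c d h1
    obtain ⟨f, hf, hfe⟩ := lift_exp (g := fun t : ℝ => γ c d t - r a) (by fun_prop)
      (fun t => sub_ne_zero.2 (hv a c d h1 h2 h3 t))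
    have : Complex.exp (f 1 - f 0) = Complex.exp (l a d - l a c) := by
      rw [Complex.exp_sub, Complex.exp_sub, hfe, hfe, hl a d h3, hl a c h2, c2, c3]
    obtain ⟨n, hn⟩ := Complex.exp_eq_exp_iff_exists_int.1 this
    exact ⟨n, f, fun _ _ _ => ⟨hf, hfe, hn⟩⟩
  choose n h hn using hh
  refine ⟨n, fun a b c d h1 h2 ac ad bc bd => ?_⟩
  obtain ⟨c1, c2, c3⟩ := hc a b h1
  obtain ⟨c4, c5, c6⟩ := hc c d h2
  obtain ⟨F, hF, hFe⟩ := lift_exp (g := fun x : ℝ × ℝ => γ c d x.2 - γ a b x.1) (by fun_prop)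
      (fun x => sub_ne_zero.2 (he a b c d h1 h2 ac ad bc bd x.1 x.2).symm)
  obtain ⟨k1, k2, k3⟩ := hn a c d h2 ac ad
  obtain ⟨k4, k5, k6⟩ := hn b c d h2 bc bd
  obtain ⟨k7, k8, k9⟩ := hn c a b h1 ac.symm bc.symm
  obtain ⟨k10, k11, k12⟩ := hn d a b h1 ad.symm bd.symm
  have e1 := lift_unique (f := fun t => F (0, t)) (g := h a c d) (by fun_prop) k1 1
    (by intro t; rw [hFe, k2, one_mul]; simp [c2]) 1 0
  have e2 := lift_unique (f := fun t => F (1, t)) (g := h b c d) (by fun_prop) k4 1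
    (by intro t; rw [hFe, k5, one_mul]; simp [c3]) 1 0
  have e3 := lift_unique (f := fun t => F (t, 0)) (g := h c a b) (by fun_prop) k7 (-1)
    (by intro t; rw [hFe, k8]; simp [c5]) 1 0
  have e4 := lift_unique (f := fun t => F (t, 1)) (g := h d a b) (by fun_prop) k10 (-1)
    (by intro t; rw [hFe, k11]; simp [c6]) 1 0
  have hp : (Real.pi * Complex.I : ℂ) ≠ 0 := by
    simp [Real.pi_ne_zero]
  have := hll a d ad
  have := hll a c ac
  have := hll b d bd
  have := hll b c bc
  have key : ((2 * (n a c d + n d a b - n c a b - n b c d) : ℤ) : ℂ) * (Real.pi * Complex.I) =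
      ((sg a d - sg a c - sg b d + sg b c : ℤ) : ℂ) * (Real.pi * Complex.I) := by
    push_cast
    linear_combination -e1 + e2 + e3 - e4 - k3 + k6 + k9 - k12 - hll a d ad + hll a c ac + hll b d bd - hll b c bc
  exact_mod_cast mul_right_cancel₀ hp key

theorem wind_sets {m : ℕ} (r : Fin m → ℂ) (Ed : Fin m → Fin m → Prop) (R : Fin m → Fin m → Set ℂ)
    (hr : Function.Injective r)
    (hc : ∀ c d, Ed c d → JoinedIn (R c d) (r c) (r d))
    (hv : ∀ a c d, Ed c d → a ≠ c → a ≠ d → r a ∉ R c d)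
    (he : ∀ a b c d, Ed a b → Ed c d → a ≠ c → a ≠ d → b ≠ c → b ≠ d → Disjoint (R a b) (R c d)) :
    ∃ n : Fin m → Fin m → Fin m → ℤ, ∀ a b c d, Ed a b → Ed c d → a ≠ c → a ≠ d → b ≠ c → b ≠ d →
      2 * (n a c d + n d a b - n c a b - n b c d) = sg a d - sg a c - sg b d + sg b c := by
  have hg : ∀ c d, ∃ g : ℝ → ℂ, Ed c d → (Continuous g ∧ g 0 = r c ∧ g 1 = r d) ∧ ∀ t, g t ∈ R c d := by
    intro c d
    by_cases h : Ed c d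
    · obtain ⟨γ, hγ⟩ := hc c d h
      refine ⟨γ.extend, fun _ => ⟨⟨γ.continuous_extend, by simp, by simp⟩, fun t => ?_⟩⟩
      have : γ.extend t ∈ range γ := by
        rw [← γ.extend_range]; exact mem_range_self t
      obtain ⟨s, hs⟩ := this
      rw [← hs]; exact hγ s
    · exact ⟨fun _ => 0, fun h' => (h h').elim⟩
  choose g hg using hg
  refine wind r Ed g hr (fun c d h => (hg c d h).1) (fun a c d h h1 h2 t e => ?_)
    (fun a b c d h h' h1 h2 h3 h4 s t e => ?_)
  · exact hv a c d h h1 h2 (e ▸ (hg c d h).2 t)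
  · exact Set.disjoint_left.1 (he a b c d h h' h1 h2 h3 h4) ((hg a b h).2 s) (e ▸ (hg c d h').2 t)

theorem no_k5 (r : Fin 5 → ℂ) (R : Fin 5 → Fin 5 → Set ℂ) (hr : Function.Injective r)
    (hc : ∀ c d, c < d → JoinedIn (R c d) (r c) (r d))
    (hv : ∀ a c d, c < d → a ≠ c → a ≠ d → r a ∉ R c d)
    (he : ∀ a b c d, a < b → c < d → a ≠ c → a ≠ d → b ≠ c → b ≠ d → Disjoint (R a b) (R c d)) :
    False := by
  obtain ⟨n, hn⟩ := wind_sets r (fun c d => c < d) R hr hc hv he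
  have q : ∀ a b c d : Fin 5, (a < b ∧ c < d ∧ a ≠ c ∧ a ≠ d ∧ b ≠ c ∧ b ≠ d) →
      2 * (n a c d + n d a b - n c a b - n b c d) = sg a d - sg a c - sg b d + sg b c :=
    fun a b c d h => hn a b c d h.1 h.2.1 h.2.2.1 h.2.2.2.1 h.2.2.2.2.1 h.2.2.2.2.2
  have q1 := q 0 1 2 3 (by decide)
  have q2 := q 0 1 2 4 (by decide)
  have q3 := q 0 1 3 4 (by decide)
  have q4 := q 0 2 1 3 (by decide)
  have q5 := q 0 2 1 4 (by decide)
  have q6 := q 0 2 3 4 (by decide)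
  have q7 := q 0 3 1 2 (by decide)
  have q8 := q 0 3 1 4 (by decide)
  have q9 := q 0 3 2 4 (by decide)
  have q10 := q 0 4 1 2 (by decide)
  have q11 := q 0 4 1 3 (by decide)
  have q12 := q 0 4 2 3 (by decide)
  have q13 := q 1 2 3 4 (by decide)
  have q14 := q 1 3 2 4 (by decide)
  have q15 := q 1 4 2 3 (by decide)
  simp only [sg, Fin.reduceLT, if_true, if_false] at q1 q2 q3 q4 q5 q6 q7 q8 q9 q10 q11 q12 q13 q14 q15
  omega

theorem no_k33 (r : Fin 6 → ℂ) (R : Fin 6 → Fin 6 → Set ℂ) (hr : Function.Injective r)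
    (hc : ∀ c d, c < 3 ∧ 3 ≤ d → JoinedIn (R c d) (r c) (r d))
    (hv : ∀ a c d, c < 3 ∧ 3 ≤ d → a ≠ c → a ≠ d → r a ∉ R c d)
    (he : ∀ a b c d, (a < 3 ∧ 3 ≤ b) → (c < 3 ∧ 3 ≤ d) → a ≠ c → a ≠ d → b ≠ c → b ≠ d →
      Disjoint (R a b) (R c d)) : False := by
  obtain ⟨n, hn⟩ := wind_sets r (fun c d => c < 3 ∧ 3 ≤ d) R hr hc hv he
  have q : ∀ a b c d : Fin 6, (a < c ∧ c < 3 ∧ 3 ≤ b ∧ 3 ≤ d ∧ b ≠ d) →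
      2 * (n a c d + n d a b - n c a b - n b c d) = sg a d - sg a c - sg b d + sg b c :=
    fun a b c d h => hn a b c d ⟨h.1.trans h.2.1, h.2.2.1⟩ ⟨h.2.1, h.2.2.2.1⟩ (by omega) (by omega)
      (by omega) (by omega)
  have q1 := q 0 3 1 4 (by decide)
  have q2 := q 0 3 1 5 (by decide)
  have q3 := q 0 4 1 3 (by decide)
  have q4 := q 0 4 1 5 (by decide)
  have q5 := q 0 5 1 3 (by decide)
  have q6 := q 0 5 1 4 (by decide)
  have q7 := q 0 3 2 4 (by decide)
  have q8 := q 0 3 2 5 (by decide)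
  have q9 := q 0 4 2 3 (by decide)
  have q10 := q 0 4 2 5 (by decide)
  have q11 := q 0 5 2 3 (by decide)
  have q12 := q 0 5 2 4 (by decide)
  have q13 := q 1 3 2 4 (by decide)
  have q14 := q 1 3 2 5 (by decide)
  have q15 := q 1 4 2 3 (by decide)
  have q16 := q 1 4 2 5 (by decide)
  have q17 := q 1 5 2 3 (by decide)
  have q18 := q 1 5 2 4 (by decide)
  simp only [sg, Fin.reduceLT, if_true, if_false] at q1 q2 q3 q4 q5 q6 q7 q8 q9 q10 q11 q12 q13 q14 q15 q16 q17 q18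
  omega

end TL

namespace TL
variable {W : Type} {H : SimpleGraph W}

/-- weak drawing -/
structure WD (H : SimpleGraph W) where
  pos : W → ℝ × ℝ
  arc : W → W → Set (ℝ × ℝ)
  inj : Function.Injective pos
  joined : ∀ x y, H.Adj x y → JoinedIn (arc x y) (pos x) (pos y)
  off : ∀ x y v, H.Adj x y → v ≠ x → v ≠ y → pos v ∉ arc x y
  disj : ∀ x y z w, H.Adj x y → H.Adj z w → x ≠ z → x ≠ w → y ≠ z → y ≠ w →
    Disjoint (arc x y) (arc z w)

def WD.RS (D : WD H) (S : Set W) : Set (ℝ × ℝ) :=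
  {q | (∃ x ∈ S, q = D.pos x) ∨ ∃ x ∈ S, ∃ y ∈ S, H.Adj x y ∧ q ∈ D.arc x y}

theorem WD.RS_disj (D : WD H) {S T : Set W} (h : Disjoint S T) : Disjoint (D.RS S) (D.RS T) := by
  rw [Set.disjoint_left] at h ⊢
  rintro q (⟨x, hx, rfl⟩ | ⟨x, hx, y, hy, ha, hq⟩) (⟨z, hz, e⟩ | ⟨z, hz, w, hw, ha', hq'⟩)
  · exact h hx (D.inj e ▸ hz)
  · exact D.off z w x ha' (by rintro rfl; exact h hx hz) (by rintro rfl; exact h hx hw) hq'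
  · exact D.off x y z ha (by rintro rfl; exact h hx hz) (by rintro rfl; exact h hy hz) (e ▸ hq)
  · exact Set.disjoint_left.1 (D.disj x y z w ha ha' (by rintro rfl; exact h hx hz)
      (by rintro rfl; exact h hx hw) (by rintro rfl; exact h hy hz) (by rintro rfl; exact h hy hw)) hq hq'

theorem WD.RS_joined (D : WD H) {S : Set W} {x y : W} (h : Lk H S x y) :
    JoinedIn (D.RS S) (D.pos x) (D.pos y) := by
  refine h.ind (fun y => JoinedIn (D.RS S) (D.pos x) (D.pos y)) (JoinedIn.refl (Or.inl ⟨x, h.left, rfl⟩)) ?_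
  intro a b ha h1 hb hab
  exact h1.trans ((D.joined a b hab).mono (fun q hq => Or.inr ⟨a, ha.right, b, hb, hab, hq⟩))

theorem WD.data (D : WD H) {m : ℕ} (B : Fin m → Set W) (Ed : Fin m → Fin m → Prop)
    (hne : ∀ i, (B i).Nonempty) (hB : ∀ i, Conn H (B i)) (hd : ∀ i j, i < j → Disjoint (B i) (B j))
    (hT : ∀ i j, Ed i j → Touch H (B i) (B j)) :
    ∃ (r : Fin m → ℂ) (R : Fin m → Fin m → Set ℂ), Function.Injective r ∧
      (∀ c d, Ed c d → JoinedIn (R c d) (r c) (r d)) ∧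
      (∀ a c d, Ed c d → a ≠ c → a ≠ d → r a ∉ R c d) ∧
      (∀ a b c d, Ed a b → Ed c d → a ≠ c → a ≠ d → b ≠ c → b ≠ d → Disjoint (R a b) (R c d)) := by
  have hd' : ∀ i j, i ≠ j → Disjoint (B i) (B j) := by
    intro i j hij
    rcases lt_or_gt_of_ne hij with h | h
    exacts [hd i j h, (hd j i h).symm]
  choose x hx using hne
  let e := Complex.equivRealProdCLM.symm
  have einj : Function.Injective e := e.injective
  refine ⟨fun i => e (D.pos (x i)), fun c d => e '' (D.RS (B c ∪ B d)), ?_, ?_, ?_, ?_⟩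
  · intro i j hij
    by_contra hne
    have : x i = x j := D.inj (einj hij)
    exact Set.disjoint_left.1 (hd' i j hne) (hx i) (this ▸ hx j)
  · intro c d h
    have := D.RS_joined (((hB c).union (hB d) (hT c d h)) (x c) (Or.inl (hx c)) (x d) (Or.inr (hx d)))
    obtain ⟨γ, hγ⟩ := this
    exact ⟨γ.map e.continuous, fun t => ⟨_, hγ t, rfl⟩⟩
  · rintro a c d h h1 h2 ⟨q, hq, he⟩
    have := einj he
    subst this
    have dd : Disjoint (B a) (B c ∪ B d) := Set.disjoint_union_right.2 ⟨hd' _ _ h1, hd' _ _ h2⟩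
    exact Set.disjoint_left.1 (D.RS_disj dd) (Or.inl ⟨_, hx a, rfl⟩) hq
  · intro a b c d _ _ h1 h2 h3 h4
    refine (Set.disjoint_image_iff einj).2 (D.RS_disj ?_)
    simp only [Set.disjoint_union_right, Set.disjoint_union_left]
    exact ⟨⟨hd' _ _ h1, hd' _ _ h3⟩, hd' _ _ h2, hd' _ _ h4⟩

theorem Touch.ne1 {B C : Set W} (h : Touch H B C) : B.Nonempty := by
  obtain ⟨b, hb, _⟩ := h; exact ⟨b, hb⟩
theorem Touch.ne2 {B C : Set W} (h : Touch H B C) : C.Nonempty := by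
  obtain ⟨b, hb, c, hc, _⟩ := h; exact ⟨c, hc⟩

theorem WD.noMin (D : WD H) : NoMin H := by
  constructor
  · intro b1 b2 b3 b4 b5 c1 c2 c3 c4 c5 d1 d2 d3 d4 d5 d6 d7 d8 d9 d10 t1 t2 t3 t4 t5 t6 t7 t8 t9 t10
    obtain ⟨r, R, h1, h2, h3, h4⟩ := D.data ![b1, b2, b3, b4, b5] (fun c d => c < d)
      (by
        have := t1.ne1; have := t1.ne2; have := t2.ne2; have := t3.ne2; have := t4.ne2
        intro i; fin_cases i <;> assumption)
      (by intro i; fin_cases i <;> assumption)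
      (by intro i j h; fin_cases i <;> fin_cases j <;> first | assumption | (exact absurd h (by decide)))
      (by intro i j h; fin_cases i <;> fin_cases j <;> first | assumption | (exact absurd h (by decide)))
    exact no_k5 r R h1 h2 h3 h4
  · intro b1 b2 b3 b4 b5 b6 c1 c2 c3 c4 c5 c6 d1 d2 d3 d4 d5 d6 d7 d8 d9 d10 d11 d12 d13 d14 d15
      t1 t2 t3 t4 t5 t6 t7 t8 t9
    obtain ⟨r, R, h1, h2, h3, h4⟩ := D.data ![b1, b2, b3, b4, b5, b6] (fun c d => c < 3 ∧ 3 ≤ d)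
      (by
        have := t1.ne1; have := t1.ne2; have := t2.ne2; have := t3.ne2; have := t4.ne1; have := t7.ne1
        intro i; fin_cases i <;> assumption)
      (by intro i; fin_cases i <;> assumption)
      (by intro i j h; fin_cases i <;> fin_cases j <;> first | assumption | (exact absurd h (by decide)))
      (by intro i j h; fin_cases i <;> fin_cases j <;> first | assumption | (exact absurd h (by decide)))
    exact no_k33 r R h1 h2 h3 h4
end TL

namespace TL
variable {W : Type} {H : SimpleGraph W}

/-- add a vertex joined to `X` -/
def plus (H : SimpleGraph W) (X : Set W) : SimpleGraph (Option W) where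
  Adj a b := match a, b with
    | some x, some y => H.Adj x y
    | none, some y => y ∈ X
    | some x, none => x ∈ X
    | none, none => False
  symm := ⟨by
    rintro (_ | x) (_ | y) h
    exacts [h, h, h, H.adj_symm h]⟩
  loopless := ⟨by
    rintro (_ | x) h
    exacts [h, H.irrefl h]⟩

theorem WD.add [Finite W] (D : WD H) (F : Set (ℝ × ℝ)) (hF : IsPathConnected F)
    (hcl : ∀ x y, H.Adj x y → IsClosed (D.arc x y))
    (hp : ∀ x, D.pos x ∉ F) (ha : ∀ x y, H.Adj x y → Disjoint F (D.arc x y)) :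
    Nonempty (WD (plus H {w | D.pos w ∈ closure F})) := by
  obtain ⟨f0, hf0⟩ := hF.nonempty
  have hball : ∀ w, ∃ ε > 0, (∀ v, v ≠ w → D.pos v ∉ Metric.ball (D.pos w) ε) ∧
      ∀ x y, H.Adj x y → w ≠ x → w ≠ y → Disjoint (Metric.ball (D.pos w) ε) (D.arc x y) := by
    intro w
    let C : Set (ℝ × ℝ) := (⋃ v : {v // v ≠ w}, {D.pos v}) ∪
      ⋃ z : {z : W × W // H.Adj z.1 z.2 ∧ w ≠ z.1 ∧ w ≠ z.2}, D.arc z.1.1 z.1.2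
    have hC : IsClosed C := by
      refine IsClosed.union ?_ ?_
      · exact isClosed_iUnion_of_finite (fun v => isClosed_singleton)
      · exact isClosed_iUnion_of_finite (fun z => hcl _ _ z.2.1)
    have hw : D.pos w ∈ Cᶜ := by
      rintro (h | h)
      · obtain ⟨v, hv⟩ := mem_iUnion.1 h
        exact v.2 (D.inj hv).symm
      · obtain ⟨z, hz⟩ := mem_iUnion.1 h
        exact D.off _ _ _ z.2.1 z.2.2.1 z.2.2.2 hz
    obtain ⟨ε, hε, hb⟩ := Metric.isOpen_iff.1 hC.isOpen_compl _ hw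
    refine ⟨ε, hε, fun v hv h => hb h (Or.inl (mem_iUnion.2 ⟨⟨v, hv⟩, rfl⟩)), fun x y h h1 h2 => ?_⟩
    rw [Set.disjoint_left]
    exact fun q hq hq' => hb hq (Or.inr (mem_iUnion.2 ⟨⟨(x, y), h, h1, h2⟩, hq'⟩))
  choose ε hε hb1 hb2 using hball
  have hJ : ∀ w, D.pos w ∈ closure F → JoinedIn (F ∪ Metric.ball (D.pos w) (ε w)) f0 (D.pos w) := by
    intro w hw
    obtain ⟨q, hq, hqF⟩ := mem_closure_iff.1 hw _ Metric.isOpen_ball (Metric.mem_ball_self (hε w))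
    refine ((hF.joinedIn f0 hf0 q hqF).mono subset_union_left).trans ?_
    have hc : IsPathConnected (Metric.ball (D.pos w) (ε w)) :=
      (convex_ball _ _).isPathConnected ⟨_, hq⟩
    exact (hc.joinedIn q hq _ (Metric.mem_ball_self (hε w))).mono subset_union_right
  have dF : ∀ w x y, H.Adj x y → w ≠ x → w ≠ y →
      Disjoint (F ∪ Metric.ball (D.pos w) (ε w)) (D.arc x y) := fun w x y h h1 h2 =>
    Set.disjoint_union_left.2 ⟨ha x y h, hb2 w x y h h1 h2⟩
  have oF : ∀ w v, v ≠ w → D.pos v ∉ F ∪ Metric.ball (D.pos w) (ε w) := by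
    rintro w v h (h1 | h1)
    exacts [hp v h1, hb1 w v h h1]
  refine ⟨{
    pos := fun a => match a with
      | none => f0
      | some x => D.pos x
    arc := fun a b => match a, b with
      | some x, some y => D.arc x y
      | none, some y => F ∪ Metric.ball (D.pos y) (ε y)
      | some x, none => F ∪ Metric.ball (D.pos x) (ε x)
      | none, none => ∅
    inj := ?_
    joined := ?_
    off := ?_
    disj := ?_ }⟩
  · rintro (_ | x) (_ | y) h
    · rfl
    · exact (hp y (by simp only [] at h; rw [← h]; exact hf0)).elim
    · exact (hp x (by simp only [] at h; rw [h]; exact hf0)).elim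
    · rw [D.inj h]
  · rintro (_ | x) (_ | y) h
    · exact h.elim
    · exact hJ y h
    · exact (hJ x h).symm
    · exact D.joined x y h
  · rintro (_ | x) (_ | y) (_ | v) h h1 h2
    · exact (h1 rfl).elim
    · exact h.elim
    · exact (h1 rfl).elim
    · exact oF y v (fun e => h2 (by rw [e]))
    · exact (h2 rfl).elim
    · exact oF x v (fun e => h1 (by rw [e]))
    · exact Set.disjoint_left.1 (ha x y h) hf0
    · exact D.off x y v h (fun e => h1 (by rw [e])) (fun e => h2 (by rw [e]))
  · have q : ∀ {a b : W}, some a ≠ some b → a ≠ b := fun h e => h (by rw [e])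
    rintro (_ | x) (_ | y) (_ | z) (_ | w) h h' h1 h2 h3 h4
    all_goals first
      | exact h.elim
      | exact h'.elim
      | exact (h1 rfl).elim
      | exact (h2 rfl).elim
      | exact (h3 rfl).elim
      | exact (h4 rfl).elim
      | exact dF _ _ _ h' (q h3) (q h4)
      | exact dF _ _ _ h' (q h1) (q h2)
      | exact (dF _ _ _ h (q h2).symm (q h4).symm).symm
      | exact (dF _ _ _ h (q h1).symm (q h3).symm).symm
      | exact D.disj _ _ _ _ h h' (q h1) (q h2) (q h3) (q h4)
end TL

namespace TL
variable {V : Type} {G : SimpleGraph V}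

theorem compl_ball_conn {R : ℝ} (hR : 0 < R) : IsPreconnected {q : ℝ × ℝ | R < ‖q‖} := by
  have h0 : IsConnected ({0}ᶜ : Set (ℝ × ℝ)) := by
    apply isConnected_compl_singleton_of_one_lt_rank
    rw [rank_prod']
    simp only [Module.rank_self, one_add_one_eq_two]
    exact Cardinal.one_lt_two
  have : {q : ℝ × ℝ | R < ‖q‖} = (fun y : ℝ × ℝ => (1 + R / ‖y‖) • y) '' {0}ᶜ := by
    ext q
    constructor
    · intro hq
      have hq : R < ‖q‖ := hq
      have hq0 : 0 < ‖q‖ := hR.trans hq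
      have h1 : 0 < 1 - R / ‖q‖ := by
        rw [sub_pos, div_lt_one hq0]; exact hq
      refine ⟨(1 - R / ‖q‖) • q, ?_, ?_⟩
      · intro h
        have h : (1 - R / ‖q‖) • q = 0 := h
        rcases smul_eq_zero.1 h with h | h
        · exact h1.ne' h
        · rw [h] at hq0; simp at hq0
      · have hn : ‖(1 - R / ‖q‖) • q‖ = ‖q‖ - R := by
          rw [norm_smul, Real.norm_of_nonneg h1.le]; field_simp
        have : ‖q‖ - R ≠ 0 := by linarith
        show (1 + R / ‖(1 - R / ‖q‖) • q‖) • ((1 - R / ‖q‖) • q) = q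
        rw [hn, smul_smul]
        have : (1 + R / (‖q‖ - R)) * (1 - R / ‖q‖) = 1 := by field_simp; ring
        rw [this, one_smul]
    · rintro ⟨y, hy, rfl⟩
      have hy : y ≠ 0 := hy
      have hy0 : 0 < ‖y‖ := norm_pos_iff.2 hy
      show R < ‖(1 + R / ‖y‖) • y‖
      rw [norm_smul, Real.norm_of_nonneg (by positivity), add_mul, div_mul_cancel₀ _ hy0.ne']
      linarith
  rw [this]
  apply h0.isPreconnected.image
  have h1 : ContinuousOn (fun y : ℝ × ℝ => 1 + R / ‖y‖) {0}ᶜ := by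
    apply ContinuousOn.add continuousOn_const
    apply ContinuousOn.div continuousOn_const continuous_norm.continuousOn
    intro x hx
    exact norm_ne_zero_iff.2 hx
  exact h1.smul continuousOn_id

variable (E : PlaneEmbedding G)

theorem arc_compact {e} (he : e ∈ G.edgeSet) : IsCompact (E.arc e) := by
  obtain ⟨γ, h1, _, h3, _⟩ := E.arc_is_arc e he
  rw [← h3]
  exact isCompact_Icc.image_of_continuousOn h1

theorem image_compact [Finite V] : IsCompact E.image := by
  refine (Set.finite_range _).isCompact.union ?_
  exact (Set.toFinite G.edgeSet).isCompact_biUnion (fun e he => arc_compact E he)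

theorem outer_facts [Finite V] : IsOpen E.outerFace ∧ IsPathConnected E.outerFace ∧
    Disjoint E.outerFace E.image := by
  have hc := image_compact E
  obtain ⟨R0, hR0⟩ := hc.isBounded.exists_norm_le
  obtain ⟨R, hR, hR1⟩ : ∃ R : ℝ, 0 < R ∧ ∀ x ∈ E.image, ‖x‖ ≤ R :=
    ⟨max R0 1, by positivity, fun x hx => (hR0 x hx).trans (le_max_left _ _)⟩
  have hU := compl_ball_conn hR
  have hUs : {q : ℝ × ℝ | R < ‖q‖} ⊆ E.imageᶜ := fun q hq hq' =>
    absurd (hR1 q hq') (not_le.2 hq)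
  have unb : ¬ Bornology.IsBounded {q : ℝ × ℝ | R < ‖q‖} := by
    intro h
    obtain ⟨M, hM⟩ := h.exists_norm_le
    have hmax : (0:ℝ) < max R M + 1 := by
      have := le_max_left R M
      linarith
    have := hM (max R M + 1, 0) (by
      show R < ‖((max R M + 1, 0) : ℝ × ℝ)‖
      rw [Prod.norm_def]
      apply lt_max_of_lt_left
      show R < ‖max R M + 1‖
      rw [Real.norm_of_nonneg hmax.le]
      have := le_max_left R M
      linarith)
    rw [Prod.norm_def] at this
    have h2 := (le_max_left _ _).trans this
    change ‖max R M + 1‖ ≤ M at h2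
    rw [Real.norm_of_nonneg hmax.le] at h2
    have := le_max_right R M
    linarith
  obtain ⟨q, hq⟩ : {q : ℝ × ℝ | R < ‖q‖}.Nonempty := by
    by_contra h
    rw [Set.not_nonempty_iff_eq_empty] at h
    rw [h] at unb
    exact unb Bornology.isBounded_empty
  have hsub : {q : ℝ × ℝ | R < ‖q‖} ⊆ connectedComponentIn E.imageᶜ q :=
    hU.subset_connectedComponentIn hq hUs
  have heq : E.outerFace = connectedComponentIn E.imageᶜ q := by
    ext x
    constructor
    · rintro ⟨hx, hb⟩
      have : ∃ y ∈ connectedComponentIn E.imageᶜ x, R < ‖y‖ := by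
        by_contra h
        push Not at h
        exact hb (isBounded_iff_forall_norm_le.2 ⟨R, h⟩)
      obtain ⟨y, hy, hyR⟩ := this
      have e1 := connectedComponentIn_eq hy
      have e2 := connectedComponentIn_eq (hsub hyR)
      rw [e2, ← e1]
      exact mem_connectedComponentIn hx
    · intro hx
      refine ⟨connectedComponentIn_subset _ _ hx, fun hb => ?_⟩
      rw [← connectedComponentIn_eq hx] at hb
      exact unb (hb.subset hsub)
  have ho : IsOpen E.outerFace := by
    rw [heq]
    exact hc.isClosed.isOpen_compl.connectedComponentIn
  refine ⟨ho, ?_, ?_⟩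
  · rw [← ho.isConnected_iff_isPathConnected, heq]
    exact isConnected_connectedComponentIn_iff.2 (hUs hq)
  · rw [Set.disjoint_left]
    exact fun x hx => hx.1

theorem arc_sub_image {e} (he : e ∈ G.edgeSet) : E.arc e ⊆ E.image := fun x hx =>
  Or.inr (mem_biUnion he hx)

/-- parametrisation with chosen orientation -/
theorem arc_param {x y : V} (h : G.Adj x y) : ∃ γ : ℝ → ℝ × ℝ,
    ContinuousOn γ (Icc 0 1) ∧ InjOn γ (Icc 0 1) ∧ γ '' (Icc 0 1) = E.arc s(x, y) ∧
    γ 0 = E.pos x ∧ γ 1 = E.pos y := by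
  obtain ⟨γ, h1, h2, h3, h4⟩ := E.arc_is_arc s(x, y) h
  have h5 := h4 x y rfl
  have hne : γ 0 ≠ γ 1 := fun hh => by
    have := h2 (by simp) (by simp) hh
    norm_num at this
  have a0 : γ 0 ∈ ({E.pos x, E.pos y} : Set (ℝ × ℝ)) := h5 ▸ (by simp)
  have a1 : γ 1 ∈ ({E.pos x, E.pos y} : Set (ℝ × ℝ)) := h5 ▸ (by simp)
  rcases a0 with a0 | a0
  · rcases a1 with a1 | a1
    · exact absurd (a0.trans a1.symm) hne
    · exact ⟨γ, h1, h2, h3, a0, a1⟩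
  · rcases a1 with a1 | a1
    · have hm : MapsTo (fun t : ℝ => 1 - t) (Icc 0 1) (Icc 0 1) := by
        intro t ht
        simp only [mem_Icc] at ht ⊢
        constructor <;> linarith [ht.1, ht.2]
      refine ⟨fun t => γ (1 - t), h1.comp (by fun_prop) hm, ?_, ?_, by simpa using a1, by simpa using a0⟩
      · intro s hs t ht hst
        have := h2 (hm hs) (hm ht) hst
        linarith
      · rw [← h3]
        ext z
        constructor
        · rintro ⟨t, ht, rfl⟩
          exact ⟨1 - t, hm ht, rfl⟩
        · rintro ⟨t, ht, rfl⟩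
          exact ⟨1 - t, hm ht, by simp⟩
    · exact absurd (a0.trans a1.symm) hne

theorem joined_of_param {γ : ℝ → ℝ × ℝ} {s t : ℝ} (h : ContinuousOn γ (Icc s t)) (hst : s ≤ t) :
    JoinedIn (γ '' Icc s t) (γ s) (γ t) := by
  have : IsPathConnected (γ '' Icc s t) :=
    ((convex_Icc s t).isPathConnected ⟨s, by simpa using hst⟩).image' h
  exact this.joinedIn _ ⟨s, by simpa using hst, rfl⟩ _ ⟨t, by simpa using hst, rfl⟩

/-- the drawing of `G` -/
def wdOf : WD G where
  pos := E.pos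
  arc x y := E.arc s(x, y)
  inj := E.pos_inj
  joined := by
    intro x y h
    obtain ⟨γ, h1, h2, h3, h4, h5⟩ := arc_param E h
    rw [← h3, ← h4, ← h5]
    exact joined_of_param h1 zero_le_one
  off := by
    intro x y v h h1 h2 h3
    have := E.arc_inter_pos _ h v h3
    simp at this
    tauto
  disj := by
    intro x y z w h h' h1 h2 h3 h4
    rw [Set.disjoint_left]
    intro q hq hq'
    obtain ⟨v, hv, hv', _⟩ := E.arc_inter_arc s(x, y) h s(z, w) h' (by
      intro hh
      have : x ∈ s(z, w) := hh ▸ (by simp)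
      simp at this
      tauto) q ⟨hq, hq'⟩
    simp at hv hv'
    grind

theorem noMin_plus [Finite V] : NoMin (plus G {v | E.IncOuter v}) := by
  obtain ⟨ho, hpc, hd⟩ := outer_facts E
  obtain ⟨D⟩ := (wdOf E).add E.outerFace hpc (fun x y h => (arc_compact E h).isClosed)
    (fun x hx => Set.disjoint_left.1 hd hx (Or.inl ⟨x, rfl⟩))
    (fun x y h => hd.mono_right (arc_sub_image E h))
  exact D.noMin

theorem incOuter_iff [Finite V] (v : V) : E.IncOuter v ↔ E.pos v ∈ frontier E.outerFace := by
  obtain ⟨ho, hpc, hd⟩ := outer_facts E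
  rw [ho.frontier_eq]
  exact ⟨fun h => ⟨h, fun hx => Set.disjoint_left.1 hd hx (Or.inl ⟨v, rfl⟩)⟩, fun h => h.1⟩

end TL

namespace TL
variable {V : Type} {G : SimpleGraph V}

theorem Lk.of_walk {A : Set V} {s t : V} (W : G.Walk s t) (h : ∀ z ∈ W.support, z ∈ A) :
    Lk G A s t := by
  induction W with
  | nil => exact Lk.refl (h _ (by simp))
  | cons ha W ih =>
    have h1 := ih (fun z hz => h z (by simp [hz]))
    exact (Lk.of_adj (h _ (by simp)) h1.left ha).trans h1

theorem Lk.map {U : Type} {H : SimpleGraph U} {A : Set V} {B : Set U} {s t : V} (f : V → U)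
    (h : Lk G A s t) (hf : ∀ a ∈ A, f a ∈ B)
    (ha : ∀ a ∈ A, ∀ b ∈ A, G.Adj a b → H.Adj (f a) (f b)) : Lk H B (f s) (f t) :=
  h.ind (fun y => Lk H B (f s) (f y)) (Lk.refl (hf _ h.left))
    (fun a b h1 h2 hb hab => h2.tail (hf b hb) (ha a h1.right b hb hab))

theorem two_conn_lk (h : TwoConnected G) {x s t : V} (hs : s ≠ x) (ht : t ≠ x) :
    Lk G {x}ᶜ s t := by
  by_contra hcon
  refine h.2 x ⟨s, t, hs, ht, h.1.preconnected s t, fun W => ?_⟩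
  by_contra hW
  exact hcon (Lk.of_walk W (fun z hz hzx => hW (by
    have : z = x := hzx
    rwa [this] at hz)))

/-- subdivide the edge `x y` -/
def subd (G : SimpleGraph V) (x y : V) : SimpleGraph (Option V) where
  Adj a b := match a, b with
    | some c, some d => G.Adj c d ∧ s(c, d) ≠ s(x, y)
    | none, some d => d = x ∨ d = y
    | some c, none => c = x ∨ c = y
    | none, none => False
  symm := ⟨by
    rintro (_ | c) (_ | d) h
    exacts [h, h, h, ⟨G.adj_symm h.1, by rw [Sym2.eq_swap]; exact h.2⟩]⟩
  loopless := ⟨by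
    rintro (_ | c) h
    exacts [h, G.irrefl h.1]⟩

theorem outer_edge [Finite V] (E : PlaneEmbedding G) (h2 : TwoConnected G) {x y : V}
    (hxy : G.Adj x y) (hfr : E.arc s(x, y) ⊆ frontier E.outerFace) {v u : V}
    (hv : E.IncOuter v) (hu : E.IncOuter u) (hvx : v ≠ x) (hvy : v ≠ y) (hux : u ≠ x)
    (huy : u ≠ y) : Lk G {x, y}ᶜ v u := by
  classical
  obtain ⟨ho, hpc, hd⟩ := outer_facts E
  obtain ⟨γ, g1, g2, g3, g4, g5⟩ := arc_param E hxy
  have hne : x ≠ y := hxy.ne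
  let half : V → Set (ℝ × ℝ) := fun a => if a = x then γ '' Icc 0 (1/2) else γ '' Icc (1/2) 1
  have half_x : half x = γ '' Icc 0 (1/2) := if_pos rfl
  have half_y : half y = γ '' Icc (1/2) 1 := if_neg hne.symm
  have s1 : Icc (0:ℝ) (1/2) ⊆ Icc 0 1 := Icc_subset_Icc_right (by norm_num)
  have s2 : Icc (1/2:ℝ) 1 ⊆ Icc 0 1 := Icc_subset_Icc_left (by norm_num)
  have i0 : (0:ℝ) ∈ Icc (0:ℝ) 1 := by simp
  have i1 : (1:ℝ) ∈ Icc (0:ℝ) 1 := by simp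
  have im : (1/2:ℝ) ∈ Icc (0:ℝ) 1 := by constructor <;> norm_num
  have marc : γ (1/2) ∈ E.arc s(x, y) := by rw [← g3]; exact ⟨_, im, rfl⟩
  have mpos : ∀ w, E.pos w ≠ γ (1/2) := by
    intro w hw
    have := E.arc_inter_pos s(x, y) hxy w (hw ▸ marc)
    simp only [Sym2.mem_iff] at this
    rcases this with rfl | rfl
    · have := g2 i0 im (g4.trans hw)
      norm_num at this
    · have := g2 i1 im (g5.trans hw)
      norm_num at this
  have hsub : ∀ a, half a ⊆ E.arc s(x, y) := by
    intro a
    rw [← g3]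
    by_cases h : a = x
    · rw [h, half_x]; exact image_mono s1
    · simp only [half, if_neg h]; exact image_mono s2
  have hpos : ∀ a w, (a = x ∨ a = y) → E.pos w ∈ half a → w = a := by
    intro a w ha hw
    have := E.arc_inter_pos s(x, y) hxy w (hsub a hw)
    simp only [Sym2.mem_iff] at this
    rcases ha with rfl | rfl <;> rcases this with rfl | rfl
    · rfl
    · rw [half_x] at hw
      obtain ⟨t, ht, hw⟩ := hw
      have := g2 (s1 ht) i1 (hw.trans g5.symm)
      rw [this] at ht
      have := ht.2
      norm_num at this
    · rw [half_y] at hw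
      obtain ⟨t, ht, hw⟩ := hw
      have := g2 (s2 ht) i0 (hw.trans g4.symm)
      rw [this] at ht
      have := ht.1
      norm_num at this
    · rfl
  have hjoin : ∀ a, (a = x ∨ a = y) → JoinedIn (half a) (γ (1/2)) (E.pos a) := by
    rintro a (rfl | rfl)
    · rw [half_x, ← g4]
      exact (joined_of_param (g1.mono s1) (by norm_num)).symm
    · rw [half_y, ← g5]
      exact joined_of_param (g1.mono s2) (by norm_num)
  have hclosed : ∀ a, IsClosed (half a) := by
    intro a
    by_cases h : a = x
    · rw [h, half_x]; exact (isCompact_Icc.image_of_continuousOn (g1.mono s1)).isClosed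
    · simp only [half, if_neg h]
      exact (isCompact_Icc.image_of_continuousOn (g1.mono s2)).isClosed
  have hdis : ∀ a c d, (a = x ∨ a = y) → G.Adj c d → s(c, d) ≠ s(x, y) → a ≠ c → a ≠ d →
      Disjoint (half a) (E.arc s(c, d)) := by
    intro a c d ha hcd hn hac had
    rw [Set.disjoint_left]
    intro q hq hq'
    obtain ⟨w, hw, _, hwq⟩ := E.arc_inter_arc s(c, d) hcd s(x, y) hxy hn q ⟨hq', hsub a hq⟩
    have := hpos a w ha (hwq ▸ hq)
    simp only [Sym2.mem_iff] at hw
    grind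
  have q : ∀ {a b : V}, some a ≠ some b → a ≠ b := fun h e => h (by rw [e])
  let D : WD (subd G x y) := {
    pos := fun a => match a with
      | some w => E.pos w
      | none => γ (1/2)
    arc := fun a b => match a, b with
      | some c, some d => E.arc s(c, d)
      | none, some d => half d
      | some c, none => half c
      | none, none => ∅
    inj := by
      rintro (_ | a) (_ | b) h
      · rfl
      · exact (mpos b h.symm).elim
      · exact (mpos a h).elim
      · rw [E.pos_inj h]
    joined := by
      rintro (_ | a) (_ | b) h
      · exact h.elim
      · exact hjoin b h
      · exact (hjoin a h).symm
      · exact (wdOf E).joined a b h.1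
    off := by
      rintro (_ | a) (_ | b) (_ | w) h h1 h2
      · exact (h1 rfl).elim
      · exact h.elim
      · exact (h1 rfl).elim
      · exact fun hw => h2 (by rw [hpos b w h hw])
      · exact (h2 rfl).elim
      · exact fun hw => h1 (by rw [hpos a w h hw])
      · intro hw
        obtain ⟨w, _, _, hwq⟩ := E.arc_inter_arc s(a, b) h.1 s(x, y) hxy h.2 _ ⟨hw, marc⟩
        exact mpos w hwq
      · exact (wdOf E).off a b w h.1 (q h1) (q h2)
    disj := by
      rintro (_ | a) (_ | b) (_ | c) (_ | d) h h' h1 h2 h3 h4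
      all_goals first
        | exact h.elim
        | exact h'.elim
        | exact (h1 rfl).elim
        | exact (h2 rfl).elim
        | exact (h3 rfl).elim
        | exact (h4 rfl).elim
        | exact hdis _ _ _ h h'.1 h'.2 (q h3) (q h4)
        | exact hdis _ _ _ h h'.1 h'.2 (q h1) (q h2)
        | exact (hdis _ _ _ h' h.1 h.2 (q h2).symm (q h4).symm).symm
        | exact (hdis _ _ _ h' h.1 h.2 (q h1).symm (q h3).symm).symm
        | exact (wdOf E).disj _ _ _ _ h.1 h'.1 (q h1) (q h2) (q h3) (q h4) }
  have harcD : ∀ a b, (subd G x y).Adj a b → ∃ e ∈ G.edgeSet, D.arc a b ⊆ E.arc e := by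
    rintro (_ | a) (_ | b) h
    · exact h.elim
    · exact ⟨s(x, y), hxy, hsub b⟩
    · exact ⟨s(x, y), hxy, hsub a⟩
    · exact ⟨s(a, b), h.1, Subset.rfl⟩
  obtain ⟨D'⟩ := D.add E.outerFace hpc (by
      rintro (_ | a) (_ | b) h
      · exact h.elim
      · exact hclosed b
      · exact hclosed a
      · exact (arc_compact E h.1).isClosed) (by
      rintro (_ | a) h
      · exact Set.disjoint_left.1 hd h (arc_sub_image E (e := s(x, y)) hxy marc)
      · exact Set.disjoint_left.1 hd h (Or.inl ⟨a, rfl⟩)) (by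
      intro a b h
      obtain ⟨e, he, hs⟩ := harcD a b h
      exact hd.mono_right (hs.trans (arc_sub_image E he)))
  have hN := D'.noMin
  have parc : E.pos x ∈ E.arc s(x, y) := by rw [← g3, ← g4]; exact ⟨_, i0, rfl⟩
  have parc' : E.pos y ∈ E.arc s(x, y) := by rw [← g3, ← g5]; exact ⟨_, i1, rfl⟩
  generalize hX : {w | D.pos w ∈ closure E.outerFace} = X at hN
  have mX : ∀ w, w ∈ X ↔ D.pos w ∈ closure E.outerFace := fun w => by rw [← hX]; rfl
  have nX : none ∈ X := (mX _).2 (frontier_subset_closure (hfr marc))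
  have xX : some x ∈ X := (mX _).2 (frontier_subset_closure (hfr parc))
  have yX : some y ∈ X := (mX _).2 (frontier_subset_closure (hfr parc'))
  have vX : some v ∈ X := (mX _).2 hv
  have uX : some u ∈ X := (mX _).2 hu
  clear_value D
  by_contra hcon
  let f : V → Option (Option V) := fun w => some (some w)
  have fadj : ∀ a b, G.Adj a b → a ∉ ({x, y} : Set V) → (plus (subd G x y) X).Adj (f a) (f b) := by
    intro a b hab ha
    refine ⟨hab, fun hh => ha ?_⟩
    have : a ∈ s(x, y) := hh ▸ (by simp)
    simpa using this
  have fconn : ∀ w, Conn (plus (subd G x y) X) (f '' comp G {x, y}ᶜ w) := by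
    rintro w _ ⟨a, ha, rfl⟩ _ ⟨b, hb, rfl⟩
    exact (conn_comp a ha b hb).map f (fun c hc => ⟨c, hc, rfl⟩)
      (fun c hc d _ hcd => fadj c d hcd (comp_sub hc))
  have tx : ∀ w, w ∉ ({x, y} : Set V) → Touch (plus (subd G x y) X) {f x} (f '' comp G {x, y}ᶜ w) := by
    intro w hw
    have hw' : w ≠ x ∧ w ≠ y := by simpa using hw
    obtain ⟨b, hb1, hb2, k, hk, b', hb', hkb⟩ := exit_comp (A := {y}ᶜ) (B := {x, y}ᶜ) hw
      (two_conn_lk h2 hw'.2 hne) (by simp)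
    have : b = x := by simp at hb1 hb2; tauto
    obtain rfl : b' = b := hb'
    subst this
    exact ⟨_, rfl, f k, ⟨k, hk, rfl⟩, (fadj k _ hkb (comp_sub hk)).symm⟩
  have ty : ∀ w, w ∉ ({x, y} : Set V) → Touch (plus (subd G x y) X) {f y} (f '' comp G {x, y}ᶜ w) := by
    intro w hw
    have hw' : w ≠ x ∧ w ≠ y := by simpa using hw
    obtain ⟨b, hb1, hb2, k, hk, b', hb', hkb⟩ := exit_comp (A := {x}ᶜ) (B := {x, y}ᶜ) hw
      (two_conn_lk h2 hw'.1 hne.symm) (by simp)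
    have : b = y := by simp at hb1 hb2; tauto
    obtain rfl : b' = b := hb'
    subst this
    exact ⟨_, rfl, f k, ⟨k, hk, rfl⟩, (fadj k _ hkb (comp_sub hk)).symm⟩
  have hvn : v ∉ ({x, y} : Set V) := by simp [hvx, hvy]
  have hun : u ∉ ({x, y} : Set V) := by simp [hux, huy]
  have finj : Function.Injective f := fun a b h => by simpa [f] using h
  have dK : Disjoint (comp G {x, y}ᶜ v) (comp G {x, y}ᶜ u) := by
    rw [Set.disjoint_left]
    exact fun z hz hz' => hcon (Lk.trans hz (Lk.symm hz'))
  have dx : ∀ w, Disjoint {f x} (f '' comp G {x, y}ᶜ w) := by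
    intro w
    rw [Set.disjoint_singleton_left]
    rintro ⟨z, hz, hz'⟩
    rw [finj hz'] at hz
    exact comp_sub hz (by simp)
  have dy : ∀ w, Disjoint {f y} (f '' comp G {x, y}ᶜ w) := by
    intro w
    rw [Set.disjoint_singleton_left]
    rintro ⟨z, hz, hz'⟩
    rw [finj hz'] at hz
    exact comp_sub hz (by simp)
  refine hN.k33 {f x} {f y} {none} (f '' comp G {x, y}ᶜ v) (f '' comp G {x, y}ᶜ u) {some none}
    (Conn.single _) (Conn.single _) (Conn.single _) (fconn v) (fconn u) (Conn.single _)
    ?_ ?_ ?_ ?_ ?_ ?_ (dx v) (dx u) ?_ (dy v) (dy u) ?_ ?_ ?_ ?_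
    (tx v hvn) (tx u hun) ?_ (ty v hvn) (ty u hun) ?_ ?_ ?_ ?_
  · simpa [f] using hne
  · simp [f]
  · simp [f]
  · exact (Set.disjoint_image_iff finj).2 dK
  · simp [f]
  · simp [f]
  · simp [f]
  · simp [f]
  · simp [f]
  · simp [f]
  · simp
  · exact ⟨_, rfl, _, rfl, Or.inl rfl⟩
  · exact ⟨_, rfl, _, rfl, Or.inr rfl⟩
  · exact ⟨_, rfl, f v, ⟨v, mem_comp hvn, rfl⟩, vX⟩
  · exact ⟨_, rfl, f u, ⟨u, mem_comp hun, rfl⟩, uX⟩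
  · exact ⟨_, rfl, _, rfl, nX⟩

end TL

/-- the main theorem. The precolored subgraph `S` of the canvas has two
components: a path `P` (given by the walk `P` from `a` to `b`) and an isolated
vertex `u` with a list of size at least two; all vertices of `P` have the same list
`L₀` of size two. Then `G` is `L`-colorable unless `L u = L₀` and `V(S)` induces an
odd cycle in `G`. -/
theorem two_lists_of_size_two_strong {V : Type} [Fintype V] (G : SimpleGraph V)
    (E : PlaneEmbedding G) (S : SimpleGraph.Subgraph G) (L : V → Finset ℕ)
    (hcv : IsCanvas G E S L)
    (a b u : V) (P : G.Walk a b) (hP : P.IsPath) (hu : u ∉ P.support)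
    (hSverts : S.verts = {v : V | v ∈ P.support} ∪ {u})
    (hSadj : ∀ x y : V, S.Adj x y ↔ s(x, y) ∈ P.edges)
    (hLu : 2 ≤ (L u).card)
    (h2conn : 1 ≤ P.length → TwoConnected G)
    (hint : 1 ≤ P.length → ∀ v ∈ P.support, v ≠ a → v ≠ b → ¬ G.Adj u v)
    (hchord : 1 ≤ P.length → ∀ x y : V, IsChord E x y →
      (x ∈ P.support ∨ y ∈ P.support) →
      ∀ v ∈ P.support, ¬ SeparatesEdge G x y v u)
    (L₀ : Finset ℕ) (hL₀ : L₀.card = 2) (hLP : ∀ v ∈ P.support, L v = L₀) :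
    (∃ φ : V → ℕ, IsLColoring G L φ) ∨
      (L u = L₀ ∧ ∃ (w : V) (D : G.Walk w w), D.IsCycle ∧ Odd D.length ∧
        {v : V | v ∈ D.support} = S.verts ∧
        ∀ x y : V, x ∈ S.verts → y ∈ S.verts → G.Adj x y → s(x, y) ∈ D.edges) := by
  classical
  obtain ⟨c1, c2, c3, c4, c5, c6⟩ := hcv
  let X : Set V := {v | E.IncOuter v}
  have hN : TL.NoMin (TL.plus G X) := TL.noMin_plus E
  have hnb : ∀ v : V, some v ∈ TL.nb (TL.plus G X) {none} ↔ E.IncOuter v := fun v => TL.nb_single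
  have hPS : ∀ i, P.getVert i ∈ P.support := fun i => P.getVert_mem_support i
  have hsup : ∀ v ∈ P.support, ∃ i, i < P.length + 1 ∧ P.getVert i = v := by
    intro v hv
    obtain ⟨i, hi, hi'⟩ := SimpleGraph.Walk.mem_support_iff_exists_getVert.1 hv
    exact ⟨i, by omega, hi⟩
  have hPX : ∀ v ∈ P.support, E.IncOuter v := fun v hv =>
    (TL.incOuter_iff E v).2 (c2 v (by rw [hSverts]; exact Or.inl hv))
  have huX : E.IncOuter u := (TL.incOuter_iff E u).2 (c2 u (by rw [hSverts]; exact Or.inr rfl))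
  have hinj : ∀ i j, i < P.length + 1 → j < P.length + 1 → P.getVert i = P.getVert j → i = j :=
    fun i j hi hj h => hP.getVert_injOn (show i ≤ P.length by omega) (show j ≤ P.length by omega) h
  have hlift : ∀ (R : Set V) (Q : Set (Option V)) (s t : V), (∀ v, some v ∈ Q → v ∈ R) →
      TL.Lk G Rᶜ s t → TL.Lk (TL.plus G X) (range some \ Q) (some s) (some t) := by
    intro R Q s t hR h
    exact h.map some (fun w hw => ⟨⟨w, rfl⟩, fun hq => hw (hR w hq)⟩) (fun a _ b _ hab => hab)
  have hMH : TL.MH (TL.plus G X) (range some) {none} (fun o => o.elim ∅ L) L₀ (P.length + 1)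
      (fun i => some (P.getVert i)) (some u) := by
    refine ⟨TL.Conn.single _, ?_, by omega, ?_, fun i _ => ⟨_, rfl⟩, ?_, ?_, ⟨u, rfl⟩, (hnb u).2 huX,
      ?_, hL₀, ?_, hLu, ?_, ?_, ?_, ?_⟩
    · simp
    · intro i j hi hj h
      exact hinj i j hi hj (Option.some.inj h)
    · exact fun i _ => (hnb _).2 (hPX _ (hPS i))
    · exact fun i hi => P.adj_getVert_succ (by omega)
    · intro i _ h
      apply hu
      rw [Option.some.inj h]
      exact hPS i
    · intro i _
      show L₀ ⊆ L (P.getVert i)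
      rw [hLP _ (hPS i)]
    · rintro _ ⟨v, rfl⟩ hvu hv
      refine c5 v ?_
      rw [hSverts]
      rintro (h | h)
      · obtain ⟨i, hi, h⟩ := hsup v h
        exact hv i hi (by rw [h])
      · exact hvu (by rw [show v = u from h])
    · rintro _ ⟨v, rfl⟩ hv
      exact c4 v (fun h => hv ((hnb v).2 h))
    · intro hk Q hQ hQA hQZ hcase huQ i hi hpi
      have hl : 1 ≤ P.length := by omega
      have h2 := h2conn hl
      rcases hQ with rfl | ⟨x, rfl⟩ | ⟨x, y, hxy, rfl⟩
      · refine hlift ∅ ∅ _ _ (fun v hv => hv) ?_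
        obtain ⟨W⟩ := h2.1.preconnected (P.getVert i) u
        exact TL.Lk.of_walk W (fun z _ => fun hz => hz)
      · obtain ⟨x, rfl⟩ := hQA rfl
        refine hlift {x} _ _ _ (fun v hv => Option.some.inj hv) ?_
        exact TL.two_conn_lk h2 (fun h => hpi (by show some _ = some x; rw [h]))
          (fun h => huQ (by show some _ = some x; rw [h]))
      · obtain ⟨x, rfl⟩ := hQA (Or.inl rfl)
        obtain ⟨y, rfl⟩ := hQA (Or.inr rfl)
        have hxy : G.Adj x y := hxy
        have xX : E.IncOuter x := (hnb x).1 (hQZ (Or.inl rfl))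
        have yX : E.IncOuter y := (hnb y).1 (hQZ (Or.inr rfl))
        have n1 : P.getVert i ≠ x := fun h => hpi (Or.inl (by show some _ = some x; rw [h]))
        have n2 : P.getVert i ≠ y := fun h => hpi (Or.inr (by show some _ = some y; rw [h]))
        have n3 : u ≠ x := fun h => huQ (Or.inl (by show some _ = some x; rw [h]))
        have n4 : u ≠ y := fun h => huQ (Or.inr (by show some _ = some y; rw [h]))
        refine hlift {x, y} _ _ _ ?_ ?_
        · rintro v (h | h)
          · exact Or.inl (Option.some.inj h)
          · exact Or.inr (Option.some.inj h)
        have hcase' : x ∈ P.support ∨ y ∈ P.support := by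
          rcases hcase with h | ⟨z, h⟩ | ⟨j, _, h | h⟩
          · exact absurd h (Set.insert_nonempty _ _).ne_empty
          · have e1 : some x ∈ ({z} : Set (Option V)) := h ▸ Or.inl rfl
            have e2 : some y ∈ ({z} : Set (Option V)) := h ▸ Or.inr rfl
            exact absurd (Option.some.inj ((show some x = z from e1).trans (show some y = z from e2).symm)) hxy.ne
          · left
            rw [← Option.some.inj h]
            exact hPS j
          · right
            rw [← Option.some.inj h]
            exact hPS j
        by_cases hfr : E.arc s(x, y) ⊆ frontier E.outerFace
        · exact TL.outer_edge E h2 hxy hfr (hPX _ (hPS i)) huX n1 n2 n3 n4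
        · have := hchord hl x y ⟨hxy, (TL.incOuter_iff E x).1 xX, (TL.incOuter_iff E y).1 yX, hfr⟩
            hcase' _ (hPS i)
          by_contra hcon
          refine this ⟨n1, n2, n3, n4, fun W => ?_⟩
          by_contra hW
          push Not at hW
          refine hcon (TL.Lk.of_walk W (fun z hz hzq => ?_))
          rcases hzq with h | h
          · rw [show z = x from h] at hz; exact hW.1 hz
          · rw [show z = y from h] at hz; exact hW.2 hz
    · intro hk i h0 hi hadj
      refine hint (by omega) _ (hPS i) ?_ ?_ hadj
      · intro h
        have := hinj i 0 (by omega) (by omega) (by rw [h]; simp)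
        omega
      · intro h
        have := hinj i P.length (by omega) (by omega) (by rw [h]; simp)
        omega
  rcases TL.main_MH hN hMH with ⟨φ, hφ1, hφ2⟩ | ⟨e1, e2, e3, e4⟩
  · left
    exact ⟨fun v => φ (some v), fun v => hφ1 (some v) ⟨v, rfl⟩,
      fun x y hxy => hφ2 (some x) ⟨x, rfl⟩ (some y) ⟨y, rfl⟩ hxy⟩
  · right
    have hua : G.Adj u a := by
      have h : G.Adj u (P.getVert 0) := e3
      simpa using h
    have hbu : G.Adj b u := by
      have h : G.Adj u (P.getVert (P.length + 1 - 1)) := e4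
      simpa using h.symm
    have hlen : 1 ≤ P.length := by
      rcases e2 with ⟨m, hm⟩
      omega
    have hab : a ≠ b := by
      intro h
      have := hinj 0 P.length (by omega) (by omega) (by simp [h])
      omega
    refine ⟨e1, u, SimpleGraph.Walk.cons hua (P.concat hbu), ?_, ?_, ?_, ?_⟩
    · rw [SimpleGraph.Walk.cons_isCycle_iff, SimpleGraph.Walk.concat_isPath_iff]
      refine ⟨⟨hP, hu⟩, ?_⟩
      rw [SimpleGraph.Walk.edges_concat]
      intro h
      simp only [List.concat_eq_append, List.mem_append, List.mem_singleton] at h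
      rcases h with h | h
      · exact hu (P.fst_mem_support_of_mem_edges h)
      · simp only [Sym2.eq_iff] at h
        rcases h with ⟨h, _⟩ | ⟨_, h⟩
        · exact hbu.ne h.symm
        · exact hab h
    · rw [SimpleGraph.Walk.length_cons, SimpleGraph.Walk.length_concat]
      exact e2.add_one
    · rw [hSverts]
      ext v
      simp only [SimpleGraph.Walk.support_cons, SimpleGraph.Walk.support_concat]
      simp
      tauto
    · have key : ∀ v ∈ P.support, G.Adj u v → v = a ∨ v = b := by
        intro v hv h
        by_contra hcon
        push Not at hcon
        exact hint hlen v hv hcon.1 hcon.2 h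
      have hedge : ∀ e, e ∈ (SimpleGraph.Walk.cons hua (P.concat hbu)).edges ↔
          e = s(u, a) ∨ e ∈ P.edges ∨ e = s(b, u) := by
        intro e
        simp [SimpleGraph.Walk.edges_concat]
      have hu1 : ∀ v ∈ P.support, G.Adj u v →
          s(u, v) ∈ (SimpleGraph.Walk.cons hua (P.concat hbu)).edges := by
        intro v hv h
        rw [hedge]
        rcases key v hv h with rfl | rfl
        · exact Or.inl rfl
        · exact Or.inr (Or.inr Sym2.eq_swap)
      have hlt : ∀ i j, i < j → j < P.length + 1 → G.Adj (P.getVert i) (P.getVert j) →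
          s(P.getVert i, P.getVert j) ∈ P.edges := by
        intro i j hij hj h
        by_cases h1 : i + 1 < j
        · exact absurd h (TL.MH.induced hN hMH h1 hj)
        · obtain rfl : j = i + 1 := by omega
          rw [SimpleGraph.Walk.mk_mem_edges_iff_exists]
          exact ⟨i, by omega, rfl⟩
      intro x y hx hy hxy
      rw [hSverts] at hx hy
      rcases hx with hx | hx
      · rcases hy with hy | hy
        · obtain ⟨i, hi, rfl⟩ := hsup x hx
          obtain ⟨j, hj, rfl⟩ := hsup y hy
          rw [hedge]
          refine Or.inr (Or.inl ?_)
          rcases lt_trichotomy i j with h | h | h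
          · exact hlt i j h hj hxy
          · subst h
            exact absurd rfl hxy.ne
          · rw [Sym2.eq_swap]
            exact hlt j i h hi hxy.symm
        · obtain rfl : y = u := hy
          rw [Sym2.eq_swap]
          exact hu1 x hx hxy.symm
      · obtain rfl : x = u := hx
        rcases hy with hy | hy
        · exact hu1 y hy hxy
        · obtain rfl : y = x := hy
          exact absurd rfl hxy.ne
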